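/- arXiv:1401.3232 — 2 statements merged into one kernel-verified Lean document; each statement's English description precedes it below -/
import Mathlib

section
/- (Prenex normal form theorem.) Let C ⊆ {=(…), ⊥_c, ⊆} and let φ be a sentence of FO(C) in which every variable is quantified exactly once and at most k universal quantifiers occur (φ ∈ FO(C)(k∀)). Then there is a sentence φ′ of FO({=(…)} ∪ C)(k∀), logically equivalent to φ under strict team semantics over all structures with at least two elements, of the form ∀x₁ … ∀x_m ∃x_{m+1} … ∃x_{m+n} (χ ∧ θ), where m ≤ k, χ is a conjunction of dependence, independence and inclusion atoms from {=(…)} ∪ C, and θ is a quantifier-free first-order formula. -/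
open FirstOrder FirstOrder.Language FirstOrder.Language.Structure

namespace TeamSem

universe u v w

/-- Formulas of team logic in negation normal form over a first-order language `L`,
with variables in `ℕ`: first-order literals, dependence atoms `=(x̄, y)`,
conditional independence atoms `ȳ ⊥_{x̄} z̄`, inclusion atoms `x̄ ⊆ ȳ`,
conjunction, disjunction and quantifiers. -/
inductive TF (L : FirstOrder.Language.{u, v}) : Type (max u v) where
  | rel : {n : ℕ} → L.Relations n → (Fin n → L.Term ℕ) → TF L
  | nrel : {n : ℕ} → L.Relations n → (Fin n → L.Term ℕ) → TF L
  | teq : L.Term ℕ → L.Term ℕ → TF L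
  | tne : L.Term ℕ → L.Term ℕ → TF L
  | dep : List ℕ → ℕ → TF L
  | indep : List ℕ → List ℕ → List ℕ → TF L
  | inc : List ℕ → List ℕ → TF L
  | and : TF L → TF L → TF L
  | or : TF L → TF L → TF L
  | ex : ℕ → TF L → TF L
  | all : ℕ → TF L → TF L

variable {L : FirstOrder.Language.{u, v}}

/-- The variables occurring in a term. -/
def tvars : L.Term ℕ → Set ℕ
  | .var n => {n}
  | .func _ ts => ⋃ i, tvars (ts i)

/-- Realization of a term under a partial assignment (an assignment whose domain is
the set of variables where it takes a `some` value). -/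
def oreal {M : Type w} [L.Structure M] (s : ℕ → Option M) : L.Term ℕ → Option M
  | .var n => s n
  | .func f ts =>
      if h : ∀ i, (oreal s (ts i)).isSome then
        some (funMap f fun i => (oreal s (ts i)).get (h i))
      else none

/-- The set of free variables of a team-logic formula. -/
def freeVars : TF L → Set ℕ
  | .rel _ ts => ⋃ i, tvars (ts i)
  | .nrel _ ts => ⋃ i, tvars (ts i)
  | .teq t u => tvars t ∪ tvars u
  | .tne t u => tvars t ∪ tvars u
  | .dep xs y => {n | n ∈ xs} ∪ {y}
  | .indep xs ys zs => {n | n ∈ xs ++ ys ++ zs}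
  | .inc xs ys => {n | n ∈ xs ++ ys}
  | .and φ ψ => freeVars φ ∪ freeVars ψ
  | .or φ ψ => freeVars φ ∪ freeVars ψ
  | .ex v φ => freeVars φ \ {v}
  | .all v φ => freeVars φ \ {v}

/-- The list of quantified (bound) variables of a formula, with multiplicity. -/
def boundVars : TF L → List ℕ
  | .and φ ψ => boundVars φ ++ boundVars ψ
  | .or φ ψ => boundVars φ ++ boundVars ψ
  | .ex v φ => v :: boundVars φ
  | .all v φ => v :: boundVars φ
  | _ => []

/-- The number of universal quantifiers occurring in a formula. -/
def uCount : TF L → ℕ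
  | .and φ ψ => uCount φ + uCount ψ
  | .or φ ψ => uCount φ + uCount ψ
  | .ex _ φ => uCount φ
  | .all _ φ => uCount φ + 1
  | _ => 0

/-- A dependence atom occurs in the formula. -/
def hasDep : TF L → Prop
  | .dep _ _ => True
  | .and φ ψ => hasDep φ ∨ hasDep ψ
  | .or φ ψ => hasDep φ ∨ hasDep ψ
  | .ex _ φ => hasDep φ
  | .all _ φ => hasDep φ
  | _ => False

/-- An independence atom occurs in the formula. -/
def hasIndep : TF L → Prop
  | .indep _ _ _ => True
  | .and φ ψ => hasIndep φ ∨ hasIndep ψ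
  | .or φ ψ => hasIndep φ ∨ hasIndep ψ
  | .ex _ φ => hasIndep φ
  | .all _ φ => hasIndep φ
  | _ => False

/-- An inclusion atom occurs in the formula. -/
def hasInc : TF L → Prop
  | .inc _ _ => True
  | .and φ ψ => hasInc φ ∨ hasInc ψ
  | .or φ ψ => hasInc φ ∨ hasInc ψ
  | .ex _ φ => hasInc φ
  | .all _ φ => hasInc φ
  | _ => False

/-- Quantifier-free formulas. -/
def quantFree : TF L → Prop
  | .and φ ψ => quantFree φ ∧ quantFree ψ
  | .or φ ψ => quantFree φ ∧ quantFree ψ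
  | .ex _ _ => False
  | .all _ _ => False
  | _ => True

/-- First-order formulas: no dependence, independence or inclusion atoms. -/
def isFO : TF L → Prop
  | .dep _ _ => False
  | .indep _ _ _ => False
  | .inc _ _ => False
  | .and φ ψ => isFO φ ∧ isFO ψ
  | .or φ ψ => isFO φ ∧ isFO ψ
  | .ex _ φ => isFO φ
  | .all _ φ => isFO φ
  | _ => True

/-- A dependency atom (dependence, independence or inclusion atom). -/
def isAtom : TF L → Prop
  | .dep _ _ => True
  | .indep _ _ _ => True
  | .inc _ _ => True
  | _ => False

/-- A conjunction of dependency atoms. -/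
def isAtomConj : TF L → Prop
  | .and φ ψ => isAtomConj φ ∧ isAtomConj ψ
  | φ => isAtom φ

/-- Strict team semantics.  A team is a set of partial assignments `ℕ → Option M`;
a variable is in the domain of an assignment iff the assignment gives it a `some`
value. -/
def strictSat (M : Type w) [L.Structure M] : Set (ℕ → Option M) → TF L → Prop
  | X, .rel R ts => ∀ s ∈ X, ∃ v, (∀ i, oreal s (ts i) = some (v i)) ∧ RelMap R v
  | X, .nrel R ts => ∀ s ∈ X, ∃ v, (∀ i, oreal s (ts i) = some (v i)) ∧ ¬ RelMap R v
  | X, .teq t u => ∀ s ∈ X, ∃ a : M, oreal s t = some a ∧ oreal s u = some a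
  | X, .tne t u => ∀ s ∈ X, ∃ a b : M, oreal s t = some a ∧ oreal s u = some b ∧ a ≠ b
  | X, .dep xs y => ∀ s ∈ X, ∀ s' ∈ X, xs.map s = xs.map s' → s y = s' y
  | X, .indep xs ys zs => ∀ s ∈ X, ∀ s' ∈ X, xs.map s = xs.map s' →
      ∃ s'' ∈ X, xs.map s'' = xs.map s ∧ ys.map s'' = ys.map s ∧ zs.map s'' = zs.map s'
  | X, .inc xs ys => ∀ s ∈ X, ∃ s' ∈ X, xs.map s = ys.map s'
  | X, .and φ ψ => strictSat M X φ ∧ strictSat M X ψ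
  | X, .or φ ψ => ∃ Y Z, Y ∪ Z = X ∧ Y ∩ Z = ∅ ∧ strictSat M Y φ ∧ strictSat M Z ψ
  | X, .ex v φ => ∃ F : (ℕ → Option M) → M,
      strictSat M ((fun s => Function.update s v (some (F s))) '' X) φ
  | X, .all v φ =>
      strictSat M {t | ∃ s ∈ X, ∃ m : M, t = Function.update s v (some m)} φ

/-- Lax team semantics: the splitting in the disjunction need not be disjoint, and
the existential quantifier may pick a nonempty set of witnesses for each assignment. -/
def laxSat (M : Type w) [L.Structure M] : Set (ℕ → Option M) → TF L → Prop
  | X, .rel R ts => ∀ s ∈ X, ∃ v, (∀ i, oreal s (ts i) = some (v i)) ∧ RelMap R v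
  | X, .nrel R ts => ∀ s ∈ X, ∃ v, (∀ i, oreal s (ts i) = some (v i)) ∧ ¬ RelMap R v
  | X, .teq t u => ∀ s ∈ X, ∃ a : M, oreal s t = some a ∧ oreal s u = some a
  | X, .tne t u => ∀ s ∈ X, ∃ a b : M, oreal s t = some a ∧ oreal s u = some b ∧ a ≠ b
  | X, .dep xs y => ∀ s ∈ X, ∀ s' ∈ X, xs.map s = xs.map s' → s y = s' y
  | X, .indep xs ys zs => ∀ s ∈ X, ∀ s' ∈ X, xs.map s = xs.map s' →
      ∃ s'' ∈ X, xs.map s'' = xs.map s ∧ ys.map s'' = ys.map s ∧ zs.map s'' = zs.map s'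
  | X, .inc xs ys => ∀ s ∈ X, ∃ s' ∈ X, xs.map s = ys.map s'
  | X, .and φ ψ => laxSat M X φ ∧ laxSat M X ψ
  | X, .or φ ψ => ∃ Y Z, Y ∪ Z = X ∧ laxSat M Y φ ∧ laxSat M Z ψ
  | X, .ex v φ => ∃ H : (ℕ → Option M) → Set M, (∀ s ∈ X, (H s).Nonempty) ∧
      laxSat M {t | ∃ s ∈ X, ∃ m ∈ H s, t = Function.update s v (some m)} φ
  | X, .all v φ =>
      laxSat M {t | ∃ s ∈ X, ∃ m : M, t = Function.update s v (some m)} φ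

/-- Ordinary (Tarskian) first-order satisfaction by a single assignment, for
first-order formulas.  (The value on the dependency atoms is irrelevant.) -/
def foSat (M : Type w) [L.Structure M] : (ℕ → Option M) → TF L → Prop
  | s, .rel R ts => ∃ v, (∀ i, oreal s (ts i) = some (v i)) ∧ RelMap R v
  | s, .nrel R ts => ∃ v, (∀ i, oreal s (ts i) = some (v i)) ∧ ¬ RelMap R v
  | s, .teq t u => ∃ a : M, oreal s t = some a ∧ oreal s u = some a
  | s, .tne t u => ∃ a b : M, oreal s t = some a ∧ oreal s u = some b ∧ a ≠ b
  | s, .and φ ψ => foSat M s φ ∧ foSat M s ψ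
  | s, .or φ ψ => foSat M s φ ∨ foSat M s ψ
  | s, .ex v φ => ∃ m : M, foSat M (Function.update s v (some m)) φ
  | s, .all v φ => ∀ m : M, foSat M (Function.update s v (some m)) φ
  | _, _ => True

/-- The empty assignment. -/
def emptyAssign (M : Type w) : ℕ → Option M := fun _ => none

/-- A sentence `φ` is true in `M` if the team `{∅}` consisting of the empty
assignment satisfies `φ` (strict semantics). -/
def tTrue (M : Type w) [L.Structure M] (φ : TF L) : Prop :=
  strictSat M {emptyAssign M} φ

/-- A sentence of `FO(C)(k∀)`: every variable is quantified exactly once, it has no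
free variables, and at most `k` universal quantifiers occur. -/
def sentenceKAll (φ : TF L) (k : ℕ) : Prop :=
  freeVars φ = ∅ ∧ (boundVars φ).Nodup ∧ uCount φ ≤ k

/-- Universal quantifier block. -/
def alls : List ℕ → TF L → TF L
  | [], φ => φ
  | v :: vs, φ => .all v (alls vs φ)

/-- Existential quantifier block. -/
def exs : List ℕ → TF L → TF L
  | [], φ => φ
  | v :: vs, φ => .ex v (exs vs φ)

end TeamSem

namespace TeamSem

section Prenex

variable {L : FirstOrder.Language.{u, v}}

/-- agreement on a list of variables -/
def Ag {M : Type w} (D : List ℕ) (g g' : ℕ → M) : Prop := ∀ x ∈ D, g x = g' x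

/-- semantics over families indexed by valuations of the universal variables -/
def gSat (M : Type w) [L.Structure M] :
    List ℕ → Set (ℕ → M) → ((ℕ → M) → ℕ → M) → TF L → Prop
  | _, U, r, .rel R ts => ∀ g ∈ U, RelMap R fun i => (ts i).realize (r g)
  | _, U, r, .nrel R ts => ∀ g ∈ U, ¬ RelMap R fun i => (ts i).realize (r g)
  | _, U, r, .teq t u => ∀ g ∈ U, t.realize (r g) = u.realize (r g)
  | _, U, r, .tne t u => ∀ g ∈ U, t.realize (r g) ≠ u.realize (r g)
  | _, U, r, .dep xs y => ∀ g ∈ U, ∀ g' ∈ U, xs.map (r g) = xs.map (r g') → r g y = r g' y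
  | _, U, r, .indep xs ys zs => ∀ g ∈ U, ∀ g' ∈ U, xs.map (r g) = xs.map (r g') →
      ∃ g'' ∈ U, xs.map (r g'') = xs.map (r g) ∧ ys.map (r g'') = ys.map (r g) ∧
        zs.map (r g'') = zs.map (r g')
  | _, U, r, .inc xs ys => ∀ g ∈ U, ∃ g' ∈ U, xs.map (r g) = ys.map (r g')
  | D, U, r, .and φ ψ => gSat M D U r φ ∧ gSat M D U r ψ
  | D, U, r, .or φ ψ => ∃ P : Set (ℕ → M), (∀ g g', Ag D g g' → g ∈ P → g' ∈ P) ∧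
      gSat M D (U ∩ P) r φ ∧ gSat M D (U \ P) r ψ
  | D, U, r, .ex v φ => ∃ F : (ℕ → M) → M, (∀ g g', Ag D g g' → F g = F g') ∧
      gSat M D U (fun g => Function.update (r g) v (F g)) φ
  | D, U, r, .all v φ => gSat M (v :: D) U (fun g => Function.update (r g) v (g v)) φ

theorem Ag.symm {M : Type w} {D : List ℕ} {g g' : ℕ → M} (h : Ag D g g') : Ag D g' g :=
  fun x hx => (h x hx).symm

theorem oreal_eq {M : Type w} [L.Structure M] (s : ℕ → Option M) (r : ℕ → M) (t : L.Term ℕ)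
    (h : ∀ v ∈ tvars t, s v = some (r v)) : oreal s t = some (t.realize r) := by
  induction t with
  | var n => simpa [oreal, tvars] using h n (by simp [tvars])
  | func f ts ih =>
    have h' : ∀ i, oreal s (ts i) = some ((ts i).realize r) := fun i =>
      ih i fun v hv => h v (by simp only [tvars, Set.mem_iUnion]; exact ⟨i, hv⟩)
    simp [oreal, h', Term.realize]

theorem realize_congr {M : Type w} [L.Structure M] (r r' : ℕ → M) (t : L.Term ℕ)
    (h : ∀ v ∈ tvars t, r v = r' v) : t.realize r = t.realize r' := by
  induction t with
  | var n => simpa [tvars] using h n (by simp [tvars])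
  | func f ts ih =>
    have h' : ∀ i, (ts i).realize r = (ts i).realize r' := fun i =>
      ih i fun v hv => h v (by simp only [tvars, Set.mem_iUnion]; exact ⟨i, hv⟩)
    simp [h', Term.realize]

theorem map_some {M : Type w} (xs : List ℕ) (s : ℕ → Option M) (r : ℕ → M)
    (h : ∀ v ∈ xs, s v = some (r v)) : xs.map s = (xs.map r).map some := by
  rw [List.map_map]; exact List.map_congr_left h

theorem map_some_inj {M : Type w} (xs ys : List M) :
    xs.map some = ys.map some ↔ xs = ys :=
  (List.map_injective_iff.2 (Option.some_injective M)).eq_iff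

/-- Lemma A -/
theorem strict_iff_gSat {M : Type w} [L.Structure M] [Nonempty M] (φ : TF L) :
    ∀ (D : List ℕ) (U : Set (ℕ → M)) (s : (ℕ → M) → ℕ → Option M) (r : (ℕ → M) → ℕ → M),
    (∀ g, ∀ x ∈ D, s g x = some (g x)) →
    (∀ g g', Ag D g g' → s g = s g') →
    (∀ g g', Ag D g g' → g ∈ U → g' ∈ U) →
    (∀ v ∈ D, v ∉ boundVars φ) → (boundVars φ).Nodup →
    (∀ g, ∀ v ∈ freeVars φ, s g v = some (r g v)) →
    (strictSat M (s '' U) φ ↔ gSat M D U r φ) := by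
  induction φ with
  | rel R ts =>
    intro D U s r h1 h2 h3 h4 h5 h6
    have : ∀ g i, oreal (s g) (ts i) = some ((ts i).realize (r g)) := fun g i =>
      oreal_eq _ _ _ fun v hv => h6 g v (by simp only [freeVars, Set.mem_iUnion]; exact ⟨i, hv⟩)
    simp only [strictSat, gSat, Set.forall_mem_image, this, Option.some.injEq]
    refine forall₂_congr fun g _ => ⟨?_, fun h => ⟨_, fun _ => rfl, h⟩⟩
    rintro ⟨v, hv, h⟩
    rwa [show v = _ from (funext hv).symm] at h
  | nrel R ts =>
    intro D U s r h1 h2 h3 h4 h5 h6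
    have : ∀ g i, oreal (s g) (ts i) = some ((ts i).realize (r g)) := fun g i =>
      oreal_eq _ _ _ fun v hv => h6 g v (by simp only [freeVars, Set.mem_iUnion]; exact ⟨i, hv⟩)
    simp only [strictSat, gSat, Set.forall_mem_image, this, Option.some.injEq]
    refine forall₂_congr fun g _ => ⟨?_, fun h => ⟨_, fun _ => rfl, h⟩⟩
    rintro ⟨v, hv, h⟩
    rwa [show v = _ from (funext hv).symm] at h
  | teq t u =>
    intro D U s r h1 h2 h3 h4 h5 h6
    have ht : ∀ g, oreal (s g) t = some (t.realize (r g)) := fun g =>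
      oreal_eq _ _ _ fun v hv => h6 g v (Or.inl hv)
    have hu : ∀ g, oreal (s g) u = some (u.realize (r g)) := fun g =>
      oreal_eq _ _ _ fun v hv => h6 g v (Or.inr hv)
    simp only [strictSat, gSat, Set.forall_mem_image, ht, hu, Option.some.injEq]
    simp [eq_comm]
  | tne t u =>
    intro D U s r h1 h2 h3 h4 h5 h6
    have ht : ∀ g, oreal (s g) t = some (t.realize (r g)) := fun g =>
      oreal_eq _ _ _ fun v hv => h6 g v (Or.inl hv)
    have hu : ∀ g, oreal (s g) u = some (u.realize (r g)) := fun g =>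
      oreal_eq _ _ _ fun v hv => h6 g v (Or.inr hv)
    simp only [strictSat, gSat, Set.forall_mem_image, ht, hu, Option.some.injEq]
    simp
  | dep xs y =>
    intro D U s r h1 h2 h3 h4 h5 h6
    have hx : ∀ g, xs.map (s g) = (xs.map (r g)).map some := fun g =>
      map_some _ _ _ fun v hv => h6 g v (Or.inl hv)
    have hy : ∀ g, s g y = some (r g y) := fun g => h6 g y (Or.inr rfl)
    simp only [strictSat, gSat, Set.forall_mem_image, hx, hy, Option.some.injEq, map_some_inj]
  | indep xs ys zs =>
    intro D U s r h1 h2 h3 h4 h5 h6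
    simp only [freeVars, List.mem_append, Set.mem_ofPred_eq] at h6
    have hx : ∀ g, xs.map (s g) = (xs.map (r g)).map some := fun g =>
      map_some _ _ _ fun v hv => h6 g v (by tauto)
    have hy : ∀ g, ys.map (s g) = (ys.map (r g)).map some := fun g =>
      map_some _ _ _ fun v hv => h6 g v (by tauto)
    have hz : ∀ g, zs.map (s g) = (zs.map (r g)).map some := fun g =>
      map_some _ _ _ fun v hv => h6 g v (by tauto)
    simp only [strictSat, gSat, Set.forall_mem_image, Set.exists_mem_image, hx, hy, hz,
      map_some_inj]
  | inc xs ys =>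
    intro D U s r h1 h2 h3 h4 h5 h6
    simp only [freeVars, List.mem_append, Set.mem_ofPred_eq] at h6
    have hx : ∀ g, xs.map (s g) = (xs.map (r g)).map some := fun g =>
      map_some _ _ _ fun v hv => h6 g v (by tauto)
    have hy : ∀ g, ys.map (s g) = (ys.map (r g)).map some := fun g =>
      map_some _ _ _ fun v hv => h6 g v (by tauto)
    simp only [strictSat, gSat, Set.forall_mem_image, Set.exists_mem_image, hx, hy,
      map_some_inj]
  | and φ ψ ihφ ihψ =>
    intro D U s r h1 h2 h3 h4 h5 h6
    simp only [boundVars, List.nodup_append, List.mem_append] at h4 h5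
    exact and_congr (ihφ D U s r h1 h2 h3 (fun v hv => fun h => h4 v hv (Or.inl h)) h5.1
        fun g v hv => h6 g v (Or.inl hv))
      (ihψ D U s r h1 h2 h3 (fun v hv => fun h => h4 v hv (Or.inr h)) h5.2.1
        fun g v hv => h6 g v (Or.inr hv))
  | or φ ψ ihφ ihψ =>
    intro D U s r h1 h2 h3 h4 h5 h6
    simp only [boundVars, List.nodup_append, List.mem_append] at h4 h5
    have hinj : ∀ g g', s g = s g' → Ag D g g' := fun g g' h x hx => by
      have := congrFun h x
      rw [h1 g x hx, h1 g' x hx] at this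
      exact Option.some.inj this
    have key : ∀ P : Set (ℕ → M), (∀ g g', Ag D g g' → g ∈ P → g' ∈ P) →
        ((strictSat M (s '' (U ∩ P)) φ ↔ gSat M D (U ∩ P) r φ) ∧
         (strictSat M (s '' (U \ P)) ψ ↔ gSat M D (U \ P) r ψ)) := fun P hP =>
      ⟨ihφ D _ s r h1 h2 (fun g g' h hg => ⟨h3 g g' h hg.1, hP g g' h hg.2⟩)
          (fun v hv => fun h => h4 v hv (Or.inl h)) h5.1 fun g v hv => h6 g v (Or.inl hv),
       ihψ D _ s r h1 h2 (fun g g' h hg => ⟨h3 g g' h hg.1, fun h' => hg.2 (hP g' g h.symm h')⟩)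
          (fun v hv => fun h => h4 v hv (Or.inr h)) h5.2.1 fun g v hv => h6 g v (Or.inr hv)⟩
    simp only [strictSat, gSat]
    constructor
    · rintro ⟨Y, Z, hU, hI, hY, hZ⟩
      have hP : ∀ g g', Ag D g g' → g ∈ s ⁻¹' Y → g' ∈ s ⁻¹' Y := fun g g' h hg => by
        simpa [← h2 g g' h] using hg
      refine ⟨s ⁻¹' Y, hP, ?_⟩
      rw [← (key _ hP).1, ← (key _ hP).2]
      have e1 : s '' (U ∩ s ⁻¹' Y) = Y := by
        rw [Set.image_inter_preimage, ← hU]; simp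
      have e2 : s '' (U \ s ⁻¹' Y) = Z := by
        rw [Set.sdiff_eq, ← Set.preimage_compl, Set.image_inter_preimage, ← hU]
        ext x
        have : ¬ (x ∈ Y ∧ x ∈ Z) := fun h => by
          have : x ∈ Y ∩ Z := h
          simp [hI] at this
        simp; tauto
      rw [e1, e2]; exact ⟨hY, hZ⟩
    · rintro ⟨P, hP, hφ, hψ⟩
      refine ⟨s '' (U ∩ P), s '' (U \ P), ?_, ?_, (key P hP).1.2 hφ, (key P hP).2.2 hψ⟩
      · rw [← Set.image_union, Set.inter_union_sdiff]
      · ext x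
        simp only [Set.mem_inter_iff, Set.mem_image, Set.mem_sdiff, Set.mem_empty_iff_false,
          iff_false]
        rintro ⟨⟨g, ⟨_, hg⟩, rfl⟩, g', ⟨_, hg'⟩, h⟩
        exact hg' (hP g g' (hinj _ _ h.symm) hg)
  | ex v φ ih =>
    intro D U s r h1 h2 h3 h4 h5 h6
    simp only [boundVars, List.nodup_cons, List.mem_cons, not_or] at h4 h5
    have hinj : ∀ g g', s g = s g' → Ag D g g' := fun g g' h x hx => by
      have := congrFun h x
      rw [h1 g x hx, h1 g' x hx] at this
      exact Option.some.inj this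
    have key : ∀ F : (ℕ → M) → M, (∀ g g', Ag D g g' → F g = F g') →
        (strictSat M ((fun g => Function.update (s g) v (some (F g))) '' U) φ ↔
          gSat M D U (fun g => Function.update (r g) v (F g)) φ) := by
      intro F hF
      refine ih D U _ _ ?_ ?_ h3 (fun v hv => (h4 v hv).2) h5.2 ?_
      · intro g x hx
        rw [Function.update_of_ne (h4 x hx).1]; exact h1 g x hx
      · intro g g' h
        simp only [h2 g g' h, hF g g' h]
      · intro g x hx
        by_cases hxv : x = v
        · subst hxv; simp
        · simp only [Function.update_of_ne hxv]; exact h6 g x ⟨hx, hxv⟩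
    simp only [strictSat, gSat]
    constructor
    · rintro ⟨F, hF⟩
      have hd : ∀ g g', Ag D g g' → F (s g) = F (s g') := fun g g' h => by rw [h2 g g' h]
      refine ⟨fun g => F (s g), hd, (key _ hd).1 ?_⟩
      rwa [Set.image_image] at hF
    · rintro ⟨F, hd, hF⟩
      have := (key _ hd).2 hF
      let F' : (ℕ → Option M) → M := fun a => F (Function.invFun s a)
      refine ⟨F', ?_⟩
      have hF' : ∀ g, F' (s g) = F g := fun g =>
        hd _ _ (hinj _ _ (Function.invFun_eq ⟨g, rfl⟩))
      rw [Set.image_image]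
      simpa only [hF'] using this
  | all v φ ih =>
    intro D U s r h1 h2 h3 h4 h5 h6
    simp only [boundVars, List.nodup_cons, List.mem_cons, not_or] at h4 h5
    simp only [strictSat, gSat]
    rw [← ih (v :: D) U (fun g => Function.update (s g) v (some (g v)))]
    · have : {t | ∃ a ∈ s '' U, ∃ m, t = Function.update a v (some m)} =
          (fun g => Function.update (s g) v (some (g v))) '' U := by
        ext t
        simp only [Set.mem_ofPred_eq, Set.mem_image]
        constructor
        · rintro ⟨_, ⟨g, hg, rfl⟩, m, rfl⟩
          have ha : Ag D g (Function.update g v m) := fun x hx => by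
            rw [Function.update_of_ne (h4 x hx).1]
          refine ⟨Function.update g v m, h3 _ _ ha hg, ?_⟩
          rw [← h2 _ _ ha]; simp
        · rintro ⟨g, hg, rfl⟩
          exact ⟨_, ⟨g, hg, rfl⟩, g v, rfl⟩
      rw [this]
    · intro g x hx
      rcases List.mem_cons.1 hx with rfl | hx
      · simp
      · rw [Function.update_of_ne (h4 x hx).1]; exact h1 g x hx
    · intro g g' h
      rw [h2 g g' fun x hx => h x (List.mem_cons_of_mem _ hx), h v (by simp)]
    · exact fun g g' h => h3 g g' fun x hx => h x (List.mem_cons_of_mem _ hx)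
    · intro x hx
      rcases List.mem_cons.1 hx with rfl | hx
      · exact h5.1
      · exact (h4 x hx).2
    · exact h5.2
    · intro g x hx
      by_cases hxv : x = v
      · subst hxv; simp
      · simp only [Function.update_of_ne hxv]; exact h6 g x ⟨hx, hxv⟩

theorem gSat_congr {M : Type w} [L.Structure M] (φ : TF L) :
    ∀ (D : List ℕ) (U : Set (ℕ → M)) (r r' : (ℕ → M) → ℕ → M),
    (∀ g, ∀ v ∈ freeVars φ, r g v = r' g v) → gSat M D U r φ → gSat M D U r' φ := by
  induction φ with
  | rel R ts =>
    intro D U r r' h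
    have : ∀ g i, (ts i).realize (r g) = (ts i).realize (r' g) := fun g i =>
      realize_congr _ _ _ fun v hv => h g v (by simp only [freeVars, Set.mem_iUnion]; exact ⟨i, hv⟩)
    simp only [gSat, this, imp_self]
  | nrel R ts =>
    intro D U r r' h
    have : ∀ g i, (ts i).realize (r g) = (ts i).realize (r' g) := fun g i =>
      realize_congr _ _ _ fun v hv => h g v (by simp only [freeVars, Set.mem_iUnion]; exact ⟨i, hv⟩)
    simp only [gSat, this, imp_self]
  | teq t u =>
    intro D U r r' h
    have ht : ∀ g, t.realize (r g) = t.realize (r' g) := fun g =>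
      realize_congr _ _ _ fun v hv => h g v (Or.inl hv)
    have hu : ∀ g, u.realize (r g) = u.realize (r' g) := fun g =>
      realize_congr _ _ _ fun v hv => h g v (Or.inr hv)
    simp only [gSat, ht, hu, imp_self]
  | tne t u =>
    intro D U r r' h
    have ht : ∀ g, t.realize (r g) = t.realize (r' g) := fun g =>
      realize_congr _ _ _ fun v hv => h g v (Or.inl hv)
    have hu : ∀ g, u.realize (r g) = u.realize (r' g) := fun g =>
      realize_congr _ _ _ fun v hv => h g v (Or.inr hv)
    simp only [gSat, ht, hu, imp_self]
  | dep xs y =>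
    intro D U r r' h
    have hx : ∀ g, xs.map (r g) = xs.map (r' g) := fun g =>
      List.map_congr_left fun v hv => h g v (Or.inl hv)
    have hy : ∀ g, r g y = r' g y := fun g => h g y (Or.inr rfl)
    simp only [gSat, hx, hy, imp_self]
  | indep xs ys zs =>
    intro D U r r' h
    simp only [freeVars, List.mem_append, Set.mem_ofPred_eq] at h
    have hx : ∀ g, xs.map (r g) = xs.map (r' g) := fun g =>
      List.map_congr_left fun v hv => h g v (by tauto)
    have hy : ∀ g, ys.map (r g) = ys.map (r' g) := fun g =>
      List.map_congr_left fun v hv => h g v (by tauto)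
    have hz : ∀ g, zs.map (r g) = zs.map (r' g) := fun g =>
      List.map_congr_left fun v hv => h g v (by tauto)
    simp only [gSat, hx, hy, hz, imp_self]
  | inc xs ys =>
    intro D U r r' h
    simp only [freeVars, List.mem_append, Set.mem_ofPred_eq] at h
    have hx : ∀ g, xs.map (r g) = xs.map (r' g) := fun g =>
      List.map_congr_left fun v hv => h g v (by tauto)
    have hy : ∀ g, ys.map (r g) = ys.map (r' g) := fun g =>
      List.map_congr_left fun v hv => h g v (by tauto)
    simp only [gSat, hx, hy, imp_self]
  | and φ ψ ihφ ihψ =>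
    exact fun D U r r' h hs => ⟨ihφ _ _ _ _ (fun g v hv => h g v (Or.inl hv)) hs.1,
      ihψ _ _ _ _ (fun g v hv => h g v (Or.inr hv)) hs.2⟩
  | or φ ψ ihφ ihψ =>
    rintro D U r r' h ⟨P, hP, hs⟩
    exact ⟨P, hP, ihφ _ _ _ _ (fun g v hv => h g v (Or.inl hv)) hs.1,
      ihψ _ _ _ _ (fun g v hv => h g v (Or.inr hv)) hs.2⟩
  | ex v φ ih =>
    rintro D U r r' h ⟨F, hF, hs⟩
    refine ⟨F, hF, ih _ _ _ _ (fun g x hx => ?_) hs⟩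
    by_cases hxv : x = v
    · subst hxv; simp
    · simp only [Function.update_of_ne hxv]; exact h g x ⟨hx, hxv⟩
  | all v φ ih =>
    intro D U r r' h hs
    refine ih _ _ _ _ (fun g x hx => ?_) hs
    by_cases hxv : x = v
    · subst hxv; simp
    · simp only [Function.update_of_ne hxv]; exact h g x ⟨hx, hxv⟩

/-- pointwise satisfaction -/
def foT (M : Type w) [L.Structure M] (s : ℕ → M) : TF L → Prop
  | .rel R ts => RelMap R fun i => (ts i).realize s
  | .nrel R ts => ¬ RelMap R fun i => (ts i).realize s
  | .teq t u => t.realize s = u.realize s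
  | .tne t u => t.realize s ≠ u.realize s
  | .and φ ψ => foT M s φ ∧ foT M s ψ
  | .or φ ψ => foT M s φ ∨ foT M s ψ
  | _ => True

theorem foT_congr {M : Type w} [L.Structure M] (φ : TF L) (s s' : ℕ → M)
    (h : ∀ v ∈ freeVars φ, s v = s' v) : foT M s φ ↔ foT M s' φ := by
  induction φ with
  | rel R ts =>
    have : ∀ i, (ts i).realize s = (ts i).realize s' := fun i =>
      realize_congr _ _ _ fun v hv => h v (by simp only [freeVars, Set.mem_iUnion]; exact ⟨i, hv⟩)
    simp only [foT, this]
  | nrel R ts =>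
    have : ∀ i, (ts i).realize s = (ts i).realize s' := fun i =>
      realize_congr _ _ _ fun v hv => h v (by simp only [freeVars, Set.mem_iUnion]; exact ⟨i, hv⟩)
    simp only [foT, this]
  | teq t u =>
    simp only [foT, realize_congr s s' t fun v hv => h v (Or.inl hv),
      realize_congr s s' u fun v hv => h v (Or.inr hv)]
  | tne t u =>
    simp only [foT, realize_congr s s' t fun v hv => h v (Or.inl hv),
      realize_congr s s' u fun v hv => h v (Or.inr hv)]
  | and φ ψ ihφ ihψ =>
    exact and_congr (ihφ fun v hv => h v (Or.inl hv)) (ihψ fun v hv => h v (Or.inr hv))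
  | or φ ψ ihφ ihψ =>
    exact or_congr (ihφ fun v hv => h v (Or.inl hv)) (ihψ fun v hv => h v (Or.inr hv))
  | _ => rfl

theorem gSat_flat {M : Type w} [L.Structure M] (E : List ℕ) (r : (ℕ → M) → ℕ → M)
    (hr : ∀ g g', Ag E g g' → r g = r g') (φ : TF L) : ∀ (U : Set (ℕ → M)),
    quantFree φ → isFO φ → (gSat M E U r φ ↔ ∀ g ∈ U, foT M (r g) φ) := by
  induction φ with
  | and φ ψ ihφ ihψ =>
    intro U h1 h2
    simp only [gSat, foT, ihφ U h1.1 h2.1, ihψ U h1.2 h2.2]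
    exact ⟨fun h g hg => ⟨h.1 g hg, h.2 g hg⟩, fun h => ⟨fun g hg => (h g hg).1, fun g hg => (h g hg).2⟩⟩
  | or φ ψ ihφ ihψ =>
    intro U h1 h2
    simp only [gSat, foT, ihφ _ h1.1 h2.1, ihψ _ h1.2 h2.2]
    constructor
    · rintro ⟨P, hP, ha, hb⟩ g hg
      by_cases h : g ∈ P
      · exact Or.inl (ha g ⟨hg, h⟩)
      · exact Or.inr (hb g ⟨hg, h⟩)
    · intro h
      refine ⟨{g | foT M (r g) φ}, fun g g' hgg hg => ?_, fun g hg => hg.2, fun g hg => ?_⟩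
      · simpa [← hr g g' hgg] using hg
      · exact (h g hg.1).resolve_left hg.2
  | rel => intro U _ _; rfl
  | nrel => intro U _ _; rfl
  | teq => intro U _ _; rfl
  | tne => intro U _ _; rfl
  | dep => intro U _ h; exact h.elim
  | indep => intro U _ h; exact h.elim
  | inc => intro U _ h; exact h.elim
  | ex => intro U h; exact h.elim
  | all => intro U h; exact h.elim

theorem gSat_alls {M : Type w} [L.Structure M] (ψ : TF L) (U : Set (ℕ → M))
    (r : (ℕ → M) → ℕ → M) (xs : List ℕ) : ∀ (D : List ℕ), (∀ g, ∀ v ∈ xs, r g v = g v) →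
    (gSat M D U r (alls xs ψ) ↔ gSat M (xs.reverse ++ D) U r ψ) := by
  induction xs with
  | nil => intro D _; simp [alls]
  | cons x xs ih =>
    intro D h
    have : (fun g => Function.update (r g) x (g x)) = r := by
      funext g; rw [← h g x (by simp)]; simp
    simp only [alls, gSat, this]
    rw [ih _ fun g v hv => h g v (List.mem_cons_of_mem _ hv)]
    simp

theorem gSat_exs {M : Type w} [L.Structure M] (ψ : TF L) (U : Set (ℕ → M)) (E : List ℕ)
    (ys : List ℕ) : ∀ (r : (ℕ → M) → ℕ → M), (∀ g g', Ag E g g' → r g = r g') →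
    (gSat M E U r (exs ys ψ) ↔ ∃ r' : (ℕ → M) → ℕ → M, (∀ g g', Ag E g g' → r' g = r' g') ∧
      (∀ g, ∀ v, v ∉ ys → r' g v = r g v) ∧ gSat M E U r' ψ) := by
  induction ys with
  | nil =>
    intro r hr
    constructor
    · exact fun h => ⟨r, hr, fun _ _ _ => rfl, h⟩
    · rintro ⟨r', _, h2, h⟩
      rwa [show r' = r from funext fun g => funext fun v => h2 g v (by simp)] at h
  | cons y ys ih =>
    intro r hr
    have hu : ∀ F : (ℕ → M) → M, (∀ g g', Ag E g g' → F g = F g') →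
        ∀ g g', Ag E g g' → Function.update (r g) y (F g) = Function.update (r g') y (F g') :=
      fun F hF g g' h => by rw [hr g g' h, hF g g' h]
    simp only [exs, gSat]
    constructor
    · rintro ⟨F, hF, h⟩
      obtain ⟨r', h1, h2, h3⟩ := (ih _ (hu F hF)).1 h
      refine ⟨r', h1, fun g v hv => ?_, h3⟩
      simp only [List.mem_cons, not_or] at hv
      rw [h2 g v hv.2, Function.update_of_ne hv.1]
    · rintro ⟨r', h1, h2, h3⟩
      have hF : ∀ g g', Ag E g g' → r' g y = r' g' y := fun g g' h => by rw [h1 g g' h]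
      refine ⟨fun g => r' g y, hF, (ih _ (hu _ hF)).2 ⟨r', h1, fun g v hv => ?_, h3⟩⟩
      by_cases hvy : v = y
      · subst hvy; simp
      · simp only [Function.update_of_ne hvy]
        exact h2 g v (by simp [hvy, hv])

/-- number of fresh variables -/
def sz (N : ℕ) : TF L → ℕ
  | .dep _ _ => N
  | .indep _ _ _ => N
  | .inc _ _ => N
  | .and φ ψ => sz N φ + sz N ψ
  | .or φ ψ => 2 + sz N φ + sz N ψ
  | .ex _ φ => sz N φ
  | .all _ φ => sz N φ
  | _ => 0

def uVars : TF L → List ℕ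
  | .and φ ψ => uVars φ ++ uVars ψ
  | .or φ ψ => uVars φ ++ uVars ψ
  | .ex _ φ => uVars φ
  | .all v φ => v :: uVars φ
  | _ => []

def eVars : TF L → List ℕ
  | .and φ ψ => eVars φ ++ eVars ψ
  | .or φ ψ => eVars φ ++ eVars ψ
  | .ex v φ => v :: eVars φ
  | .all _ φ => eVars φ
  | _ => []

/-- atom part of the translation -/
def cA (N : ℕ) : TF L → List ℕ → ℕ → ℕ → List (TF L)
  | .dep xs y, _, t, n => [.dep (t :: xs.map (n + ·)) (n + y)]
  | .indep xs ys zs, _, t, n =>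
      [.indep (t :: xs.map (n + ·)) (ys.map (n + ·)) (zs.map (n + ·))]
  | .inc xs ys, _, t, n => if xs.length = ys.length then
      [.inc (t :: xs.map (n + ·)) (t :: ys.map (n + ·))] else []
  | .and φ ψ, D, t, n => cA N φ D t n ++ cA N ψ D t (n + sz N φ)
  | .or φ ψ, D, _, n => .dep D n :: .dep D (n + 1) ::
      (cA N φ D n (n + 2) ++ cA N ψ D (n + 1) (n + 2 + sz N φ))
  | .ex v φ, D, t, n => .dep D v :: cA N φ D t n
  | .all v φ, D, t, n => cA N φ (v :: D) t n
  | _, _, _, _ => []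

def vEq (a b : ℕ) : TF L := .teq (.var a) (.var b)
def vNe (a b : ℕ) : TF L := .tne (.var a) (.var b)

def copyF (N t n v : ℕ) : TF L :=
  .or (.and (vNe t N) (vEq (n + v) N)) (.and (vEq t N) (vEq (n + v) v))

def splitF (N t a b : ℕ) : TF L :=
  .or (.and (vEq t N) (.or (.and (vEq a N) (vNe b N)) (.and (vNe a N) (vEq b N))))
    (.and (vNe t N) (.and (vNe a N) (vNe b N)))

/-- first-order part of the translation -/
def cT (N : ℕ) : TF L → ℕ → ℕ → List (TF L)
  | .dep xs y, t, n => (y :: xs).map (copyF N t n)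
  | .indep xs ys zs, t, n => (xs ++ ys ++ zs).map (copyF N t n)
  | .inc xs ys, t, n => if xs.length = ys.length then (xs ++ ys).map (copyF N t n)
      else [vNe t N]
  | .and φ ψ, t, n => cT N φ t n ++ cT N ψ t (n + sz N φ)
  | .or φ ψ, t, n => splitF N t n (n + 1) ::
      (cT N φ n (n + 2) ++ cT N ψ (n + 1) (n + 2 + sz N φ))
  | .ex _ φ, t, n => cT N φ t n
  | .all _ φ, t, n => cT N φ t n
  | .rel R ts, t, _ => [.or (vNe t N) (.rel R ts)]
  | .nrel R ts, t, _ => [.or (vNe t N) (.nrel R ts)]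
  | .teq a b, t, _ => [.or (vNe t N) (.teq a b)]
  | .tne a b, t, _ => [.or (vNe t N) (.tne a b)]

theorem perm_vars (φ : TF L) : (boundVars φ).Perm (uVars φ ++ eVars φ) := by
  induction φ with
  | and φ ψ h1 h2 =>
    simp only [boundVars, uVars, eVars]
    classical
    rw [List.perm_iff_count] at *
    intro a; have := h1 a; have := h2 a
    simp only [List.count_append] at *; omega
  | or φ ψ h1 h2 =>
    simp only [boundVars, uVars, eVars]
    rw [List.perm_iff_count] at *
    intro a; have := h1 a; have := h2 a
    simp only [List.count_append] at *; omega
  | ex v φ h => exact (List.Perm.cons v h).trans List.perm_middle.symm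
  | all v φ h => exact List.Perm.cons v h
  | _ => simp [boundVars, uVars, eVars]

theorem mem_bound (φ : TF L) (v : ℕ) : v ∈ boundVars φ ↔ v ∈ uVars φ ∨ v ∈ eVars φ := by
  rw [(perm_vars φ).mem_iff, List.mem_append]

theorem uVars_length (φ : TF L) : (uVars φ).length = uCount φ := by
  induction φ <;> simp_all [uVars, uCount]

theorem cA_atom (N : ℕ) (φ : TF L) : ∀ D t n, ∀ α ∈ cA N φ D t n,
    isAtom α ∧ (hasIndep α → hasIndep φ) ∧ (hasInc α → hasInc φ) := by
  induction φ with
  | and φ ψ h1 h2 =>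
    intro D t n α h
    simp only [cA, List.mem_append] at h
    rcases h with h | h
    · have := h1 _ _ _ _ h; simp only [hasIndep, hasInc]; tauto
    · have := h2 _ _ _ _ h; simp only [hasIndep, hasInc]; tauto
  | or φ ψ h1 h2 =>
    intro D t n α h
    simp only [cA, List.mem_append, List.mem_cons] at h
    rcases h with rfl | rfl | h | h
    · simp [isAtom, hasIndep, hasInc]
    · simp [isAtom, hasIndep, hasInc]
    · have := h1 _ _ _ _ h; simp only [hasIndep, hasInc]; tauto
    · have := h2 _ _ _ _ h; simp only [hasIndep, hasInc]; tauto
  | ex v φ ih =>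
    intro D t n α h
    simp only [cA, List.mem_cons] at h
    rcases h with rfl | h
    · simp [isAtom, hasIndep, hasInc]
    · exact ih _ _ _ _ h
  | all v φ ih =>
    intro D t n α h
    exact ih _ _ _ _ h
  | inc xs ys =>
    intro D t n α h
    simp only [cA] at h
    split_ifs at h
    · simp_all [isAtom, hasIndep, hasInc]
    · simp at h
  | _ => intro D t n α h; simp_all [cA, isAtom, hasIndep, hasInc]

theorem cT_fo (N : ℕ) (φ : TF L) : ∀ t n, ∀ α ∈ cT N φ t n, quantFree α ∧ isFO α := by
  induction φ with
  | and φ ψ h1 h2 =>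
    intro t n α h
    simp only [cT, List.mem_append] at h
    rcases h with h | h
    · exact h1 _ _ _ h
    · exact h2 _ _ _ h
  | or φ ψ h1 h2 =>
    intro t n α h
    simp only [cT, List.mem_append, List.mem_cons] at h
    rcases h with rfl | h | h
    · simp [splitF, vEq, vNe, quantFree, isFO]
    · exact h1 _ _ _ h
    · exact h2 _ _ _ h
  | ex v φ ih => intro t n α h; exact ih _ _ _ h
  | all v φ ih => intro t n α h; exact ih _ _ _ h
  | dep | indep =>
    intro t n α h
    simp only [cT, List.mem_map] at h
    obtain ⟨v, _, rfl⟩ := h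
    simp [copyF, vEq, vNe, quantFree, isFO]
  | inc =>
    intro t n α h
    simp only [cT] at h
    split_ifs at h
    · simp only [List.mem_map] at h
      obtain ⟨v, _, rfl⟩ := h
      simp [copyF, vEq, vNe, quantFree, isFO]
    · simp only [List.mem_singleton] at h
      subst h
      simp [vNe, quantFree, isFO]
  | _ =>
    intro t n α h
    simp only [cT, List.mem_singleton] at h
    subst h
    simp [vNe, quantFree, isFO]

theorem cA_free (N : ℕ) (φ : TF L) : ∀ D t n, (∀ v ∈ freeVars φ, v < N) →
    (∀ v ∈ boundVars φ, v < N) → ∀ α ∈ cA N φ D t n, ∀ v ∈ freeVars α,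
    v ∈ freeVars φ ∨ v ∈ boundVars φ ∨ v ∈ D ∨ v = t ∨ (n ≤ v ∧ v < n + sz N φ) := by
  induction φ with
  | and φ ψ h1 h2 =>
    intro D t n hf hb α h v hv
    simp only [boundVars, freeVars, Set.mem_union, sz, List.mem_append, or_imp, forall_and] at *
    simp only [cA, List.mem_append] at h
    rcases h with h | h
    · have := h1 _ _ _ hf.1 hb.1 _ h _ hv; grind
    · have := h2 _ _ _ hf.2 hb.2 _ h _ hv; grind
  | or φ ψ h1 h2 =>
    intro D t n hf hb α h v hv
    simp only [boundVars, freeVars, Set.mem_union, sz, List.mem_append, or_imp, forall_and] at *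
    simp only [cA, List.mem_append, List.mem_cons] at h
    rcases h with rfl | rfl | h | h
    · simp [freeVars] at hv; grind
    · simp [freeVars] at hv; grind
    · have := h1 _ _ _ hf.1 hb.1 _ h _ hv; grind
    · have := h2 _ _ _ hf.2 hb.2 _ h _ hv; grind
  | ex x φ ih =>
    intro D t n hf hb α h v hv
    simp only [boundVars, freeVars, Set.mem_sdiff, Set.mem_singleton_iff, sz, List.mem_cons] at *
    simp only [cA, List.mem_cons] at h
    rcases h with rfl | h
    · simp [freeVars] at hv; grind
    · have := ih D t n (by grind) (by grind) _ h _ hv; grind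
  | all x φ ih =>
    intro D t n hf hb α h v hv
    simp only [boundVars, freeVars, Set.mem_sdiff, Set.mem_singleton_iff, sz, List.mem_cons] at *
    have := ih (x :: D) t n (by grind) (by grind) _ h _ hv; grind
  | dep xs y =>
    intro D t n hf hb α h v hv
    simp only [cA, List.mem_singleton] at h
    subst h
    simp [freeVars, sz] at hf hv ⊢
    grind
  | indep xs ys zs =>
    intro D t n hf hb α h v hv
    simp only [cA, List.mem_singleton] at h
    subst h
    simp [freeVars, sz] at hf hv ⊢
    grind
  | inc xs ys =>
    intro D t n hf hb α h v hv
    simp only [cA] at h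
    split_ifs at h
    on_goal 2 => simp at h
    simp only [List.mem_singleton] at h
    subst h
    simp [freeVars, sz] at hf hv ⊢
    grind
  | _ => intro D t n hf hb α h; simp [cA] at h

theorem cT_free (N : ℕ) (φ : TF L) : ∀ t n, (∀ v ∈ freeVars φ, v < N) →
    (∀ v ∈ boundVars φ, v < N) → ∀ α ∈ cT N φ t n, ∀ v ∈ freeVars α,
    v ∈ freeVars φ ∨ v ∈ boundVars φ ∨ v = N ∨ v = t ∨ (n ≤ v ∧ v < n + sz N φ) := by
  induction φ with
  | and φ ψ h1 h2 =>
    intro t n hf hb α h v hv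
    simp only [boundVars, freeVars, Set.mem_union, sz, List.mem_append, or_imp, forall_and] at *
    simp only [cT, List.mem_append] at h
    rcases h with h | h
    · have := h1 _ _ hf.1 hb.1 _ h _ hv; grind
    · have := h2 _ _ hf.2 hb.2 _ h _ hv; grind
  | or φ ψ h1 h2 =>
    intro t n hf hb α h v hv
    simp only [boundVars, freeVars, Set.mem_union, sz, List.mem_append, or_imp, forall_and] at *
    simp only [cT, List.mem_append, List.mem_cons] at h
    rcases h with rfl | h | h
    · simp [freeVars, splitF, vEq, vNe, tvars] at hv; grind
    · have := h1 _ _ hf.1 hb.1 _ h _ hv; grind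
    · have := h2 _ _ hf.2 hb.2 _ h _ hv; grind
  | ex x φ ih =>
    intro t n hf hb α h v hv
    simp only [boundVars, freeVars, Set.mem_sdiff, Set.mem_singleton_iff, sz, List.mem_cons] at *
    have := ih t n (by grind) (by grind) _ h _ hv; grind
  | all x φ ih =>
    intro t n hf hb α h v hv
    simp only [boundVars, freeVars, Set.mem_sdiff, Set.mem_singleton_iff, sz, List.mem_cons] at *
    have := ih t n (by grind) (by grind) _ h _ hv; grind
  | dep | indep =>
    intro t n hf hb α h v hv
    simp only [cT, List.mem_map] at h
    obtain ⟨x, hx, rfl⟩ := h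
    simp [freeVars, copyF, vEq, vNe, tvars, sz] at hx hf hv ⊢
    grind
  | inc =>
    intro t n hf hb α h v hv
    simp only [cT] at h
    split_ifs at h
    · simp only [List.mem_map] at h
      obtain ⟨x, hx, rfl⟩ := h
      simp [freeVars, copyF, vEq, vNe, tvars, sz] at hx hf hv ⊢
      grind
    · simp only [List.mem_singleton] at h
      subst h
      simp [freeVars, vNe, tvars] at hv ⊢
      tauto
  | rel | nrel | teq | tne =>
    intro t n hf hb α h v hv
    simp only [cT, List.mem_singleton] at h
    subst h
    simp [freeVars, vNe, tvars] at hv ⊢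
    tauto

theorem foT_copy {M : Type w} [L.Structure M] (s : ℕ → M) (N t n v : ℕ) :
    foT M s (copyF N t n v : TF L) ↔
      (s t ≠ s N ∧ s (n + v) = s N ∨ s t = s N ∧ s (n + v) = s v) := by
  simp [foT, copyF, vEq, vNe]

theorem foT_split {M : Type w} [L.Structure M] (s : ℕ → M) (N t a b : ℕ) :
    foT M s (splitF N t a b : TF L) ↔
      (s t = s N ∧ (s a = s N ∧ s b ≠ s N ∨ s a ≠ s N ∧ s b = s N) ∨
        s t ≠ s N ∧ s a ≠ s N ∧ s b ≠ s N) := by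
  simp [foT, splitF, vEq, vNe]

theorem copy_map {M : Type w} (s : ℕ → M) (N t n : ℕ) (xs : List ℕ)
    (h : ∀ v ∈ xs, (s t ≠ s N ∧ s (n + v) = s N ∨ s t = s N ∧ s (n + v) = s v)) :
    (s t = s N → (xs.map (n + ·)).map s = xs.map s) ∧
    (s t ≠ s N → (xs.map (n + ·)).map s = xs.map (fun _ => s N)) := by
  constructor
  · intro ht
    rw [List.map_map]; apply List.map_congr_left; intro v hv
    have := h v hv; simp only [Function.comp]; tauto
  · intro ht
    rw [List.map_map]; apply List.map_congr_left; intro v hv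
    have := h v hv; simp only [Function.comp]; tauto

theorem dep_det {M : Type w} [L.Structure M] (r : (ℕ → M) → ℕ → M) (D : List ℕ) (y : ℕ)
    (hD : ∀ g, ∀ v ∈ D, r g v = g v) :
    gSat M [] Set.univ r (.dep D y : TF L) ↔ ∀ g g', Ag D g g' → r g y = r g' y := by
  have : ∀ g, D.map (r g) = D.map g := fun g => List.map_congr_left (hD g)
  simp only [gSat, this, Set.mem_univ, true_imp_iff, List.map_inj_left, Ag]

theorem sound {M : Type w} [L.Structure M] (N : ℕ) (r : (ℕ → M) → ℕ → M)
    (hN : ∀ g g', r g N = r g' N) (φ : TF L) : ∀ D t n,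
    (∀ g, ∀ v ∈ D, r g v = g v) → (∀ g, ∀ v ∈ uVars φ, r g v = g v) →
    (∀ α ∈ cA N φ D t n, gSat M [] Set.univ r α) →
    (∀ α ∈ cT N φ t n, ∀ g, foT M (r g) α) →
    gSat M D {g | r g t = r g N} r φ := by
  induction φ with
  | rel | nrel | teq | tne =>
    intro D t n hD hu hA hT g hg
    have := hT _ (List.mem_singleton.2 rfl) g
    simp only [foT, vNe] at this
    exact this.resolve_left fun h => h hg
  | and φ ψ h1 h2 =>
    intro D t n hD hu hA hT
    simp only [uVars, cA, cT, List.mem_append, or_imp, forall_and] at hu hA hT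
    exact ⟨h1 D t n hD hu.1 hA.1 hT.1, h2 D t _ hD hu.2 hA.2 hT.2⟩
  | or φ ψ h1 h2 =>
    intro D t n hD hu hA hT
    simp only [uVars, cA, cT, List.mem_append, List.mem_cons, or_imp, forall_and,
      forall_eq] at hu hA hT
    obtain ⟨a1, a2, a3, a4⟩ := hA
    obtain ⟨t1, t2, t3⟩ := hT
    simp only [foT_split] at t1
    rw [dep_det r D _ hD] at a1
    have e1 : {g | r g t = r g N} ∩ {g | r g n = r g N} = {g | r g n = r g N} := by
      ext g; have := t1 g; simp only [Set.mem_inter_iff, Set.mem_ofPred_eq]; tauto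
    have e2 : {g | r g t = r g N} \ {g | r g n = r g N} = {g | r g (n + 1) = r g N} := by
      ext g; have := t1 g; simp only [Set.mem_sdiff, Set.mem_ofPred_eq]; tauto
    refine ⟨{g | r g n = r g N}, fun g g' h hg => ?_, ?_, ?_⟩
    · simp only [Set.mem_ofPred_eq] at hg ⊢
      rw [← a1 g g' h, hg, hN]
    · rw [e1]; exact h1 D _ _ hD hu.1 a3 t2
    · rw [e2]; exact h2 D _ _ hD hu.2 a4 t3
  | ex v φ ih =>
    intro D t n hD hu hA hT
    simp only [cA, List.mem_cons, or_imp, forall_and, forall_eq] at hA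
    refine ⟨fun g => r g v, (dep_det r D v hD).1 hA.1, ?_⟩
    simp only [Function.update_eq_self]
    exact ih D t n hD hu hA.2 hT
  | all v φ ih =>
    intro D t n hD hu hA hT
    simp only [uVars, List.mem_cons, or_imp, forall_and, forall_eq] at hu
    have : (fun g => Function.update (r g) v (g v)) = r := by
      funext g; rw [← hu.1 g]; simp
    simp only [gSat, this]
    exact ih (v :: D) t n (fun g x hx => by
      rcases List.mem_cons.1 hx with rfl | hx
      · exact hu.1 g
      · exact hD g x hx) hu.2 hA hT
  | dep xs y =>
    intro D t n hD hu hA hT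
    simp only [cA, cT, List.mem_singleton, forall_eq, List.forall_mem_map, foT_copy] at hA hT
    intro g hg g' hg' h
    simp only [Set.mem_ofPred_eq] at hg hg'
    have hx : ∀ g, r g t = r g N → (xs.map (n + ·)).map (r g) = xs.map (r g) := fun g =>
      (copy_map (r g) N t n xs fun v hv => hT v (by simp [hv]) g).1
    have := hA g trivial g' trivial (by
      rw [List.map_cons, List.map_cons, hx g hg, hx g' hg', h, hg, hg', hN])
    have k1 := hT y (by simp) g
    have k2 := hT y (by simp) g'
    grind
  | indep xs ys zs =>
    intro D t n hD hu hA hT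
    simp only [cA, cT, List.mem_singleton, forall_eq, List.forall_mem_map, foT_copy,
      List.mem_append] at hA hT
    intro g hg g' hg' h
    simp only [Set.mem_ofPred_eq] at hg hg'
    have hx : ∀ g, r g t = r g N → (xs.map (n + ·)).map (r g) = xs.map (r g) := fun g =>
      (copy_map (r g) N t n xs fun v hv => hT v (by simp [hv]) g).1
    have hy : ∀ g, r g t = r g N → (ys.map (n + ·)).map (r g) = ys.map (r g) := fun g =>
      (copy_map (r g) N t n ys fun v hv => hT v (by simp [hv]) g).1
    have hz : ∀ g, r g t = r g N → (zs.map (n + ·)).map (r g) = zs.map (r g) := fun g =>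
      (copy_map (r g) N t n zs fun v hv => hT v (by simp [hv]) g).1
    obtain ⟨g'', -, k1, k2, k3⟩ := hA g trivial g' trivial (by
      rw [List.map_cons, List.map_cons, hx g hg, hx g' hg', h, hg, hg', hN])
    simp only [List.map_cons, List.cons.injEq] at k1
    have hg'' : r g'' t = r g'' N := by rw [k1.1, hg, hN]
    refine ⟨g'', hg'', ?_, ?_, ?_⟩
    · rw [← hx _ hg'', ← hx _ hg, k1.2]
    · rw [← hy _ hg'', ← hy _ hg, k2]
    · rw [← hz _ hg'', ← hz _ hg', k3]
  | inc xs ys =>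
    intro D t n hD hu hA hT
    by_cases hl : xs.length = ys.length
    on_goal 2 =>
      simp only [cT, if_neg hl, List.mem_singleton, forall_eq] at hT
      exact fun g hg => absurd hg (hT g)
    simp only [cA, cT, if_pos hl, List.mem_singleton, forall_eq, List.forall_mem_map, foT_copy,
      List.mem_append] at hA hT
    intro g hg
    simp only [Set.mem_ofPred_eq] at hg
    have hx : ∀ g, r g t = r g N → (xs.map (n + ·)).map (r g) = xs.map (r g) := fun g =>
      (copy_map (r g) N t n xs fun v hv => hT v (by simp [hv]) g).1
    have hy : ∀ g, r g t = r g N → (ys.map (n + ·)).map (r g) = ys.map (r g) := fun g =>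
      (copy_map (r g) N t n ys fun v hv => hT v (by simp [hv]) g).1
    obtain ⟨g'', -, k1⟩ := hA g trivial
    simp only [List.map_cons, List.cons.injEq] at k1
    have hg'' : r g'' t = r g'' N := by rw [← k1.1, hg, hN]
    exact ⟨g'', hg'', by rw [← hx _ hg, ← hy _ hg'', k1.2]⟩

structure Pre (M : Type w) [L.Structure M] (N : ℕ) (E : List ℕ) (φ : TF L) (D : List ℕ)
    (t n : ℕ) (U : Set (ℕ → M)) (r : (ℕ → M) → ℕ → M) : Prop where
  hf : ∀ v ∈ freeVars φ, v < N
  hb : ∀ v ∈ boundVars φ, v < N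
  hfb : ∀ v ∈ freeVars φ, v ∉ boundVars φ
  hnd : (boundVars φ).Nodup
  hD : ∀ v ∈ D, v < N ∧ v ∉ boundVars φ ∧ v ∈ E
  ht : N ≤ t
  htn : t < n
  huE : ∀ v ∈ uVars φ, v ∈ E
  hr : ∀ g g', Ag E g g' → r g = r g'
  hrD : ∀ g, ∀ v ∈ D, r g v = g v
  hru : ∀ g, ∀ v ∈ uVars φ, r g v = g v
  hU : ∀ g, g ∈ U ↔ r g t = r g N
  hUd : ∀ g g', Ag D g g' → g ∈ U → g' ∈ U
  hc : ∀ g g', r g N = r g' N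
  hs : gSat M D U r φ

structure Post (M : Type w) [L.Structure M] (N : ℕ) (E : List ℕ) (φ : TF L) (D : List ℕ)
    (t n : ℕ) (r r' : (ℕ → M) → ℕ → M) : Prop where
  hr : ∀ g g', Ag E g g' → r' g = r' g'
  ha : ∀ g v, v ∉ eVars φ → ¬ (n ≤ v ∧ v < n + sz N φ) → r' g v = r g v
  hA : ∀ α ∈ cA N φ D t n, gSat M [] Set.univ r' α
  hT : ∀ α ∈ cT N φ t n, ∀ g, foT M (r' g) α

theorem comb {M : Type w} [L.Structure M] {N : ℕ} {E : List ℕ} {φ ψ : TF L} {D : List ℕ}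
    {t₁ t₂ n : ℕ} {U₁ U₂ : Set (ℕ → M)} {r : (ℕ → M) → ℕ → M}
    (ihφ : ∀ D t n U r, Pre M N E φ D t n U r → ∃ r', Post M N E φ D t n r r')
    (ihψ : ∀ D t n U r, Pre M N E ψ D t n U r → ∃ r', Post M N E ψ D t n r r')
    (p1 : Pre M N E φ D t₁ n U₁ r) (p2 : Pre M N E ψ D t₂ (n + sz N φ) U₂ r)
    (ht2 : t₂ < n) (hbb : ∀ v ∈ boundVars φ, v ∉ boundVars ψ)
    (hf1 : ∀ v ∈ freeVars φ, v ∉ boundVars ψ) (hf2 : ∀ v ∈ freeVars ψ, v ∉ boundVars φ) :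
    ∃ r' : (ℕ → M) → ℕ → M, (∀ g g', Ag E g g' → r' g = r' g') ∧
      (∀ g v, v ∉ eVars φ → v ∉ eVars ψ → ¬ (n ≤ v ∧ v < n + sz N φ + sz N ψ) →
        r' g v = r g v) ∧
      (∀ α ∈ cA N φ D t₁ n, gSat M [] Set.univ r' α) ∧
      (∀ α ∈ cT N φ t₁ n, ∀ g, foT M (r' g) α) ∧
      (∀ α ∈ cA N ψ D t₂ (n + sz N φ), gSat M [] Set.univ r' α) ∧
      (∀ α ∈ cT N ψ t₂ (n + sz N φ), ∀ g, foT M (r' g) α) := by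
  obtain ⟨r₁, q1⟩ := ihφ _ _ _ _ _ p1
  have mφ := mem_bound φ
  have mψ := mem_bound ψ
  have hsmall : ∀ g v, v < n → v ∉ boundVars φ → r₁ g v = r g v := fun g v h1 h2 =>
    q1.ha g v (fun h => h2 ((mφ v).2 (Or.inr h))) (by omega)
  have hNn : N < n := lt_of_le_of_lt p1.ht p1.htn
  have hN : ∀ g, r₁ g N = r g N := fun g =>
    hsmall g N hNn fun h => lt_irrefl _ (p1.hb _ h)
  have ht : ∀ g, r₁ g t₂ = r g t₂ := fun g =>
    hsmall g t₂ ht2 fun h => absurd (p1.hb _ h) (not_lt.2 p2.ht)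
  have p2' : Pre M N E ψ D t₂ (n + sz N φ) U₂ r₁ :=
    { hf := p2.hf, hb := p2.hb, hfb := p2.hfb, hnd := p2.hnd, hD := p2.hD, ht := p2.ht,
      htn := p2.htn, huE := p2.huE, hr := q1.hr, hUd := p2.hUd
      hrD := fun g v hv => by
        rw [hsmall g v ((p2.hD v hv).1.trans hNn) (p1.hD v hv).2.1]; exact p2.hrD g v hv
      hru := fun g v hv => by
        have hb : v ∈ boundVars ψ := (mψ v).2 (Or.inl hv)
        rw [hsmall g v ((p2.hb v hb).trans hNn) fun h => hbb v h hb]; exact p2.hru g v hv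
      hU := fun g => by rw [hN, ht]; exact p2.hU g
      hc := fun g g' => by rw [hN, hN]; exact p2.hc g g'
      hs := gSat_congr ψ _ _ r r₁ (fun g v hv =>
        (hsmall g v ((p2.hf v hv).trans hNn) (hf2 v hv)).symm) p2.hs }
  obtain ⟨r₂, q2⟩ := ihψ _ _ _ _ _ p2'
  have hag : ∀ g v, v ∉ boundVars ψ → v < n + sz N φ → r₁ g v = r₂ g v := fun g v h1 h2 =>
    (q2.ha g v (fun h => h1 ((mψ v).2 (Or.inr h))) (by omega)).symm
  refine ⟨r₂, q2.hr, ?_, ?_, ?_, q2.hA, q2.hT⟩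
  · intro g v h1 h2 h3
    rw [q2.ha g v h2 (by omega), q1.ha g v h1 (by omega)]
  · intro α hα
    refine gSat_congr α _ _ r₁ r₂ (fun g v hv => ?_) (q1.hA α hα)
    have hψN := p2.hb v
    have hN := p1.hf v
    have hN' := p1.hb v
    have h1 := p1.ht
    have h2 := p1.htn
    rcases cA_free N φ D t₁ n p1.hf p1.hb α hα v hv with h | h | h | h | h
    · exact hag g v (hf1 v h) (by have := hN h; omega)
    · exact hag g v (hbb v h) (by have := hN' h; omega)
    · exact hag g v (p2.hD v h).2.1 (by have := (p2.hD v h).1; omega)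
    · exact hag g v (fun h' => by have := hψN h'; omega) (by omega)
    · exact hag g v (fun h' => by have := hψN h'; omega) (by omega)
  · intro α hα g
    refine (foT_congr α (r₁ g) (r₂ g) (fun v hv => ?_)).1 (q1.hT α hα g)
    have hψN := p2.hb v
    have hN := p1.hf v
    have hN' := p1.hb v
    have h1 := p1.ht
    have h2 := p1.htn
    rcases cT_free N φ t₁ n p1.hf p1.hb α hα v hv with h | h | h | h | h
    · exact hag g v (hf1 v h) (by have := hN h; omega)
    · exact hag g v (hbb v h) (by have := hN' h; omega)
    · exact hag g v (fun h' => by have := hψN h'; omega) (by omega)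
    · exact hag g v (fun h' => by have := hψN h'; omega) (by omega)
    · exact hag g v (fun h' => by have := hψN h'; omega) (by omega)

theorem copy_ex {M : Type w} {N : ℕ} {E : List ℕ} {t n : ℕ} {r : (ℕ → M) → ℕ → M}
    (hr : ∀ g g', Ag E g g' → r g = r g') (ht : N ≤ t) (htn : t < n) :
    ∃ r' : (ℕ → M) → ℕ → M, (∀ g g', Ag E g g' → r' g = r' g') ∧
      (∀ g v, ¬ (n ≤ v ∧ v < n + N) → r' g v = r g v) ∧
      (∀ v < N, ∀ g, (r' g t ≠ r' g N ∧ r' g (n + v) = r' g N ∨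
        r' g t = r' g N ∧ r' g (n + v) = r' g v)) := by
  classical
  refine ⟨fun g v => if n ≤ v ∧ v < n + N then (if r g t = r g N then r g (v - n) else r g N)
    else r g v, ?_, ?_, ?_⟩
  · intro g g' h
    simp only [hr g g' h]
  · intro g v h
    simp only [if_neg h]
  · intro v hv g
    have h1 : ¬ (n ≤ t ∧ t < n + N) := by omega
    have h2 : ¬ (n ≤ N ∧ N < n + N) := by omega
    have h3 : n ≤ n + v ∧ n + v < n + N := by omega
    have h4 : ¬ (n ≤ v ∧ v < n + N) := by omega
    simp only [if_neg h1, if_neg h2, if_pos h3, if_neg h4, Nat.add_sub_cancel_left]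
    by_cases h : r g t = r g N <;> simp [h]

set_option maxHeartbeats 1000000 in
theorem complete {M : Type w} [L.Structure M] (hM : ∃ a b : M, a ≠ b) (N : ℕ) (E : List ℕ)
    (φ : TF L) : ∀ D t n U r, Pre M N E φ D t n U r → ∃ r', Post M N E φ D t n r r' := by
  classical
  induction φ with
  | rel | nrel | teq | tne =>
    intro D t n U r p
    refine ⟨r, p.hr, fun _ _ _ _ => rfl, by simp [cA], ?_⟩
    intro α hα g
    simp only [cT, List.mem_singleton] at hα
    subst hα
    by_cases h : g ∈ U
    · exact Or.inr (p.hs g h)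
    · exact Or.inl fun h' => h ((p.hU g).2 h')
  | and φ ψ ihφ ihψ =>
    intro D t n U r ⟨hf, hb, hfb, hnd, hD, ht, htn, huE, hr, hrD, hru, hU, hUd, hc, hs⟩
    simp only [freeVars, boundVars, uVars, List.mem_append, Set.mem_union, or_imp, forall_and,
      not_or, List.nodup_append] at hf hb hfb hnd hD huE hru
    obtain ⟨r', h1, h2, h3, h4, h5, h6⟩ := comb (t₁ := t) (t₂ := t) (n := n) ihφ ihψ
      ⟨hf.1, hb.1, hfb.1.1, hnd.1, fun v hv => ⟨hD.1 v hv, hD.2.1.1 v hv, hD.2.2 v hv⟩, ht, htn,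
        huE.1, hr, hrD, hru.1, hU, hUd, hc, hs.1⟩
      ⟨hf.2, hb.2, hfb.2.2, hnd.2.1, fun v hv => ⟨hD.1 v hv, hD.2.1.2 v hv, hD.2.2 v hv⟩, ht,
        by omega, huE.2, hr, hrD, hru.2, hU, hUd, hc, hs.2⟩ htn
      (fun v hv hv' => hnd.2.2 v hv v hv' rfl) hfb.2.1 hfb.1.2
    refine ⟨r', h1, ?_, ?_, ?_⟩
    · intro g v hv hv'
      simp only [eVars, List.mem_append, not_or, sz] at hv hv'
      exact h2 g v hv.1 hv.2 (by omega)
    · simp only [cA, List.mem_append, or_imp, forall_and]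
      exact ⟨h3, h5⟩
    · simp only [cT, List.mem_append]
      rintro α (h | h)
      · exact h4 α h
      · exact h6 α h
  | or φ ψ ihφ ihψ =>
    intro D t n U r ⟨hf, hb, hfb, hnd, hD, ht, htn, huE, hr, hrD, hru, hU, hUd, hc, hs⟩
    simp only [freeVars, boundVars, uVars, List.mem_append, Set.mem_union, or_imp, forall_and,
      not_or, List.nodup_append] at hf hb hfb hnd hD huE hru
    obtain ⟨P, hP, hs1, hs2⟩ := hs
    have hDE : ∀ g g' : ℕ → M, Ag E g g' → Ag D g g' := fun g g' h x hx => h x (hD.2.2 x hx)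
    have hU1 : ∀ g g', Ag D g g' → g ∈ U ∩ P → g' ∈ U ∩ P := fun g g' h hg =>
      ⟨hUd g g' h hg.1, hP g g' h hg.2⟩
    have hU2 : ∀ g g', Ag D g g' → g ∈ U \ P → g' ∈ U \ P := fun g g' h hg =>
      ⟨hUd g g' h hg.1, fun h' => hg.2 (hP g' g h.symm h')⟩
    obtain ⟨e, he⟩ : ∃ e, ∀ g, e ≠ r g N := by
      obtain ⟨a, b, hab⟩ := hM
      by_cases ha : a = r (fun _ => a) N
      · exact ⟨b, fun g hg => hab (by rw [ha, hg, hc])⟩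
      · exact ⟨a, fun g hg => ha (hg.trans (hc _ _))⟩
    let r₁ : (ℕ → M) → ℕ → M := fun g v =>
      if v = n then (if g ∈ U ∩ P then r g N else e)
      else if v = n + 1 then (if g ∈ U \ P then r g N else e) else r g v
    have k1 : ∀ g, r₁ g n = if g ∈ U ∩ P then r g N else e := fun g => by simp [r₁]
    have k2 : ∀ g, r₁ g (n + 1) = if g ∈ U \ P then r g N else e := fun g => by simp [r₁]
    have k3 : ∀ g v, v ≠ n → v ≠ n + 1 → r₁ g v = r g v := fun g v h h' => by simp [r₁, h, h']
    have d1 : ∀ g g', Ag D g g' → r₁ g n = r₁ g' n := fun g g' h => by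
      rw [k1, k1, hc g g']
      have : g ∈ U ∩ P ↔ g' ∈ U ∩ P := ⟨hU1 _ _ h, hU1 _ _ h.symm⟩
      simp only [this]
    have d2 : ∀ g g', Ag D g g' → r₁ g (n + 1) = r₁ g' (n + 1) := fun g g' h => by
      rw [k2, k2, hc g g']
      have : g ∈ U \ P ↔ g' ∈ U \ P := ⟨hU2 _ _ h, hU2 _ _ h.symm⟩
      simp only [this]
    have hr₁ : ∀ g g', Ag E g g' → r₁ g = r₁ g' := fun g g' h => by
      funext v
      by_cases h1 : v = n
      · subst h1; exact d1 _ _ (hDE _ _ h)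
      by_cases h2 : v = n + 1
      · subst h2; exact d2 _ _ (hDE _ _ h)
      rw [k3 g v h1 h2, k3 g' v h1 h2, hr g g' h]
    have kN : ∀ g v, v < n → r₁ g v = r g v := fun g v h => k3 g v (by omega) (by omega)
    have hNn : N < n := by omega
    have i1 : ∀ g, g ∈ U ∩ P ↔ r₁ g n = r₁ g N := fun g => by
      rw [k1, kN g N hNn]
      by_cases h : g ∈ U ∩ P
      · simp only [h, if_true]
      · simp only [h, if_false, he g]
    have i2 : ∀ g, g ∈ U \ P ↔ r₁ g (n + 1) = r₁ g N := fun g => by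
      rw [k2, kN g N hNn]
      by_cases h : g ∈ U \ P
      · simp only [h, if_true]
      · simp only [h, if_false, he g]
    have c1 : ∀ g g', r₁ g N = r₁ g' N := fun g g' => by rw [kN g N hNn, kN g' N hNn, hc]
    have rD1 : ∀ g, ∀ v ∈ D, r₁ g v = g v := fun g v hv => by
      rw [kN g v ((hD.1 v hv).trans hNn), hrD g v hv]
    obtain ⟨r', h1, h2, h3, h4, h5, h6⟩ := comb (t₁ := n) (t₂ := n + 1) (n := n + 2)
      (U₁ := U ∩ P) (U₂ := U \ P) (r := r₁) (D := D) ihφ ihψ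
      ⟨hf.1, hb.1, hfb.1.1, hnd.1, fun v hv => ⟨hD.1 v hv, hD.2.1.1 v hv, hD.2.2 v hv⟩,
        by omega, by omega, huE.1, hr₁, rD1, fun g v hv => by
          rw [kN g v ((hb.1 v ((mem_bound φ v).2 (Or.inl hv))).trans hNn), hru.1 g v hv],
        i1, hU1, c1, gSat_congr φ _ _ r r₁ (fun g v hv => (kN g v ((hf.1 v hv).trans hNn)).symm) hs1⟩
      ⟨hf.2, hb.2, hfb.2.2, hnd.2.1, fun v hv => ⟨hD.1 v hv, hD.2.1.2 v hv, hD.2.2 v hv⟩,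
        by omega, by omega, huE.2, hr₁, rD1, fun g v hv => by
          rw [kN g v ((hb.2 v ((mem_bound ψ v).2 (Or.inl hv))).trans hNn), hru.2 g v hv],
        i2, hU2, c1, gSat_congr ψ _ _ r r₁ (fun g v hv => (kN g v ((hf.2 v hv).trans hNn)).symm) hs2⟩
      (by omega)
      (fun v hv hv' => hnd.2.2 v hv v hv' rfl) hfb.2.1 hfb.1.2
    have big : ∀ v, N ≤ v → v ∉ eVars φ ∧ v ∉ eVars ψ := fun v hv =>
      ⟨fun h => absurd (hb.1 v ((mem_bound φ v).2 (Or.inr h))) (by omega),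
       fun h => absurd (hb.2 v ((mem_bound ψ v).2 (Or.inr h))) (by omega)⟩
    have hbig : ∀ g v, N ≤ v → v < n + 2 → r' g v = r₁ g v := fun g v hv hv' =>
      h2 g v (big v hv).1 (big v hv).2 (by omega)
    have rD' : ∀ g, ∀ v ∈ D, r' g v = g v := fun g v hv => by
      have e1 : v ∉ eVars φ := fun h => hD.2.1.1 v hv ((mem_bound φ v).2 (Or.inr h))
      have e2 : v ∉ eVars ψ := fun h => hD.2.1.2 v hv ((mem_bound ψ v).2 (Or.inr h))
      rw [h2 g v e1 e2 (by have := hD.1 v hv; omega), rD1 g v hv]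
    refine ⟨r', h1, ?_, ?_, ?_⟩
    · intro g v hv hv'
      simp only [eVars, List.mem_append, not_or, sz] at hv hv'
      rw [h2 g v hv.1 hv.2 (by omega)]
      by_cases hn : v < n
      · exact kN g v hn
      · exact k3 g v (by omega) (by omega)
    · simp only [cA, List.mem_append, List.mem_cons, or_imp, forall_and, forall_eq]
      refine ⟨?_, ?_, h3, h5⟩
      · rw [dep_det r' D _ rD']
        intro g g' h
        rw [hbig g n (by omega) (by omega), hbig g' n (by omega) (by omega)]; exact d1 g g' h
      · rw [dep_det r' D _ rD']
        intro g g' h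
        rw [hbig g _ (by omega) (by omega), hbig g' _ (by omega) (by omega)]; exact d2 g g' h
    · simp only [cT, List.mem_append, List.mem_cons]
      rintro α (rfl | h | h)
      · intro g
        rw [foT_split, hbig g n (by omega) (by omega), hbig g (n + 1) (by omega) (by omega),
          hbig g N (by omega) (by omega), hbig g t (by omega) (by omega)]
        simp only [ne_eq, ← i1, ← i2]
        rw [kN g t htn, kN g N hNn, ← hU]
        by_cases a : g ∈ U <;> by_cases b : g ∈ P <;> simp [a, b]
      · exact h4 α h
      · exact h6 α h
  | ex x φ ih =>
    intro D t n U r ⟨hf, hb, hfb, hnd, hD, ht, htn, huE, hr, hrD, hru, hU, hUd, hc, hs⟩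
    simp only [freeVars, boundVars, uVars, List.mem_cons, Set.mem_sdiff, Set.mem_singleton_iff,
      not_or, List.nodup_cons] at hf hb hfb hnd hD huE hru
    obtain ⟨F, hF, hs⟩ := hs
    have hxN := hb x (Or.inl rfl)
    have hDE : ∀ g g' : ℕ → M, Ag E g g' → Ag D g g' := fun g g' h y hy => h y (hD y hy).2.2
    have hne : ∀ g v, v ≠ x → Function.update (r g) x (F g) v = r g v := fun g v h =>
      Function.update_of_ne h _ _
    have hNx : N ≠ x := by omega
    have htx : t ≠ x := by omega
    obtain ⟨r', q⟩ := ih D t n U (fun g => Function.update (r g) x (F g))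
      { hf := fun v hv => by
          by_cases h : v = x
          · rw [h]; exact hxN
          · exact hf v ⟨hv, h⟩
        hb := fun v hv => hb v (Or.inr hv)
        hfb := fun v hv => by
          by_cases h : v = x
          · rw [h]; exact hnd.1
          · exact (hfb v ⟨hv, h⟩).2
        hnd := hnd.2
        hD := fun v hv => ⟨(hD v hv).1, (hD v hv).2.1.2, (hD v hv).2.2⟩
        ht := ht, htn := htn, huE := huE
        hr := fun g g' h => by simp only [hr g g' h, hF g g' (hDE g g' h)]
        hrD := fun g v hv => by rw [hne g v (hD v hv).2.1.1]; exact hrD g v hv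
        hru := fun g v hv => by
          rw [hne g v fun h => hnd.1 (h ▸ (mem_bound φ v).2 (Or.inl hv))]; exact hru g v hv
        hU := fun g => by rw [hne g t htx, hne g N hNx]; exact hU g
        hUd := hUd
        hc := fun g g' => by rw [hne g N hNx, hne g' N hNx]; exact hc g g'
        hs := hs }
    refine ⟨r', q.hr, ?_, ?_, q.hT⟩
    · intro g v hv hv'
      simp only [eVars, List.mem_cons, not_or, sz] at hv hv'
      rw [q.ha g v hv.2 hv']; exact hne g v hv.1
    · simp only [cA, List.mem_cons, or_imp, forall_and, forall_eq]
      refine ⟨?_, q.hA⟩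
      rw [dep_det r' D x]
      · intro g g' h
        have hxe : x ∉ eVars φ := fun h => hnd.1 ((mem_bound φ x).2 (Or.inr h))
        rw [q.ha g x hxe (by omega), q.ha g' x hxe (by omega)]
        simpa using hF g g' h
      · intro g v hv
        rw [q.ha g v (fun h => (hD v hv).2.1.2 ((mem_bound φ v).2 (Or.inr h)))
          (by have := (hD v hv).1; omega), hne g v (hD v hv).2.1.1]
        exact hrD g v hv
  | all x φ ih =>
    intro D t n U r ⟨hf, hb, hfb, hnd, hD, ht, htn, huE, hr, hrD, hru, hU, hUd, hc, hs⟩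
    simp only [freeVars, boundVars, uVars, List.mem_cons, Set.mem_sdiff, Set.mem_singleton_iff,
      not_or, List.nodup_cons] at hf hb hfb hnd hD huE hru
    have hxN := hb x (Or.inl rfl)
    have : (fun g => Function.update (r g) x (g x)) = r := by
      funext g; rw [← hru g x (Or.inl rfl)]; simp
    simp only [gSat, this] at hs
    obtain ⟨r', q⟩ := ih (x :: D) t n U r
      { hf := fun v hv => by
          by_cases h : v = x
          · rw [h]; exact hxN
          · exact hf v ⟨hv, h⟩
        hb := fun v hv => hb v (Or.inr hv)
        hfb := fun v hv => by
          by_cases h : v = x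
          · rw [h]; exact hnd.1
          · exact (hfb v ⟨hv, h⟩).2
        hnd := hnd.2
        hD := fun v hv => by
          rcases List.mem_cons.1 hv with rfl | hv
          · exact ⟨hxN, hnd.1, huE v (Or.inl rfl)⟩
          · exact ⟨(hD v hv).1, (hD v hv).2.1.2, (hD v hv).2.2⟩
        ht := ht, htn := htn, huE := fun v hv => huE v (Or.inr hv)
        hr := hr
        hrD := fun g v hv => by
          rcases List.mem_cons.1 hv with rfl | hv
          · exact hru g v (Or.inl rfl)
          · exact hrD g v hv
        hru := fun g v hv => hru g v (Or.inr hv)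
        hU := hU
        hUd := fun g g' h => hUd g g' fun y hy => h y (List.mem_cons_of_mem _ hy)
        hc := hc
        hs := hs }
    exact ⟨r', q.hr, q.ha, q.hA, q.hT⟩
  | dep xs y =>
    intro D t n U r p
    obtain ⟨r', h1, h2, h3⟩ := copy_ex p.hr p.ht p.htn
    have hf := p.hf
    have ht := p.ht
    have htn := p.htn
    simp only [freeVars, Set.mem_union, Set.mem_ofPred_eq, Set.mem_singleton_iff] at hf
    have hlow : ∀ g v, v < n → r' g v = r g v := fun g v hv => h2 g v (by omega)
    have hc : ∀ g g', r' g N = r' g' N := fun g g' => by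
      rw [hlow g N (by omega), hlow g' N (by omega)]; exact p.hc g g'
    have hU : ∀ g, g ∈ U ↔ r' g t = r' g N := fun g => by
      rw [hlow g N (by omega), hlow g t htn]; exact p.hU g
    have hs := gSat_congr _ _ _ r r' (fun g v hv => (hlow g v (by
      have := p.hf v hv; omega)).symm) p.hs
    refine ⟨r', h1, fun g v _ hv => h2 g v hv, ?_, ?_⟩
    · simp only [cA, List.mem_singleton, forall_eq]
      intro g _ g' _ h
      simp only [List.map_cons, List.cons.injEq] at h
      have hx := fun g => copy_map (r' g) N t n xs fun v hv => h3 v (hf v (Or.inl hv)) g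
      have y1 := h3 y (hf y (Or.inr rfl)) g
      have y2 := h3 y (hf y (Or.inr rfl)) g'
      have hcc := hc g g'
      by_cases hg : r' g t = r' g N
      · have hg' : r' g' t = r' g' N := by rw [← h.1, hg, hc]
        have := hs g ((hU g).2 hg) g' ((hU g').2 hg') (by
          rw [← (hx g).1 hg, ← (hx g').1 hg', h.2])
        grind
      · have hg' : r' g' t ≠ r' g' N := by rw [← h.1, ← hc g]; exact hg
        grind
    · simp only [cT, List.forall_mem_map, foT_copy]
      intro v hv
      exact h3 v (hf v (by simpa [or_comm] using hv))
  | indep xs ys zs =>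
    intro D t n U r p
    obtain ⟨r', h1, h2, h3⟩ := copy_ex p.hr p.ht p.htn
    have hf := p.hf
    have ht := p.ht
    have htn := p.htn
    simp only [freeVars, Set.mem_ofPred_eq, List.mem_append] at hf
    have hlow : ∀ g v, v < n → r' g v = r g v := fun g v hv => h2 g v (by omega)
    have hc : ∀ g g', r' g N = r' g' N := fun g g' => by
      rw [hlow g N (by omega), hlow g' N (by omega)]; exact p.hc g g'
    have hU : ∀ g, g ∈ U ↔ r' g t = r' g N := fun g => by
      rw [hlow g N (by omega), hlow g t htn]; exact p.hU g
    have hs := gSat_congr _ _ _ r r' (fun g v hv => (hlow g v (by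
      have := p.hf v hv; omega)).symm) p.hs
    refine ⟨r', h1, fun g v _ hv => h2 g v hv, ?_, ?_⟩
    · simp only [cA, List.mem_singleton, forall_eq]
      intro g _ g' _ h
      simp only [List.map_cons, List.cons.injEq] at h
      have hx := fun g => copy_map (r' g) N t n xs fun v hv => h3 v (hf v (by tauto)) g
      have hy := fun g => copy_map (r' g) N t n ys fun v hv => h3 v (hf v (by tauto)) g
      have hz := fun g => copy_map (r' g) N t n zs fun v hv => h3 v (hf v (by tauto)) g
      by_cases hg : r' g t = r' g N
      · have hg' : r' g' t = r' g' N := by rw [← h.1, hg, hc]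
        obtain ⟨g'', hg'', j1, j2, j3⟩ := hs g ((hU g).2 hg) g' ((hU g').2 hg') (by
          rw [← (hx g).1 hg, ← (hx g').1 hg', h.2])
        have hg3 := (hU g'').1 hg''
        refine ⟨g'', trivial, ?_, ?_, ?_⟩
        · rw [List.map_cons, List.map_cons, (hx g'').1 hg3, (hx g).1 hg, j1, hg3, hg, hc]
        · rw [(hy g'').1 hg3, (hy g).1 hg, j2]
        · rw [(hz g'').1 hg3, (hz g').1 hg', j3]
      · have hg' : r' g' t ≠ r' g' N := by rw [← h.1, ← hc g]; exact hg
        exact ⟨g, trivial, rfl, rfl, by rw [(hz g).2 hg, (hz g').2 hg', hc g g']⟩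
    · simp only [cT, List.forall_mem_map, foT_copy]
      intro v hv
      exact h3 v (hf v (by simpa [or_assoc] using hv))
  | inc xs ys =>
    intro D t n U r p
    obtain ⟨r', h1, h2, h3⟩ := copy_ex p.hr p.ht p.htn
    have hf := p.hf
    have ht := p.ht
    have htn := p.htn
    have hs0 := p.hs
    simp only [freeVars, Set.mem_ofPred_eq, List.mem_append] at hf
    have hlow : ∀ g v, v < n → r' g v = r g v := fun g v hv => h2 g v (by omega)
    have hc : ∀ g g', r' g N = r' g' N := fun g g' => by
      rw [hlow g N (by omega), hlow g' N (by omega)]; exact p.hc g g'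
    have hU : ∀ g, g ∈ U ↔ r' g t = r' g N := fun g => by
      rw [hlow g N (by omega), hlow g t htn]; exact p.hU g
    have hs := gSat_congr _ _ _ r r' (fun g v hv => (hlow g v (by
      have := p.hf v hv; omega)).symm) p.hs
    by_cases hl : xs.length = ys.length
    on_goal 2 =>
      refine ⟨r', h1, fun g v _ hv => h2 g v hv, by simp [cA, hl], ?_⟩
      simp only [cT, if_neg hl, List.mem_singleton, forall_eq]
      intro g hg
      obtain ⟨g', -, j⟩ := hs g ((hU g).2 hg)
      exact hl (by simpa using congrArg List.length j)
    refine ⟨r', h1, fun g v _ hv => h2 g v hv, ?_, ?_⟩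
    · simp only [cA, if_pos hl, List.mem_singleton, forall_eq]
      intro g _
      have hx := fun g => copy_map (r' g) N t n xs fun v hv => h3 v (hf v (by tauto)) g
      have hy := fun g => copy_map (r' g) N t n ys fun v hv => h3 v (hf v (by tauto)) g
      by_cases hg : r' g t = r' g N
      · obtain ⟨g', hg', j⟩ := hs g ((hU g).2 hg)
        have hg'' := (hU g').1 hg'
        refine ⟨g', trivial, ?_⟩
        rw [List.map_cons, List.map_cons, (hx g).1 hg, (hy g').1 hg'', j, hg, hg'', hc]
      · refine ⟨g, trivial, ?_⟩
        rw [List.map_cons, List.map_cons, (hx g).2 hg, (hy g).2 hg]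
        simp [hl]
    · simp only [cT, if_pos hl, List.forall_mem_map, foT_copy]
      intro v hv
      exact h3 v (hf v (by simpa using hv))

def andL : TF L → List (TF L) → TF L
  | a, [] => a
  | a, b :: l => .and a (andL b l)

theorem andL_all (p : TF L → Prop) (hp : ∀ φ ψ, p φ → p ψ → p (.and φ ψ)) (l : List (TF L)) :
    ∀ a, p a → (∀ b ∈ l, p b) → p (andL a l) := by
  induction l with
  | nil => intro a ha _; exact ha
  | cons b l ih =>
    intro a ha h
    exact hp _ _ ha (ih b (h b (by simp)) fun c hc => h c (by simp [hc]))

theorem gSat_andL {M : Type w} [L.Structure M] (D : List ℕ) (U : Set (ℕ → M))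
    (r : (ℕ → M) → ℕ → M) (l : List (TF L)) : ∀ a,
    (gSat M D U r (andL a l) ↔ gSat M D U r a ∧ ∀ b ∈ l, gSat M D U r b) := by
  induction l with
  | nil => intro a; simp [andL]
  | cons b l ih => intro a; simp only [andL, gSat, ih, List.forall_mem_cons]

theorem gSat_atom {M : Type w} [L.Structure M] (D D' : List ℕ) (U : Set (ℕ → M))
    (r : (ℕ → M) → ℕ → M) (α : TF L) (h : isAtom α) :
    gSat M D U r α ↔ gSat M D' U r α := by
  cases α <;> first | exact h.elim | rfl

theorem quantFree_bound (φ : TF L) (h : quantFree φ) : boundVars φ = [] ∧ uCount φ = 0 := by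
  induction φ with
  | and φ ψ h1 h2 => simp [boundVars, uCount, h1 h.1, h2 h.2]
  | or φ ψ h1 h2 => simp [boundVars, uCount, h1 h.1, h2 h.2]
  | ex => exact h.elim
  | all => exact h.elim
  | _ => simp [boundVars, uCount]

theorem isFO_no (φ : TF L) (h : isFO φ) : ¬ hasIndep φ ∧ ¬ hasInc φ := by
  induction φ with
  | and φ ψ h1 h2 => have := h1 h.1; have := h2 h.2; simp only [hasIndep, hasInc]; tauto
  | or φ ψ h1 h2 => have := h1 h.1; have := h2 h.2; simp only [hasIndep, hasInc]; tauto
  | ex v φ ih => exact ih h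
  | all v φ ih => exact ih h
  | dep | indep | inc => exact h.elim
  | _ => simp [hasIndep, hasInc]

theorem alls_bound (xs : List ℕ) (ψ : TF L) : boundVars (alls xs ψ) = xs ++ boundVars ψ ∧
    uCount (alls xs ψ) = uCount ψ + xs.length ∧ (hasIndep (alls xs ψ) ↔ hasIndep ψ) ∧
    (hasInc (alls xs ψ) ↔ hasInc ψ) ∧
    (∀ v, v ∈ freeVars (alls xs ψ) → v ∈ freeVars ψ ∧ v ∉ xs) := by
  induction xs with
  | nil => simp [alls]
  | cons x xs ih =>
    obtain ⟨h1, h2, h3, h4, h5⟩ := ih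
    refine ⟨by simp [alls, boundVars, h1], by simp [alls, uCount, h2]; omega, h3, h4, ?_⟩
    rintro v ⟨hv, hx⟩
    have := h5 v hv
    exact ⟨this.1, by simp only [List.mem_cons, not_or]; exact ⟨hx, this.2⟩⟩

theorem exs_bound (xs : List ℕ) (ψ : TF L) : boundVars (exs xs ψ) = xs ++ boundVars ψ ∧
    uCount (exs xs ψ) = uCount ψ ∧ (hasIndep (exs xs ψ) ↔ hasIndep ψ) ∧
    (hasInc (exs xs ψ) ↔ hasInc ψ) ∧
    (∀ v, v ∈ freeVars (exs xs ψ) → v ∈ freeVars ψ ∧ v ∉ xs) := by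
  induction xs with
  | nil => simp [exs]
  | cons x xs ih =>
    obtain ⟨h1, h2, h3, h4, h5⟩ := ih
    refine ⟨by simp [exs, boundVars, h1], by simp [exs, uCount, h2], h3, h4, ?_⟩
    rintro v ⟨hv, hx⟩
    have := h5 v hv
    exact ⟨this.1, by simp only [List.mem_cons, not_or]; exact ⟨hx, this.2⟩⟩

theorem tTrue_iff {M : Type w} [L.Structure M] [Nonempty M] (φ : TF L) (h : freeVars φ = ∅)
    (hn : (boundVars φ).Nodup) (r : (ℕ → M) → ℕ → M) :
    tTrue M φ ↔ gSat M [] Set.univ r φ := by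
  rw [← strict_iff_gSat φ [] Set.univ (fun _ => emptyAssign M) r (by simp) (by simp) (by simp)
    (by simp) hn (by simp [h])]
  rw [Set.univ_nonempty.image_const]
  rfl

end Prenex

/-- **Prenex normal form theorem.**  Let `C ⊆ {=(…), ⊥_c, ⊆}` (membership of the
three kinds of atoms in `C` is given by the propositions `cd`, `ci`, `cc`) and let
`φ ∈ FO(C)(k∀)` be a sentence in which every variable is quantified exactly once and
at most `k` universal quantifiers occur.  Then there is a sentence
`φ' ∈ FO({=(…)} ∪ C)(k∀)`, logically equivalent to `φ` over all structures with at
least two elements (strict semantics), of the form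
`∀x₁ … ∀x_m ∃x_{m+1} … ∃x_{m+n} (χ ∧ θ)` with `m ≤ k`, where `χ` is a conjunction of
`{=(…)} ∪ C`-atoms and `θ` is a quantifier-free first-order formula. -/
theorem prenex_normal_form {L : FirstOrder.Language.{u, v}} (cd ci cc : Prop) (k : ℕ)
    (φ : TF L) (hφsent : freeVars φ = ∅) (hφnodup : (boundVars φ).Nodup)
    (hφk : uCount φ ≤ k)
    (hφd : hasDep φ → cd) (hφi : hasIndep φ → ci) (hφc : hasInc φ → cc) :
    ∃ (xs ys : List ℕ) (χ θ : TF L) (φ' : TF L),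
      φ' = alls xs (exs ys (TF.and χ θ)) ∧
      xs.length ≤ k ∧
      isAtomConj χ ∧ quantFree θ ∧ isFO θ ∧
      freeVars φ' = ∅ ∧ (boundVars φ').Nodup ∧ uCount φ' ≤ k ∧
      (hasIndep φ' → ci) ∧ (hasInc φ' → cc) ∧
      ∀ (M : Type w) [L.Structure M], (∃ a b : M, a ≠ b) →
        (tTrue M φ ↔ tTrue M φ') := by
  obtain ⟨N, hN⟩ : ∃ N, ∀ v ∈ boundVars φ, v < N :=
    ⟨(boundVars φ).sum + 1, fun v hv => Nat.lt_succ_of_le (List.le_sum_of_mem hv)⟩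
  have hf0 : ∀ v, v ∉ freeVars φ := by simp [hφsent]
  have hperm := perm_vars φ
  have hmem := mem_bound φ
  have hnd2 : (uVars φ ++ eVars φ).Nodup := hperm.nodup_iff.1 hφnodup
  let xs := uVars φ
  let ys := eVars φ ++ List.range' N (1 + sz N φ)
  let χ : TF L := andL (.dep [] N) (cA N φ [] N (N + 1))
  let θ : TF L := andL (vEq N N) (cT N φ N (N + 1))
  let φ' : TF L := alls xs (exs ys (.and χ θ))
  have hA := cA_atom N φ [] N (N + 1)
  have hT := cT_fo N φ N (N + 1)
  have hχ : isAtomConj χ := andL_all isAtomConj (fun _ _ h1 h2 => ⟨h1, h2⟩) _ _ trivial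
    fun b hb => by
      have := (hA b hb).1
      cases b <;> first | exact this.elim | trivial
  have hχq : quantFree χ := andL_all quantFree (fun _ _ h1 h2 => ⟨h1, h2⟩) _ _ trivial
    fun b hb => by
      have := (hA b hb).1
      cases b <;> first | exact this.elim | trivial
  have hθq : quantFree θ := andL_all quantFree (fun _ _ h1 h2 => ⟨h1, h2⟩) _ _ trivial
    fun b hb => (hT b hb).1
  have hθf : isFO θ := andL_all isFO (fun _ _ h1 h2 => ⟨h1, h2⟩) _ _ trivial
    fun b hb => (hT b hb).2
  have hχi : hasIndep χ → hasIndep φ := andL_all (fun α => hasIndep α → hasIndep φ)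
    (fun _ _ h1 h2 h => h.elim h1 h2) _ _ (fun h => h.elim) fun b hb => (hA b hb).2.1
  have hχc : hasInc χ → hasInc φ := andL_all (fun α => hasInc α → hasInc φ)
    (fun _ _ h1 h2 h => h.elim h1 h2) _ _ (fun h => h.elim) fun b hb => (hA b hb).2.2
  have hθn := isFO_no θ hθf
  have hysm : ∀ v, v ∈ ys ↔ v ∈ eVars φ ∨ N ≤ v ∧ v < N + 1 + sz N φ := fun v => by
    simp only [ys, List.mem_append, List.mem_range'_1, add_assoc]
  have hχv : ∀ v ∈ freeVars χ, v ∈ xs ∨ v ∈ ys :=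
    andL_all (fun α => ∀ v ∈ freeVars α, v ∈ xs ∨ v ∈ ys)
      (fun _ _ h1 h2 v h => h.elim (h1 v) (h2 v)) _ _ (fun v hv => by
        simp [freeVars] at hv; rw [hysm]; omega) fun b hb v hv => by
        have := cA_free N φ [] N (N + 1) (fun v hv => absurd hv (hf0 v)) hN b hb v hv
        rw [hmem] at this
        rw [hysm]
        rcases this with h | (h | h) | h | h | h
        · exact absurd h (hf0 v)
        · exact Or.inl h
        · exact Or.inr (Or.inl h)
        · simp at h
        · right; right; omega
        · right; right; omega
  have hθv : ∀ v ∈ freeVars θ, v ∈ xs ∨ v ∈ ys :=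
    andL_all (fun α => ∀ v ∈ freeVars α, v ∈ xs ∨ v ∈ ys)
      (fun _ _ h1 h2 v h => h.elim (h1 v) (h2 v)) _ _ (fun v hv => by
        simp [freeVars, vEq, tvars] at hv; rw [hysm]; omega) fun b hb v hv => by
        have := cT_free N φ N (N + 1) (fun v hv => absurd hv (hf0 v)) hN b hb v hv
        rw [hmem] at this
        rw [hysm]
        rcases this with h | (h | h) | h | h | h
        · exact absurd h (hf0 v)
        · exact Or.inl h
        · exact Or.inr (Or.inl h)
        · right; right; omega
        · right; right; omega
        · right; right; omega
  obtain ⟨e1, e2, e3, e4, e5⟩ := exs_bound ys (.and χ θ)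
  obtain ⟨a1, a2, a3, a4, a5⟩ := alls_bound xs (exs ys (.and χ θ))
  have hq := quantFree_bound (.and χ θ) ⟨hχq, hθq⟩
  have hfree : freeVars φ' = ∅ := by
    ext v
    simp only [Set.mem_empty_iff_false, iff_false]
    intro hv
    obtain ⟨h1, h2⟩ := a5 v hv
    obtain ⟨h3, h4⟩ := e5 v h1
    rcases h3 with h3 | h3
    · exact (hχv v h3).elim h2 h4
    · exact (hθv v h3).elim h2 h4
  have hlt : ∀ v, v ∈ uVars φ ∨ v ∈ eVars φ → v < N := fun v h => hN v ((hmem v).2 h)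
  have hdisj : ∀ v ∈ xs, v ∉ ys := fun v hv hv' => by
    rw [hysm] at hv'
    have h1 := hlt v (Or.inl hv)
    rcases hv' with h | h
    · exact (List.nodup_append.1 hnd2).2.2 v hv v h rfl
    · omega
  have hnodup : (boundVars φ').Nodup := by
    have hbv : boundVars φ' = xs ++ ys := by
      simp only [φ', a1, e1, hq.1, List.append_nil]
    rw [hbv, List.nodup_append]
    refine ⟨(List.nodup_append.1 hnd2).1, ?_, fun a ha b hb hab => hdisj a ha (hab ▸ hb)⟩
    rw [List.nodup_append]
    refine ⟨(List.nodup_append.1 hnd2).2.1, List.nodup_range', fun a ha b hb hab => ?_⟩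
    have h1 := hlt a (Or.inr ha)
    rw [List.mem_range'_1] at hb
    omega
  refine ⟨xs, ys, χ, θ, φ', rfl, ?_, hχ, hθq, hθf, hfree, hnodup, ?_, ?_, ?_, ?_⟩
  · exact (uVars_length φ).le.trans hφk
  · have := uVars_length φ
    simp only [φ', a2, e2, hq.2, xs]; omega
  · intro h
    exact hφi (hχi (((e3.1 (a3.1 h))).resolve_right hθn.1))
  · intro h
    exact hφc (hχc (((e4.1 (a4.1 h))).resolve_right hθn.2))
  intro M _ hM
  classical
  obtain ⟨m, _, _⟩ := id hM
  haveI : Nonempty M := ⟨m⟩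
  let r : (ℕ → M) → ℕ → M := fun g v => if v ∈ xs then g v else m
  have hrx : ∀ g, ∀ v ∈ xs, r g v = g v := fun g v hv => by simp only [r, if_pos hv]
  have hrE : ∀ g g', Ag (xs.reverse ++ []) g g' → r g = r g' := fun g g' h => by
    funext v
    by_cases hv : v ∈ xs
    · rw [hrx g v hv, hrx g' v hv]; exact h v (by simpa using hv)
    · simp only [r, if_neg hv]
  rw [tTrue_iff φ hφsent hφnodup r, tTrue_iff φ' hfree hnodup r, gSat_alls _ _ _ _ _ hrx,
    gSat_exs _ _ _ _ r hrE]
  have hNe : N ∉ eVars φ := fun h => lt_irrefl _ (hlt N (Or.inr h))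
  constructor
  · intro hs
    obtain ⟨r', q⟩ := complete hM N (xs.reverse ++ []) φ [] N (N + 1) Set.univ r
      { hf := fun v hv => absurd hv (hf0 v), hb := hN, hfb := fun v hv => absurd hv (hf0 v)
        hnd := hφnodup, hD := by simp, ht := le_rfl, htn := Nat.lt_succ_self N
        huE := fun v hv => by simpa using hv
        hr := hrE, hrD := by simp, hru := hrx, hU := by simp, hUd := by simp
        hc := fun g g' => by
          have : N ∉ xs := fun h => lt_irrefl _ (hlt N (Or.inl h))
          simp only [r, if_neg this]
        hs := hs }
    have hNr : ∀ g, r' g N = r g N := fun g => q.ha g N hNe (by omega)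
    refine ⟨r', q.hr, fun g v hv => ?_, ?_, ?_⟩
    · rw [hysm, not_or] at hv
      exact q.ha g v hv.1 (by omega)
    · rw [gSat_andL]
      refine ⟨?_, fun b hb => (gSat_atom _ [] _ _ b (hA b hb).1).2 (q.hA b hb)⟩
      intro g _ g' _ _
      rw [hNr, hNr]
      have : N ∉ xs := fun h => lt_irrefl _ (hlt N (Or.inl h))
      simp only [r, if_neg this]
    · rw [gSat_andL]
      exact ⟨fun g _ => rfl, fun b hb => (gSat_flat _ r' q.hr b _ (hT b hb).1 (hT b hb).2).2
        fun g _ => q.hT b hb g⟩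
  · rintro ⟨r', hr', hag, h1, h2⟩
    rw [gSat_andL] at h1 h2
    have hx' : ∀ g, ∀ v ∈ uVars φ, r' g v = g v := fun g v hv => by
      rw [hag g v (hdisj v hv), hrx g v hv]
    have := sound N r' (fun g g' => h1.1 g trivial g' trivial rfl) φ [] N (N + 1) (by simp) hx'
      (fun b hb => (gSat_atom _ [] _ _ b (hA b hb).1).1 (h1.2 b hb))
      (fun b hb g => (gSat_flat _ r' hr' b _ (hT b hb).1 (hT b hb).2).1 (h2.2 b hb) g trivial)
    refine gSat_congr φ _ _ r' r (fun g v hv => absurd hv (hf0 v)) ?_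
    simpa using this

end TeamSem
end

section
/- For every sentence ψ ∈ FO(=(…), ⊥_c, ⊆)(k∀) there is a sentence τ_ψ ∈ ESO_f((k+1)∀) such that for all structures A with at least two elements: A ⊨ ψ under strict team semantics if and only if A ⊨ τ_ψ. -/
open FirstOrder FirstOrder.Language FirstOrder.Language.Structure

namespace TeamSem

/-- Terms of the language `L` extended with function symbols from `F` (where `f : F`
has arity `ar f`), with first-order variables in `ℕ`. -/
inductive ETerm (L : FirstOrder.Language.{u, v}) (F : Type) (ar : F → ℕ) :
    Type (max u v) where
  | var : ℕ → ETerm L F ar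
  | func : {n : ℕ} → L.Functions n → (Fin n → ETerm L F ar) → ETerm L F ar
  | efunc : (f : F) → (Fin (ar f) → ETerm L F ar) → ETerm L F ar

/-- Quantifier-free first-order formulas over `L` extended with function symbols
from `F`. -/
inductive EQF (L : FirstOrder.Language.{u, v}) (F : Type) (ar : F → ℕ) :
    Type (max u v) where
  | rel : {n : ℕ} → L.Relations n → (Fin n → ETerm L F ar) → EQF L F ar
  | nrel : {n : ℕ} → L.Relations n → (Fin n → ETerm L F ar) → EQF L F ar
  | teq : ETerm L F ar → ETerm L F ar → EQF L F ar
  | tne : ETerm L F ar → ETerm L F ar → EQF L F ar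
  | and : EQF L F ar → EQF L F ar → EQF L F ar
  | or : EQF L F ar → EQF L F ar → EQF L F ar

variable {L : FirstOrder.Language.{u, v}} {F : Type} {ar : F → ℕ}

/-- Realization of an extended term, given interpretations `fi` of the extra
function symbols and an assignment `s` of the variables. -/
def ETerm.realize {M : Type w} [L.Structure M]
    (fi : ∀ f : F, (Fin (ar f) → M) → M) (s : ℕ → M) : ETerm L F ar → M
  | .var n => s n
  | .func g ts => funMap g fun i => (ts i).realize fi s
  | .efunc f ts => fi f fun i => (ts i).realize fi s

/-- Realization of a quantifier-free extended formula. -/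
def EQF.realize {M : Type w} [L.Structure M]
    (fi : ∀ f : F, (Fin (ar f) → M) → M) (s : ℕ → M) : EQF L F ar → Prop
  | .rel R ts => RelMap R fun i => (ts i).realize fi s
  | .nrel R ts => ¬ RelMap R fun i => (ts i).realize fi s
  | .teq t u => t.realize fi s = u.realize fi s
  | .tne t u => t.realize fi s ≠ u.realize fi s
  | .and φ ψ => φ.realize fi s ∧ ψ.realize fi s
  | .or φ ψ => φ.realize fi s ∨ ψ.realize fi s

/-- All variables occurring in the term are among `x₀, …, x_{r-1}`. -/
def ETerm.varsLT (r : ℕ) : ETerm L F ar → Prop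
  | .var n => n < r
  | .func _ ts => ∀ i, (ts i).varsLT r
  | .efunc _ ts => ∀ i, (ts i).varsLT r

/-- All variables occurring in the formula are among `x₀, …, x_{r-1}`. -/
def EQF.varsLT (r : ℕ) : EQF L F ar → Prop
  | .rel _ ts => ∀ i, (ts i).varsLT r
  | .nrel _ ts => ∀ i, (ts i).varsLT r
  | .teq t u => t.varsLT r ∧ u.varsLT r
  | .tne t u => t.varsLT r ∧ u.varsLT r
  | .and φ ψ => φ.varsLT r ∧ ψ.varsLT r
  | .or φ ψ => φ.varsLT r ∧ ψ.varsLT r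

/-- Truth of the `ESO_f` sentence `∃f₁…∃fₙ ∀x₁…∀x_r θ` in `M`: there are
interpretations of the function symbols such that `θ` holds under every assignment
of the universally quantified variables. -/
def esoTrue (M : Type w) [L.Structure M] (θ : EQF L F ar) : Prop :=
  ∃ fi : ∀ f : F, (Fin (ar f) → M) → M, ∀ s : ℕ → M, θ.realize fi s

end TeamSem

namespace TeamSem

section Helpers

universe u v w

variable {L : FirstOrder.Language.{u, v}} {F : Type} {ar : F → ℕ}

/-- Substitution of terms for variables. -/
def ETerm.subst (σ : ℕ → ETerm L F ar) : ETerm L F ar → ETerm L F ar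
  | .var n => σ n
  | .func g ts => .func g fun i => (ts i).subst σ
  | .efunc f ts => .efunc f fun i => (ts i).subst σ

def EQF.subst (σ : ℕ → ETerm L F ar) : EQF L F ar → EQF L F ar
  | .rel R ts => .rel R fun i => (ts i).subst σ
  | .nrel R ts => .nrel R fun i => (ts i).subst σ
  | .teq t u => .teq (t.subst σ) (u.subst σ)
  | .tne t u => .tne (t.subst σ) (u.subst σ)
  | .and φ ψ => .and (φ.subst σ) (ψ.subst σ)
  | .or φ ψ => .or (φ.subst σ) (ψ.subst σ)

def EQF.neg : EQF L F ar → EQF L F ar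
  | .rel R ts => .nrel R ts
  | .nrel R ts => .rel R ts
  | .teq t u => .tne t u
  | .tne t u => .teq t u
  | .and φ ψ => .or φ.neg ψ.neg
  | .or φ ψ => .and φ.neg ψ.neg

/-- Renaming of the extra function symbols. -/
def ETerm.mapS {F' : Type} {ar' : F' → ℕ} (σ : F → F') (h : ∀ f, ar' (σ f) = ar f) :
    ETerm L F ar → ETerm L F' ar'
  | .var n => .var n
  | .func g ts => .func g fun i => (ts i).mapS σ h
  | .efunc f ts => .efunc (σ f) fun i => (ts (Fin.cast (h f) i)).mapS σ h

def EQF.mapS {F' : Type} {ar' : F' → ℕ} (σ : F → F') (h : ∀ f, ar' (σ f) = ar f) :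
    EQF L F ar → EQF L F' ar'
  | .rel R ts => .rel R fun i => (ts i).mapS σ h
  | .nrel R ts => .nrel R fun i => (ts i).mapS σ h
  | .teq t u => .teq (t.mapS σ h) (u.mapS σ h)
  | .tne t u => .tne (t.mapS σ h) (u.mapS σ h)
  | .and φ ψ => .and (φ.mapS σ h) (ψ.mapS σ h)
  | .or φ ψ => .or (φ.mapS σ h) (ψ.mapS σ h)

section real
variable {M : Type w} [L.Structure M] (fi : ∀ f : F, (Fin (ar f) → M) → M)

theorem ETerm.realize_subst (σ : ℕ → ETerm L F ar) (s : ℕ → M) (t : ETerm L F ar) :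
    (t.subst σ).realize fi s = t.realize fi (fun n => (σ n).realize fi s) := by
  induction t with
  | var n => rfl
  | func g ts ih => simp only [ETerm.subst, ETerm.realize, ih]
  | efunc f ts ih => simp only [ETerm.subst, ETerm.realize, ih]

theorem EQF.realize_subst (σ : ℕ → ETerm L F ar) (s : ℕ → M) (t : EQF L F ar) :
    (t.subst σ).realize fi s ↔ t.realize fi (fun n => (σ n).realize fi s) := by
  induction t with
  | rel => simp only [EQF.subst, EQF.realize, ETerm.realize_subst]
  | nrel => simp only [EQF.subst, EQF.realize, ETerm.realize_subst]
  | teq => simp only [EQF.subst, EQF.realize, ETerm.realize_subst]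
  | tne => simp only [EQF.subst, EQF.realize, ETerm.realize_subst]
  | and _ _ h1 h2 => simp only [EQF.subst, EQF.realize, h1, h2]
  | or _ _ h1 h2 => simp only [EQF.subst, EQF.realize, h1, h2]

theorem EQF.realize_neg (s : ℕ → M) (t : EQF L F ar) :
    t.neg.realize fi s ↔ ¬ t.realize fi s := by
  induction t with
  | rel => simp only [EQF.neg, EQF.realize]
  | nrel => simp only [EQF.neg, EQF.realize, not_not]
  | teq => simp only [EQF.neg, EQF.realize, ne_eq]
  | tne => simp only [EQF.neg, EQF.realize, ne_eq, not_not]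
  | and _ _ h1 h2 => simp only [EQF.neg, EQF.realize, h1, h2]; tauto
  | or _ _ h1 h2 => simp only [EQF.neg, EQF.realize, h1, h2]; tauto

theorem ETerm.realize_mapS {F' : Type} {ar' : F' → ℕ} (σ : F → F')
    (h : ∀ f, ar' (σ f) = ar f) (fi' : ∀ f : F', (Fin (ar' f) → M) → M)
    (hfi : ∀ f v, fi' (σ f) (fun i => v (Fin.cast (h f) i)) = fi f v)
    (s : ℕ → M) (t : ETerm L F ar) :
    (t.mapS σ h).realize fi' s = t.realize fi s := by
  induction t with
  | var n => rfl
  | func g ts ih => simp only [ETerm.mapS, ETerm.realize, ih]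
  | efunc f ts ih =>
    simp only [ETerm.mapS, ETerm.realize, ih]
    exact hfi f (fun i => (ts i).realize fi s)

theorem EQF.realize_mapS {F' : Type} {ar' : F' → ℕ} (σ : F → F')
    (h : ∀ f, ar' (σ f) = ar f) (fi' : ∀ f : F', (Fin (ar' f) → M) → M)
    (hfi : ∀ f v, fi' (σ f) (fun i => v (Fin.cast (h f) i)) = fi f v)
    (s : ℕ → M) (t : EQF L F ar) :
    (t.mapS σ h).realize fi' s ↔ t.realize fi s := by
  induction t with
  | rel => simp only [EQF.mapS, EQF.realize, ETerm.realize_mapS fi σ h fi' hfi]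
  | nrel => simp only [EQF.mapS, EQF.realize, ETerm.realize_mapS fi σ h fi' hfi]
  | teq => simp only [EQF.mapS, EQF.realize, ETerm.realize_mapS fi σ h fi' hfi]
  | tne => simp only [EQF.mapS, EQF.realize, ETerm.realize_mapS fi σ h fi' hfi]
  | and _ _ h1 h2 => simp only [EQF.mapS, EQF.realize, h1, h2]
  | or _ _ h1 h2 => simp only [EQF.mapS, EQF.realize, h1, h2]

theorem ETerm.realize_congr {r : ℕ} {s s' : ℕ → M} (hs : ∀ n < r, s n = s' n)
    {t : ETerm L F ar} (ht : t.varsLT r) : t.realize fi s = t.realize fi s' := by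
  induction t with
  | var n => exact hs n ht
  | func g ts ih =>
    simp only [ETerm.realize]
    congr 1; funext i; exact ih i (ht i)
  | efunc f ts ih =>
    simp only [ETerm.realize]
    congr 1; funext i; exact ih i (ht i)

theorem EQF.realize_congr {r : ℕ} {s s' : ℕ → M} (hs : ∀ n < r, s n = s' n)
    {t : EQF L F ar} (ht : t.varsLT r) : t.realize fi s ↔ t.realize fi s' := by
  induction t with
  | rel R ts =>
    simp only [EQF.realize, fun i => ETerm.realize_congr fi hs (ht i)]
  | nrel R ts =>
    simp only [EQF.realize, fun i => ETerm.realize_congr fi hs (ht i)]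
  | teq => simp only [EQF.realize, ETerm.realize_congr fi hs ht.1, ETerm.realize_congr fi hs ht.2]
  | tne => simp only [EQF.realize, ETerm.realize_congr fi hs ht.1, ETerm.realize_congr fi hs ht.2]
  | and _ _ h1 h2 => simp only [EQF.realize, h1 ht.1, h2 ht.2]
  | or _ _ h1 h2 => simp only [EQF.realize, h1 ht.1, h2 ht.2]

end real

theorem ETerm.varsLT_mono {a b : ℕ} (hab : a ≤ b) {t : ETerm L F ar} (h : t.varsLT a) :
    t.varsLT b := by
  induction t with
  | var n => exact lt_of_lt_of_le h hab
  | func g ts ih => exact fun i => ih i (h i)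
  | efunc g ts ih => exact fun i => ih i (h i)

theorem EQF.varsLT_mono {a b : ℕ} (hab : a ≤ b) {t : EQF L F ar} (h : t.varsLT a) :
    t.varsLT b := by
  induction t with
  | rel => exact fun i => ETerm.varsLT_mono hab (h i)
  | nrel => exact fun i => ETerm.varsLT_mono hab (h i)
  | teq => exact ⟨ETerm.varsLT_mono hab h.1, ETerm.varsLT_mono hab h.2⟩
  | tne => exact ⟨ETerm.varsLT_mono hab h.1, ETerm.varsLT_mono hab h.2⟩
  | and _ _ h1 h2 => exact ⟨h1 h.1, h2 h.2⟩
  | or _ _ h1 h2 => exact ⟨h1 h.1, h2 h.2⟩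

theorem EQF.varsLT_neg {a : ℕ} {t : EQF L F ar} (h : t.varsLT a) :
    t.neg.varsLT a := by
  induction t with
  | rel => exact h
  | nrel => exact h
  | teq => exact h
  | tne => exact h
  | and _ _ h1 h2 => exact ⟨h1 h.1, h2 h.2⟩
  | or _ _ h1 h2 => exact ⟨h1 h.1, h2 h.2⟩

theorem ETerm.varsLT_subst {a b : ℕ} {σ : ℕ → ETerm L F ar} (hσ : ∀ n < a, (σ n).varsLT b)
    {t : ETerm L F ar} (h : t.varsLT a) : (t.subst σ).varsLT b := by
  induction t with
  | var n => exact hσ n h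
  | func g ts ih => exact fun i => ih i (h i)
  | efunc g ts ih => exact fun i => ih i (h i)

theorem EQF.varsLT_subst {a b : ℕ} {σ : ℕ → ETerm L F ar} (hσ : ∀ n < a, (σ n).varsLT b)
    {t : EQF L F ar} (h : t.varsLT a) : (t.subst σ).varsLT b := by
  induction t with
  | rel => exact fun i => ETerm.varsLT_subst hσ (h i)
  | nrel => exact fun i => ETerm.varsLT_subst hσ (h i)
  | teq => exact ⟨ETerm.varsLT_subst hσ h.1, ETerm.varsLT_subst hσ h.2⟩
  | tne => exact ⟨ETerm.varsLT_subst hσ h.1, ETerm.varsLT_subst hσ h.2⟩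
  | and _ _ h1 h2 => exact ⟨h1 h.1, h2 h.2⟩
  | or _ _ h1 h2 => exact ⟨h1 h.1, h2 h.2⟩

theorem ETerm.varsLT_mapS {a : ℕ} {F' : Type} {ar' : F' → ℕ} {σ : F → F'}
    {h' : ∀ f, ar' (σ f) = ar f} {t : ETerm L F ar} (h : t.varsLT a) :
    (t.mapS σ h').varsLT a := by
  induction t with
  | var n => exact h
  | func g ts ih => exact fun i => ih i (h i)
  | efunc g ts ih => exact fun i => ih _ (h _)

theorem EQF.varsLT_mapS {a : ℕ} {F' : Type} {ar' : F' → ℕ} {σ : F → F'}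
    {h' : ∀ f, ar' (σ f) = ar f} {t : EQF L F ar} (h : t.varsLT a) :
    (t.mapS σ h').varsLT a := by
  induction t with
  | rel => exact fun i => ETerm.varsLT_mapS (h i)
  | nrel => exact fun i => ETerm.varsLT_mapS (h i)
  | teq => exact ⟨ETerm.varsLT_mapS h.1, ETerm.varsLT_mapS h.2⟩
  | tne => exact ⟨ETerm.varsLT_mapS h.1, ETerm.varsLT_mapS h.2⟩
  | and _ _ h1 h2 => exact ⟨h1 h.1, h2 h.2⟩
  | or _ _ h1 h2 => exact ⟨h1 h.1, h2 h.2⟩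

def EQF.imp (a b : EQF L F ar) : EQF L F ar := .or a.neg b

theorem EQF.realize_imp {M : Type w} [L.Structure M] (fi : ∀ f : F, (Fin (ar f) → M) → M)
    (s : ℕ → M) (a b : EQF L F ar) :
    (a.imp b).realize fi s ↔ (a.realize fi s → b.realize fi s) := by
  simp only [EQF.imp, EQF.realize, EQF.realize_neg]; tauto

theorem EQF.varsLT_imp {r : ℕ} {a b : EQF L F ar} (ha : a.varsLT r) (hb : b.varsLT r) :
    (a.imp b).varsLT r := ⟨EQF.varsLT_neg ha, hb⟩

/-- Conjunction of a formula with a list of equations. -/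
def EQF.eqs (a : EQF L F ar) : List (ETerm L F ar × ETerm L F ar) → EQF L F ar
  | [] => a
  | p :: l => .and (.teq p.1 p.2) (EQF.eqs a l)

theorem EQF.realize_eqs {M : Type w} [L.Structure M] (fi : ∀ f : F, (Fin (ar f) → M) → M)
    (s : ℕ → M) (a : EQF L F ar) (l : List (ETerm L F ar × ETerm L F ar)) :
    (a.eqs l).realize fi s ↔
      (a.realize fi s ∧ ∀ p ∈ l, p.1.realize fi s = p.2.realize fi s) := by
  induction l with
  | nil => simp [EQF.eqs]
  | cons p l ih => simp only [EQF.eqs, EQF.realize, ih, List.forall_mem_cons]; tauto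

theorem EQF.varsLT_eqs {r : ℕ} {a : EQF L F ar} {l : List (ETerm L F ar × ETerm L F ar)}
    (ha : a.varsLT r) (hl : ∀ p ∈ l, p.1.varsLT r ∧ p.2.varsLT r) : (a.eqs l).varsLT r := by
  induction l with
  | nil => exact ha
  | cons p l ih =>
    rw [List.forall_mem_cons] at hl
    exact ⟨hl.1, ih hl.2⟩

/-! Expressible predicates -/

/-- `P` is expressible by an existential second order sentence with `r` universal quantifiers
over the signature extended by `F`. -/
def Expr (r : ℕ) (F : Type) (ar : F → ℕ)
    (P : (A : Type w) → [L.Structure A] → (∀ f : F, (Fin (ar f) → A) → A) → Prop) : Prop :=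
  ∃ (G : Type) (_ : Finite G) (arG : G → ℕ) (θ : EQF L (F ⊕ G) (Sum.elim ar arG)),
    θ.varsLT r ∧ ∀ (A : Type w) [L.Structure A], Nontrivial A →
      ∀ fi : (∀ f : F, (Fin (ar f) → A) → A),
      (P A fi ↔ ∃ gi : (∀ g : G, (Fin (arG g) → A) → A), ∀ s : ℕ → A,
        θ.realize (Sum.rec fi gi : ∀ f : F ⊕ G, (Fin (Sum.elim ar arG f) → A) → A) s)

theorem Expr.congr {r : ℕ}
    {P Q : (A : Type w) → [L.Structure A] → (∀ f : F, (Fin (ar f) → A) → A) → Prop}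
    (h : Expr r F ar P)
    (hPQ : ∀ (A : Type w) [L.Structure A], Nontrivial A → ∀ fi, (Q A fi ↔ P A fi)) :
    Expr r F ar Q := by
  obtain ⟨G, hG, arG, θ, h1, h2⟩ := h
  exact ⟨G, hG, arG, θ, h1, fun A _ hA fi => (hPQ A hA fi).trans (h2 A hA fi)⟩

theorem Expr.qf {r : ℕ} (θ : EQF L F ar) (hθ : θ.varsLT r) :
    Expr.{u, v, w} (L := L) r F ar (fun A _ fi => ∀ s : ℕ → A, θ.realize fi s) := by
  refine ⟨Empty, inferInstance, Empty.elim, θ.mapS Sum.inl (fun _ => rfl), EQF.varsLT_mapS hθ, ?_⟩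
  intro A _ hA fi
  have key : ∀ (gi : (∀ g : Empty, (Fin (Empty.elim g) → A) → A)) s,
      (θ.mapS Sum.inl (fun _ => rfl)).realize
        (Sum.rec fi gi : ∀ f : F ⊕ Empty, (Fin (Sum.elim ar Empty.elim f) → A) → A) s ↔
      θ.realize fi s := by
    intro gi s
    refine EQF.realize_mapS fi Sum.inl (fun _ => rfl) _ ?_ s θ
    intro f v
    rfl
  constructor
  · intro h
    exact ⟨fun g => g.elim, fun s => (key _ s).2 (h s)⟩
  · rintro ⟨gi, h⟩ s
    exact (key gi s).1 (h s)

theorem Expr.and {r : ℕ}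
    {P Q : (A : Type w) → [L.Structure A] → (∀ f : F, (Fin (ar f) → A) → A) → Prop}
    (hP : Expr r F ar P) (hQ : Expr r F ar Q) :
    Expr (L := L) r F ar (fun A _ fi => P A fi ∧ Q A fi) := by
  obtain ⟨G, hG, arG, θ, h1, h2⟩ := hP
  obtain ⟨G', hG', arG', θ', h1', h2'⟩ := hQ
  let σ : F ⊕ G → F ⊕ (G ⊕ G') := Sum.elim Sum.inl (fun g => Sum.inr (Sum.inl g))
  let σ' : F ⊕ G' → F ⊕ (G ⊕ G') := Sum.elim Sum.inl (fun g => Sum.inr (Sum.inr g))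
  have hσ : ∀ f, (Sum.elim ar (Sum.elim arG arG')) (σ f) = Sum.elim ar arG f := by
    rintro (f | f) <;> rfl
  have hσ' : ∀ f, (Sum.elim ar (Sum.elim arG arG')) (σ' f) = Sum.elim ar arG' f := by
    rintro (f | f) <;> rfl
  refine ⟨G ⊕ G', inferInstance, Sum.elim arG arG', .and (θ.mapS σ hσ) (θ'.mapS σ' hσ'),
    ⟨EQF.varsLT_mapS h1, EQF.varsLT_mapS h1'⟩, ?_⟩
  intro A _ hA fi
  refine (and_congr (h2 A hA fi) (h2' A hA fi)).trans ?_
  constructor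
  · rintro ⟨⟨gi, h⟩, ⟨gi', h'⟩⟩
    refine ⟨Sum.rec gi gi', fun s => ⟨?_, ?_⟩⟩
    · refine (EQF.realize_mapS _ _ _ _ ?_ s θ).2 (h s)
      rintro (f | f) v <;> rfl
    · refine (EQF.realize_mapS _ _ _ _ ?_ s θ').2 (h' s)
      rintro (f | f) v <;> rfl
  · rintro ⟨gi, h⟩
    refine ⟨⟨fun g => gi (.inl g), fun s => ?_⟩, ⟨fun g => gi (.inr g), fun s => ?_⟩⟩
    · refine (EQF.realize_mapS _ _ _ _ ?_ s θ).1 (h s).1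
      rintro (f | f) v <;> rfl
    · refine (EQF.realize_mapS _ _ _ _ ?_ s θ').1 (h s).2
      rintro (f | f) v <;> rfl

/-- Extension of an interpretation by functions with arbitrary finite index types. -/
noncomputable def extI {A : Type w} (fi : ∀ f : F, (Fin (ar f) → A) → A) {H : Type}
    (ι : H → Type) [∀ h, Fintype (ι h)] (Φ : ∀ h, (ι h → A) → A) :
    ∀ f : F ⊕ H, (Fin (Sum.elim ar (fun h => Fintype.card (ι h)) f) → A) → A :=
  Sum.rec fi (fun h v => Φ h (fun i => v (Fintype.equivFin (ι h) i)))

noncomputable def appT {H : Type} (ι : H → Type) [∀ h, Fintype (ι h)] (h : H)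
    (args : ι h → ETerm L (F ⊕ H) (Sum.elim ar (fun h => Fintype.card (ι h)))) :
    ETerm L (F ⊕ H) (Sum.elim ar (fun h => Fintype.card (ι h))) :=
  .efunc (.inr h) (fun i => args ((Fintype.equivFin (ι h)).symm i))

theorem realize_appT {A : Type w} [L.Structure A] (fi : ∀ f : F, (Fin (ar f) → A) → A) {H : Type}
    (ι : H → Type) [∀ h, Fintype (ι h)] (Φ : ∀ h, (ι h → A) → A) (h : H)
    (args : ι h → ETerm L (F ⊕ H) (Sum.elim ar (fun h => Fintype.card (ι h)))) (s : ℕ → A) :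
    (appT ι h args).realize (extI fi ι Φ) s =
      Φ h (fun i => (args i).realize (extI fi ι Φ) s) := by
  simp only [appT, ETerm.realize]
  simp [extI]

theorem varsLT_appT {H : Type} {ι : H → Type} [∀ h, Fintype (ι h)] {h : H}
    {args : ι h → ETerm L (F ⊕ H) (Sum.elim ar (fun h => Fintype.card (ι h)))} {r : ℕ}
    (ha : ∀ i, (args i).varsLT r) : (appT ι h args).varsLT r :=
  fun _ => ha _

/-- Lifting terms. -/
def liftT {H : Type} {arH : H → ℕ} (t : ETerm L F ar) : ETerm L (F ⊕ H) (Sum.elim ar arH) :=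
  t.mapS Sum.inl (fun _ => rfl)

def liftQ {H : Type} {arH : H → ℕ} (t : EQF L F ar) : EQF L (F ⊕ H) (Sum.elim ar arH) :=
  t.mapS Sum.inl (fun _ => rfl)

theorem realize_liftT {A : Type w} [L.Structure A] (fi : ∀ f : F, (Fin (ar f) → A) → A) {H : Type}
    (ι : H → Type) [∀ h, Fintype (ι h)] (Φ : ∀ h, (ι h → A) → A) (t : ETerm L F ar) (s : ℕ → A) :
    (liftT t).realize (extI fi ι Φ) s = t.realize fi s :=
  ETerm.realize_mapS _ _ _ _ (fun _ _ => rfl) s t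

theorem realize_liftQ {A : Type w} [L.Structure A] (fi : ∀ f : F, (Fin (ar f) → A) → A) {H : Type}
    (ι : H → Type) [∀ h, Fintype (ι h)] (Φ : ∀ h, (ι h → A) → A) (t : EQF L F ar) (s : ℕ → A) :
    (liftQ t).realize (extI fi ι Φ) s ↔ t.realize fi s :=
  EQF.realize_mapS _ _ _ _ (fun _ _ => rfl) s t

theorem Expr.ex {r : ℕ} {H : Type} [Finite H] (ι : H → Type) [∀ h, Fintype (ι h)]
    {P : (A : Type w) → [L.Structure A] →
      (∀ f : F ⊕ H, (Fin (Sum.elim ar (fun h => Fintype.card (ι h)) f) → A) → A) → Prop}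
    (hP : Expr r (F ⊕ H) (Sum.elim ar (fun h => Fintype.card (ι h))) P) :
    Expr (L := L) r F ar (fun A _ fi => ∃ Φ : ∀ h, (ι h → A) → A, P A (extI fi ι Φ)) := by
  obtain ⟨G, hG, arG, θ, h1, h2⟩ := hP
  let σ : (F ⊕ H) ⊕ G → F ⊕ (H ⊕ G) :=
    Sum.elim (Sum.elim Sum.inl (fun g => Sum.inr (Sum.inl g))) (fun g => Sum.inr (Sum.inr g))
  have hσ : ∀ f, (Sum.elim ar (Sum.elim (fun h => Fintype.card (ι h)) arG)) (σ f) =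
      Sum.elim (Sum.elim ar (fun h => Fintype.card (ι h))) arG f := by
    rintro ((f | f) | f) <;> rfl
  refine ⟨H ⊕ G, inferInstance, Sum.elim (fun h => Fintype.card (ι h)) arG, θ.mapS σ hσ,
    EQF.varsLT_mapS h1, ?_⟩
  intro A _ hA fi
  constructor
  · rintro ⟨Φ, h⟩
    obtain ⟨gi, h⟩ := (h2 A hA _).1 h
    refine ⟨Sum.rec (fun h v => Φ h (fun i => v (Fintype.equivFin (ι h) i))) gi, fun s => ?_⟩
    refine (EQF.realize_mapS _ _ _ _ ?_ s θ).2 (h s)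
    rintro ((f | f) | f) v <;> rfl
  · rintro ⟨gi, h⟩
    refine ⟨fun h v => gi (.inl h) (fun i => v ((Fintype.equivFin (ι h)).symm i)), ?_⟩
    refine (h2 A hA _).2 ⟨fun g => gi (.inr g), fun s => ?_⟩
    refine (EQF.realize_mapS _ _ _ _ ?_ s θ).1 (h s)
    rintro ((f | f) | f) v
    · rfl
    · simp [σ, extI]
    · rfl

theorem Expr.true {r : ℕ} (hr : 0 < r) : Expr.{u, v, w} (L := L) r F ar (fun _ _ _ => True) := by
  refine (Expr.qf (.teq (.var 0) (.var 0)) ⟨hr, hr⟩).congr ?_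
  intro A _ _ fi
  simp [EQF.realize]

theorem Expr.forall_fin {r : ℕ} (hr : 0 < r) (n : ℕ)
    {P : Fin n → (A : Type w) → [L.Structure A] → (∀ f : F, (Fin (ar f) → A) → A) → Prop}
    (h : ∀ j, Expr r F ar (P j)) :
    Expr (L := L) r F ar (fun A _ fi => ∀ j, P j A fi) := by
  induction n with
  | zero => exact (Expr.true hr).congr (fun A _ _ fi => by simp)
  | succ n ih =>
    refine ((h 0).and (ih (P := fun j => P j.succ) fun j => h j.succ)).congr ?_
    intro A _ _ fi
    exact Fin.forall_fin_succ

/-- Combination of two assignments. -/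
def comb_s12 {A : Type w} (r : ℕ) (s s' : ℕ → A) : ℕ → A := fun n => if n < r then s n else s' (n - r)

theorem Expr.skolem {r N : ℕ} (θ : EQF L F ar) (hθ : θ.varsLT (r + N)) :
    Expr.{u, v, w} (L := L) r F ar
      (fun A _ fi => ∀ s : ℕ → A, ∃ s' : ℕ → A, θ.realize fi (comb_s12 r s s')) := by
  let ι : Fin N → Type := fun _ => Fin r
  let σ : ℕ → ETerm L (F ⊕ Fin N) (Sum.elim ar (fun h => Fintype.card (ι h))) := fun n =>
    if n < r then .var n else
      if h : n - r < N then appT ι ⟨n - r, h⟩ (fun i : Fin r => .var i) else .var 0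
  refine (Expr.ex ι (Expr.qf ((liftQ θ).subst σ) ?_)).congr ?_
  · refine EQF.varsLT_subst (a := r + N) ?_ (EQF.varsLT_mapS hθ)
    intro n hn
    by_cases h : n < r
    · simp only [σ, h, if_true]; exact h
    · have h' : n - r < N := by omega
      simp only [σ, h, if_false, h', dif_pos]
      exact varsLT_appT (fun i => i.2)
  · intro A _ hA fi
    obtain ⟨a0⟩ := hA.to_nonempty
    have key : ∀ (Φ : ∀ h, (ι h → A) → A) (s : ℕ → A),
        ((liftQ θ).subst σ).realize (extI fi ι Φ) s ↔ θ.realize fi (comb_s12 r s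
          (fun n => if h : n < N then Φ ⟨n, h⟩ (fun i : Fin r => s i) else s 0)) := by
      intro Φ s
      rw [EQF.realize_subst, realize_liftQ]
      have : (fun n => (σ n).realize (extI fi ι Φ) s) = comb_s12 r s
          (fun n => if h : n < N then Φ ⟨n, h⟩ (fun i : Fin r => s i) else s 0) := by
        funext n
        by_cases h : n < r
        · simp [σ, h, comb_s12, ETerm.realize]
        · by_cases h' : n - r < N
          · simp only [σ, h, if_false, h', dif_pos, comb_s12, realize_appT]
            rfl
          · simp [σ, h, h', comb_s12, ETerm.realize]
      rw [this]
    simp only [key]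
    constructor
    · intro h
      let ex : (Fin r → A) → ℕ → A := fun v n => if h : n < r then v ⟨n, h⟩ else a0
      choose S hS using h
      refine ⟨fun j v => S (ex v) j, fun s => ?_⟩
      refine (EQF.realize_congr fi ?_ hθ).1 (hS (ex fun i => s i))
      intro n hn
      by_cases h : n < r
      · simp [comb_s12, h, ex]
      · have h' : n - r < N := by omega
        simp [comb_s12, h, h']
    · rintro ⟨Φ, h⟩ s
      exact ⟨_, h s⟩


theorem Expr.rows {r i : ℕ} (hir : i ≤ r) (act : EQF L F ar) (hact : act.varsLT i)
    (l : List (ETerm L F ar × ETerm L F ar))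
    (hl : ∀ p ∈ l, p.1.varsLT i ∧ p.2.varsLT r) :
    Expr.{u, v, w} (L := L) r F ar (fun A _ fi => ∀ s : ℕ → A, act.realize fi s →
      ∃ s' : ℕ → A, act.realize fi s' ∧
        ∀ p ∈ l, p.1.realize fi s' = p.2.realize fi s) := by
  let sh : ℕ → ETerm L F ar := fun n => .var (r + n)
  have hsh : ∀ n < i, (sh n).varsLT (r + i) := fun n hn => Nat.add_lt_add_left hn r
  refine (Expr.skolem (r := r) (N := i)
    (act.imp ((act.subst sh).eqs (l.map fun p => (p.1.subst sh, p.2)))) ?_).congr ?_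
  · refine EQF.varsLT_imp (EQF.varsLT_mono (by omega) hact)
      (EQF.varsLT_eqs (EQF.varsLT_subst hsh hact) ?_)
    intro p hp
    obtain ⟨q, hq, rfl⟩ := List.mem_map.1 hp
    exact ⟨ETerm.varsLT_subst hsh (hl q hq).1, ETerm.varsLT_mono (by omega) (hl q hq).2⟩
  · intro A _ hA fi
    have h1 : ∀ s s' : ℕ → A, (fun n => (sh n).realize fi (comb_s12 r s s')) = s' := by
      intro s s'
      funext n
      simp [sh, ETerm.realize, comb_s12]
    have h2 : ∀ s s' : ℕ → A, ∀ n < r, comb_s12 r s s' n = s n := by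
      intro s s' n hn
      simp [comb_s12, hn]
    have key : ∀ s s' : ℕ → A, (act.imp ((act.subst sh).eqs
        (l.map fun p => (p.1.subst sh, p.2)))).realize fi (comb_s12 r s s') ↔
        (act.realize fi s → act.realize fi s' ∧
          ∀ p ∈ l, p.1.realize fi s' = p.2.realize fi s) := by
      intro s s'
      rw [EQF.realize_imp, EQF.realize_eqs, EQF.realize_subst, h1,
        EQF.realize_congr fi (h2 s s') (EQF.varsLT_mono hir hact), List.forall_mem_map]
      refine imp_congr_right fun _ => and_congr_right fun _ => forall₂_congr fun p hp => ?_
      rw [ETerm.realize_subst, h1, ETerm.realize_congr fi (h2 s s') (hl p hp).2]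
    simp only [key]
    refine forall_congr' fun s => ?_
    by_cases h : act.realize fi s
    · simp [h]
    · simp only [h, false_imp_iff, true_iff]
      exact ⟨s, trivial⟩

/-- A set that is an image of `A^i` is spanned by a tree of depth `i` with `A`-branching. -/
theorem tree_lemma {A γ : Type w} [Nonempty A] (i : ℕ) : ∀ (S : Set γ), S.Nonempty →
    ∀ f : (Fin i → A) → γ, S ⊆ Set.range f →
    ∃ R ∈ S, ∃ (C : ℕ → γ → A → γ) (W : ℕ → γ → A) (V : ℕ → γ → γ),
      (∀ j z u, C j z u ∈ S) ∧ ∀ z ∈ S, V 0 z = R ∧ V i z = z ∧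
        ∀ j < i, V (j + 1) z = C j (V j z) (W j z) := by
  classical
  induction i with
  | zero =>
    rintro S ⟨R, hR⟩ f hf
    refine ⟨R, hR, fun _ _ _ => R, fun _ _ => Classical.arbitrary A, fun _ _ => R,
      fun _ _ _ => hR, fun z hz => ⟨rfl, ?_, by simp⟩⟩
    obtain ⟨p, rfl⟩ := hf hz
    obtain ⟨q, rfl⟩ := hf hR
    exact congrArg f (Subsingleton.elim _ _)
  | succ i ih =>
    rintro S ⟨s0, hs0⟩ f hf
    have hc : ∀ z, ∃ p, z ∈ S → f p = z := by
      intro z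
      by_cases h : z ∈ S
      · obtain ⟨p, hp⟩ := hf h
        exact ⟨p, fun _ => hp⟩
      · exact ⟨fun _ => Classical.arbitrary A, fun h' => absurd h' h⟩
    choose c hc using hc
    have hrep : ∀ p : Fin i → A, ∃ z ∈ S, (∃ z' ∈ S, Fin.init (c z') = p) → Fin.init (c z) = p := by
      intro p
      by_cases h : ∃ z' ∈ S, Fin.init (c z') = p
      · obtain ⟨z, hz, hp⟩ := h
        exact ⟨z, hz, fun _ => hp⟩
      · exact ⟨s0, hs0, fun h' => absurd h' h⟩
    choose rep hrepS hrep using hrep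
    obtain ⟨R, hR, C, W, V, hC, hV⟩ := ih (Set.range rep)
      ⟨rep (fun _ => Classical.arbitrary A), Set.mem_range_self _⟩ rep subset_rfl
    have hsub : Set.range rep ⊆ S := by
      rintro _ ⟨p, rfl⟩
      exact hrepS p
    refine ⟨R, hsub hR,
      fun j z u => if j < i then C j z u else
        if f (Fin.snoc (α := fun _ => A) (Fin.init (c z)) u) ∈ S then
          f (Fin.snoc (α := fun _ => A) (Fin.init (c z)) u) else s0,
      fun j z => if j < i then W j (rep (Fin.init (c z))) else c z (Fin.last i),
      fun j z => if j ≤ i then V j (rep (Fin.init (c z))) else z, ?_, ?_⟩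
    · intro j z u
      dsimp only
      split_ifs with h1 h2
      · exact hsub (hC _ _ _)
      · exact h2
      · exact hs0
    · intro z hz
      obtain ⟨h1, h2, h3⟩ := hV (rep (Fin.init (c z))) (Set.mem_range_self _)
      refine ⟨by simp [h1], by simp, ?_⟩
      intro j hj
      by_cases hji : j < i
      · have : j + 1 ≤ i := hji
        simp [hji, this, hji.le, h3 j hji]
      · obtain rfl : j = i := by omega
        have e : Fin.init (c (rep (Fin.init (c z)))) = Fin.init (c z) :=
          hrep _ ⟨z, hz, rfl⟩
        simp [h2, e, hc z hz, hz]

theorem indep_sem {A α β γ : Type w} [Nonempty A] [Nonempty γ] (i : ℕ) (act : (ℕ → A) → Prop)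
    (x : (ℕ → A) → α) (y : (ℕ → A) → β) (z : (ℕ → A) → γ)
    (hdep : ∀ s s' : ℕ → A, (∀ n < i, s n = s' n) →
      (act s ↔ act s') ∧ x s = x s' ∧ y s = y s' ∧ z s = z s') :
    (∀ t, act t → ∀ t', act t' → x t = x t' →
      ∃ t'', act t'' ∧ x t'' = x t ∧ y t'' = y t ∧ z t'' = z t') ↔
    ∃ (R : α → γ) (C : Fin i → α → γ → A → γ) (W : Fin i → α → γ → A)
      (V : Fin (i + 1) → α → γ → γ),
      (∀ t, act t → ∃ t', act t' ∧ x t' = x t ∧ y t' = y t ∧ z t' = R (x t)) ∧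
      (∀ j t, act t → ∃ t', act t' ∧ x t' = x t ∧ y t' = y t ∧ z t' = C j (x t) (z t) (t i)) ∧
      (∀ t, act t → V 0 (x t) (z t) = R (x t) ∧ V (Fin.last i) (x t) (z t) = z t ∧
        ∀ j : Fin i, V j.succ (x t) (z t) =
          C j (x t) (V j.castSucc (x t) (z t)) (W j (x t) (z t))) := by
  constructor
  · intro h
    have key : ∀ a : α, ∃ (R : γ) (C : ℕ → γ → A → γ) (W : ℕ → γ → A) (V : ℕ → γ → γ),
        (∃ t, act t ∧ x t = a) → (∃ t, act t ∧ x t = a ∧ z t = R) ∧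
          (∀ j z' u, ∃ t, act t ∧ x t = a ∧ z t = C j z' u) ∧
          ∀ t, act t → x t = a → V 0 (z t) = R ∧ V i (z t) = z t ∧
            ∀ j < i, V (j + 1) (z t) = C j (V j (z t)) (W j (z t)) := by
      intro a
      by_cases ha : ∃ t, act t ∧ x t = a
      · have a0 : A := Classical.arbitrary A
        obtain ⟨R, hR, C, W, V, hC, hV⟩ := tree_lemma (A := A) i
          {c | ∃ t, act t ∧ x t = a ∧ z t = c}
          (by obtain ⟨t, h1, h2⟩ := ha; exact ⟨z t, t, h1, h2, rfl⟩)
          (fun p => z (fun n => if h : n < i then p ⟨n, h⟩ else a0)) (by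
            rintro _ ⟨t, h1, h2, rfl⟩
            refine ⟨fun j => t j, ((hdep _ _ ?_).2.2.2)⟩
            intro n hn
            simp [hn])
        exact ⟨R, C, W, V, fun _ => ⟨hR, hC, fun t h1 h2 => hV _ ⟨t, h1, h2, rfl⟩⟩⟩
      · exact ⟨Classical.arbitrary _, fun _ _ _ => Classical.arbitrary _,
          fun _ _ => Classical.arbitrary _, fun _ _ => Classical.arbitrary _,
          fun h => absurd h ha⟩
    choose R C W V hk using key
    refine ⟨R, fun j a => C a j, fun j a => W a j, fun j a => V a j, ?_, ?_, ?_⟩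
    · intro t ht
      obtain ⟨t', h1, h2, h3⟩ := (hk (x t) ⟨t, ht, rfl⟩).1
      obtain ⟨t'', g1, g2, g3, g4⟩ := h t ht t' h1 h2.symm
      exact ⟨t'', g1, g2, g3, g4.trans h3⟩
    · intro j t ht
      obtain ⟨t', h1, h2, h3⟩ := (hk (x t) ⟨t, ht, rfl⟩).2.1 j (z t) (t i)
      obtain ⟨t'', g1, g2, g3, g4⟩ := h t ht t' h1 h2.symm
      exact ⟨t'', g1, g2, g3, g4.trans h3⟩
    · intro t ht
      obtain ⟨h1, h2, h3⟩ := (hk (x t) ⟨t, ht, rfl⟩).2.2 t ht rfl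
      exact ⟨h1, h2, fun j => h3 j j.2⟩
  · rintro ⟨R, C, W, V, h1, h2, h3⟩ t ht t' ht' hx
    obtain ⟨g1, g2, g3⟩ := h3 t' ht'
    have : ∀ j : Fin (i + 1), ∃ t'', act t'' ∧ x t'' = x t ∧ y t'' = y t ∧
        z t'' = V j (x t') (z t') := by
      intro j
      induction j using Fin.induction with
      | zero =>
        obtain ⟨s, k1, k2, k3, k4⟩ := h1 t ht
        exact ⟨s, k1, k2, k3, by rw [k4, g1, hx]⟩
      | succ j ih =>
        obtain ⟨s, k1, k2, k3, k4⟩ := ih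
        let s1 : ℕ → A := Function.update s i (W j (x t') (z t'))
        obtain ⟨e1, e2, e3, e4⟩ := hdep s s1 (by
          intro n hn
          have : n ≠ i := by omega
          simp [s1, this])
        obtain ⟨s', m1, m2, m3, m4⟩ := h2 j s1 (e1.1 k1)
        refine ⟨s', m1, by rw [m2, ← e2, k2], by rw [m3, ← e3, k3], ?_⟩
        rw [m4, g3 j, ← e2, ← e4, k2, k4, hx]
        simp [s1]
    obtain ⟨t'', k1, k2, k3, k4⟩ := this (Fin.last i)
    exact ⟨t'', k1, k2, k3, by rw [k4, g2]⟩

/-- The assignment with domain `D` and given values. -/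
def asg {A : Type w} (D : Finset ℕ) (w : D → A) : ℕ → Option A :=
  fun n => if h : n ∈ D then some (w ⟨n, h⟩) else none

def row {A : Type w} [L.Structure A] (fi : ∀ f : F, (Fin (ar f) → A) → A) (D : Finset ℕ)
    (env : ℕ → ETerm L F ar) (t : ℕ → A) : ℕ → Option A :=
  asg D (fun v => (env v).realize fi t)

def team {A : Type w} [L.Structure A] (fi : ∀ f : F, (Fin (ar f) → A) → A) (D : Finset ℕ)
    (env : ℕ → ETerm L F ar) (act : EQF L F ar) : Set (ℕ → Option A) :=
  {s | ∃ t : ℕ → A, act.realize fi t ∧ s = row fi D env t}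

theorem row_mem {A : Type w} [L.Structure A] (fi : ∀ f : F, (Fin (ar f) → A) → A) {D : Finset ℕ}
    (env : ℕ → ETerm L F ar) (t : ℕ → A) {n : ℕ} (h : n ∈ D) :
    row fi D env t n = some ((env n).realize fi t) := by
  simp [row, asg, h]

theorem forall_team {A : Type w} [L.Structure A] (fi : ∀ f : F, (Fin (ar f) → A) → A)
    (D : Finset ℕ) (env : ℕ → ETerm L F ar) (act : EQF L F ar) (P : (ℕ → Option A) → Prop) :
    (∀ s ∈ team fi D env act, P s) ↔ ∀ t : ℕ → A, act.realize fi t → P (row fi D env t) := by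
  constructor
  · intro h t ht
    exact h _ ⟨t, ht, rfl⟩
  · rintro h _ ⟨t, ht, rfl⟩
    exact h t ht

theorem exists_team {A : Type w} [L.Structure A] (fi : ∀ f : F, (Fin (ar f) → A) → A)
    (D : Finset ℕ) (env : ℕ → ETerm L F ar) (act : EQF L F ar) (P : (ℕ → Option A) → Prop) :
    (∃ s ∈ team fi D env act, P s) ↔ ∃ t : ℕ → A, act.realize fi t ∧ P (row fi D env t) := by
  constructor
  · rintro ⟨_, ⟨t, ht, rfl⟩, h⟩
    exact ⟨t, ht, h⟩
  · rintro ⟨t, ht, h⟩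
    exact ⟨_, ⟨t, ht, rfl⟩, h⟩

/-- Substitution of terms into first-order terms. -/
def tsub (env : ℕ → ETerm L F ar) : L.Term ℕ → ETerm L F ar
  | .var n => env n
  | .func f ts => .func f fun i => tsub env (ts i)

theorem oreal_row {A : Type w} [L.Structure A] (fi : ∀ f : F, (Fin (ar f) → A) → A)
    {D : Finset ℕ} (env : ℕ → ETerm L F ar) (s : ℕ → A) (t : L.Term ℕ)
    (ht : tvars t ⊆ (D : Set ℕ)) :
    oreal (row fi D env s) t = some ((tsub env t).realize fi s) := by
  induction t with
  | var n =>
    have : n ∈ D := ht (by simp [tvars])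
    simp only [oreal, tsub]
    exact row_mem fi env s this
  | func f ts ih =>
    have h : ∀ i, oreal (row fi D env s) (ts i) = some ((tsub env (ts i)).realize fi s) := by
      intro i
      refine ih i (subset_trans ?_ ht)
      simp only [tvars]
      exact Set.subset_iUnion (fun i => tvars (ts i)) i
    simp [oreal, tsub, ETerm.realize, h]

theorem varsLT_tsub {D : Finset ℕ} {env : ℕ → ETerm L F ar} {i : ℕ}
    (henv : ∀ v ∈ D, (env v).varsLT i) (t : L.Term ℕ) (ht : tvars t ⊆ (D : Set ℕ)) :
    (tsub env t).varsLT i := by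
  induction t with
  | var n => exact henv n (ht (by simp [tvars]))
  | func f ts ih =>
    intro j
    refine ih j (subset_trans ?_ ht)
    simp only [tvars]
    exact Set.subset_iUnion (fun i => tvars (ts i)) j

theorem map_eq_map_row {A : Type w} [L.Structure A] (fi : ∀ f : F, (Fin (ar f) → A) → A)
    {D : Finset ℕ} (env : ℕ → ETerm L F ar) (s s' : ℕ → A) (xs : List ℕ)
    (h : ∀ v ∈ xs, v ∈ D) :
    xs.map (row fi D env s) = xs.map (row fi D env s') ↔
      ∀ v ∈ xs, (env v).realize fi s = (env v).realize fi s' := by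
  rw [List.map_inj_left]
  refine forall₂_congr fun v hv => ?_
  rw [row_mem fi env s (h v hv), row_mem fi env s' (h v hv), Option.some_inj]

theorem map_eq_zip {A : Type w} [L.Structure A] (fi : ∀ f : F, (Fin (ar f) → A) → A)
    {D : Finset ℕ} (env : ℕ → ETerm L F ar) (s s' : ℕ → A) : ∀ (xs ys : List ℕ),
    (∀ v ∈ xs, v ∈ D) → (∀ v ∈ ys, v ∈ D) → xs.length = ys.length →
    (xs.map (row fi D env s) = ys.map (row fi D env s') ↔
      ∀ p ∈ (ys.zip xs).map (fun q => (env q.1, env q.2)),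
        p.1.realize fi s' = p.2.realize fi s)
  | [], [], _, _, _ => by simp
  | [], _ :: _, _, _, h => by simp at h
  | _ :: _, [], _, _, h => by simp at h
  | x :: xs, y :: ys, hx, hy, h => by
    rw [List.forall_mem_cons] at hx hy
    have ih := map_eq_zip fi env s s' xs ys hx.2 hy.2 (by simpa using h)
    simp only [List.map_cons, List.zip_cons_cons, List.forall_mem_cons, List.cons.injEq, ih,
      row_mem fi env s hx.1, row_mem fi env s' hy.1, Option.some_inj]
    exact and_congr_left fun _ => eq_comm

/-- Shorthand for a predicate on teams. -/
def TExpr (r : ℕ) (D : Finset ℕ) (env : ℕ → ETerm L F ar) (act : EQF L F ar) (φ : TF L) : Prop :=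
  Expr.{u, v, w} (L := L) r F ar (fun A _ fi => strictSat A (team fi D env act) φ)

section cases

variable {r i : ℕ} {D : Finset ℕ} {env : ℕ → ETerm L F ar} {act : EQF L F ar}

theorem texpr_lit (φ : TF L) (θ : EQF L F ar) (hact : act.varsLT r) (hθ : θ.varsLT r)
    (h : ∀ (A : Type w) [L.Structure A] (fi : ∀ f : F, (Fin (ar f) → A) → A),
      strictSat A (team fi D env act) φ ↔
        ∀ t : ℕ → A, act.realize fi t → θ.realize fi t) :
    TExpr.{u, v, w} r D env act φ := by
  refine (Expr.qf (act.imp θ) (EQF.varsLT_imp hact hθ)).congr ?_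
  intro A _ _ fi
  simp only [EQF.realize_imp]
  exact h A fi

theorem texpr_rel (hir : i < r) (henv : ∀ v ∈ D, (env v).varsLT i) (hact : act.varsLT i)
    {n : ℕ} (R : L.Relations n) (ts : Fin n → L.Term ℕ)
    (hfv : freeVars (.rel R ts) ⊆ (D : Set ℕ)) :
    TExpr.{u, v, w} r D env act (.rel R ts) := by
  simp only [freeVars, Set.iUnion_subset_iff] at hfv
  refine texpr_lit _ (.rel R fun j => tsub env (ts j)) (EQF.varsLT_mono hir.le hact)
    (fun j => ETerm.varsLT_mono hir.le (varsLT_tsub henv _ (hfv j))) ?_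
  intro A _ fi
  rw [strictSat, forall_team]
  refine forall₂_congr fun t _ => ?_
  simp only [fun j => oreal_row fi env t (ts j) (hfv j), Option.some_inj, EQF.realize]
  constructor
  · rintro ⟨v, h1, h2⟩
    rwa [funext h1]
  · intro h
    exact ⟨_, fun _ => rfl, h⟩

theorem texpr_nrel (hir : i < r) (henv : ∀ v ∈ D, (env v).varsLT i) (hact : act.varsLT i)
    {n : ℕ} (R : L.Relations n) (ts : Fin n → L.Term ℕ)
    (hfv : freeVars (.nrel R ts) ⊆ (D : Set ℕ)) :
    TExpr.{u, v, w} r D env act (.nrel R ts) := by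
  simp only [freeVars, Set.iUnion_subset_iff] at hfv
  refine texpr_lit _ (.nrel R fun j => tsub env (ts j)) (EQF.varsLT_mono hir.le hact)
    (fun j => ETerm.varsLT_mono hir.le (varsLT_tsub henv _ (hfv j))) ?_
  intro A _ fi
  rw [strictSat, forall_team]
  refine forall₂_congr fun t _ => ?_
  simp only [fun j => oreal_row fi env t (ts j) (hfv j), Option.some_inj, EQF.realize]
  constructor
  · rintro ⟨v, h1, h2⟩
    rwa [funext h1]
  · intro h
    exact ⟨_, fun _ => rfl, h⟩

theorem texpr_teq (hir : i < r) (henv : ∀ v ∈ D, (env v).varsLT i) (hact : act.varsLT i)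
    (t u : L.Term ℕ) (hfv : freeVars (.teq t u) ⊆ (D : Set ℕ)) :
    TExpr.{u, v, w} r D env act (.teq t u) := by
  simp only [freeVars, Set.union_subset_iff] at hfv
  refine texpr_lit _ (.teq (tsub env t) (tsub env u)) (EQF.varsLT_mono hir.le hact)
    ⟨ETerm.varsLT_mono hir.le (varsLT_tsub henv _ hfv.1),
      ETerm.varsLT_mono hir.le (varsLT_tsub henv _ hfv.2)⟩ ?_
  intro A _ fi
  rw [strictSat, forall_team]
  refine forall₂_congr fun s _ => ?_
  simp only [oreal_row fi env s _ hfv.1, oreal_row fi env s _ hfv.2, Option.some_inj, EQF.realize]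
  constructor
  · rintro ⟨a, h1, h2⟩
    rw [h1, h2]
  · intro h
    exact ⟨_, rfl, h.symm⟩

theorem texpr_tne (hir : i < r) (henv : ∀ v ∈ D, (env v).varsLT i) (hact : act.varsLT i)
    (t u : L.Term ℕ) (hfv : freeVars (.tne t u) ⊆ (D : Set ℕ)) :
    TExpr.{u, v, w} r D env act (.tne t u) := by
  simp only [freeVars, Set.union_subset_iff] at hfv
  refine texpr_lit _ (.tne (tsub env t) (tsub env u)) (EQF.varsLT_mono hir.le hact)
    ⟨ETerm.varsLT_mono hir.le (varsLT_tsub henv _ hfv.1),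
      ETerm.varsLT_mono hir.le (varsLT_tsub henv _ hfv.2)⟩ ?_
  intro A _ fi
  rw [strictSat, forall_team]
  refine forall₂_congr fun s _ => ?_
  simp only [oreal_row fi env s _ hfv.1, oreal_row fi env s _ hfv.2, Option.some_inj, EQF.realize]
  constructor
  · rintro ⟨a, b, h1, h2, h3⟩
    rwa [h1, h2]
  · intro h
    exact ⟨_, _, rfl, rfl, h⟩

theorem texpr_dep (hir : i < r) (henv : ∀ v ∈ D, (env v).varsLT i) (hact : act.varsLT i)
    (xs : List ℕ) (y : ℕ) (hfv : freeVars (L := L) (.dep xs y) ⊆ (D : Set ℕ)) :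
    TExpr.{u, v, w} r D env act (.dep xs y) := by
  classical
  simp only [freeVars, Set.union_subset_iff, Set.singleton_subset_iff] at hfv
  obtain ⟨hx, hy⟩ := hfv
  have hx : ∀ v ∈ xs, v ∈ D := fun v hv => hx hv
  have hy : y ∈ D := hy
  let ι : Unit → Type := fun _ => xs.toFinset
  refine (Expr.ex ι (Expr.qf ((liftQ act).imp
    (.teq (appT ι () (fun v : xs.toFinset => liftT (env v))) (liftT (env y)))) ?_)).congr ?_
  · refine EQF.varsLT_imp (EQF.varsLT_mono hir.le (EQF.varsLT_mapS hact)) ⟨varsLT_appT ?_, ?_⟩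
    · intro v
      exact ETerm.varsLT_mono hir.le (ETerm.varsLT_mapS (henv _ (hx _ (List.mem_toFinset.1 v.2))))
    · exact ETerm.varsLT_mono hir.le (ETerm.varsLT_mapS (henv _ hy))
  · intro A _ hA fi
    have a0 : A := Classical.arbitrary A
    simp only [EQF.realize_imp, realize_liftQ, EQF.realize, realize_appT, realize_liftT]
    rw [strictSat, forall_team]
    simp only [forall_team, map_eq_map_row fi env _ _ xs hx, row_mem fi env _ hy, Option.some_inj]
    constructor
    · intro h
      have : ∀ w : xs.toFinset → A, ∃ a : A, ∀ t : ℕ → A, act.realize fi t →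
          (fun v : xs.toFinset => (env v).realize fi t) = w → a = (env y).realize fi t := by
        intro w
        by_cases hw : ∃ t : ℕ → A, act.realize fi t ∧
          (fun v : xs.toFinset => (env v).realize fi t) = w
        · obtain ⟨t, ht, hw⟩ := hw
          refine ⟨(env y).realize fi t, fun t' ht' hw' => h t ht t' ht' fun v hv => ?_⟩
          exact congrFun (hw.trans hw'.symm) ⟨v, List.mem_toFinset.2 hv⟩
        · exact ⟨a0, fun t ht hw' => absurd ⟨t, ht, hw'⟩ hw⟩
      choose Φ hΦ using this
      exact ⟨fun _ => Φ, fun s hs => hΦ _ s hs rfl⟩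
    · rintro ⟨Φ, h⟩ t ht t' ht' hv
      rw [← h t ht, ← h t' ht']
      congr 1
      funext v
      exact hv v (List.mem_toFinset.1 v.2)

theorem texpr_inc (hir : i < r) (henv : ∀ v ∈ D, (env v).varsLT i) (hact : act.varsLT i)
    (xs ys : List ℕ) (hfv : freeVars (L := L) (.inc xs ys) ⊆ (D : Set ℕ)) :
    TExpr.{u, v, w} r D env act (.inc xs ys) := by
  have hx : ∀ v ∈ xs, v ∈ D := fun v hv => hfv (by simp [freeVars, hv])
  have hy : ∀ v ∈ ys, v ∈ D := fun v hv => hfv (by simp [freeVars, hv])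
  by_cases hlen : xs.length = ys.length
  · refine (Expr.rows hir.le act hact ((ys.zip xs).map (fun q => (env q.1, env q.2))) ?_).congr ?_
    · intro p hp
      obtain ⟨⟨a, b⟩, hq, rfl⟩ := List.mem_map.1 hp
      obtain ⟨ha, hb⟩ := List.of_mem_zip hq
      exact ⟨henv _ (hy _ ha), ETerm.varsLT_mono hir.le (henv _ (hx _ hb))⟩
    · intro A _ hA fi
      rw [strictSat, forall_team]
      simp only [exists_team, map_eq_zip fi env _ _ xs ys hx hy hlen]
  · refine (Expr.qf act.neg (EQF.varsLT_neg (EQF.varsLT_mono hir.le hact))).congr ?_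
    intro A _ hA fi
    rw [strictSat, forall_team]
    simp only [EQF.realize_neg]
    refine forall_congr' fun t => imp_congr_right fun _ => ?_
    constructor
    · rintro ⟨s, _, h⟩
      exact hlen (by simpa using congrArg List.length h)
    · exact False.elim

theorem texpr_or {φ ψ : TF L}
    (hφ : ∀ (F : Type) (ar : F → ℕ) (env : ℕ → ETerm L F ar) (act : EQF L F ar),
      (∀ v ∈ D, (env v).varsLT i) → act.varsLT i → TExpr.{u, v, w} r D env act φ)
    (hψ : ∀ (F : Type) (ar : F → ℕ) (env : ℕ → ETerm L F ar) (act : EQF L F ar),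
      (∀ v ∈ D, (env v).varsLT i) → act.varsLT i → TExpr.{u, v, w} r D env act ψ)
    (henv : ∀ v ∈ D, (env v).varsLT i) (hact : act.varsLT i) :
    TExpr.{u, v, w} r D env act (.or φ ψ) := by
  classical
  let ι : Bool → Type := fun _ => D
  let g : Bool → ETerm L (F ⊕ Bool) (Sum.elim ar (fun h => Fintype.card (ι h))) :=
    fun b => appT ι b (fun v : D => liftT (env v))
  have hg : ∀ b, (g b).varsLT i := fun b => varsLT_appT fun v : D =>
    ETerm.varsLT_mapS (henv v v.2)
  have henv' : ∀ v ∈ D, (liftT (env v) :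
      ETerm L (F ⊕ Bool) (Sum.elim ar (fun h => Fintype.card (ι h)))).varsLT i :=
    fun v hv => ETerm.varsLT_mapS (henv v hv)
  refine (Expr.ex ι ((hφ _ _ (fun v => liftT (env v)) (.and (liftQ act) (.teq (g true) (g false)))
    henv' ⟨EQF.varsLT_mapS hact, hg _, hg _⟩).and
    (hψ _ _ (fun v => liftT (env v)) (.and (liftQ act) (.tne (g true) (g false)))
    henv' ⟨EQF.varsLT_mapS hact, hg _, hg _⟩))).congr ?_
  intro A _ hA fi
  obtain ⟨a, b, hab⟩ := hA.exists_pair_ne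
  have e1 : ∀ Φ : ∀ h, (ι h → A) → A,
      team (extI fi ι Φ) D (fun v => liftT (env v)) (.and (liftQ act) (.teq (g true) (g false))) =
      {s | ∃ t : ℕ → A, (act.realize fi t ∧ Φ true (fun v : D => (env v).realize fi t) =
        Φ false (fun v : D => (env v).realize fi t)) ∧ s = row fi D env t} := by
    intro Φ
    simp only [team, row, EQF.realize, realize_liftQ, realize_liftT, g, realize_appT]
    rfl
  have e2 : ∀ Φ : ∀ h, (ι h → A) → A,
      team (extI fi ι Φ) D (fun v => liftT (env v)) (.and (liftQ act) (.tne (g true) (g false))) =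
      {s | ∃ t : ℕ → A, (act.realize fi t ∧ Φ true (fun v : D => (env v).realize fi t) ≠
        Φ false (fun v : D => (env v).realize fi t)) ∧ s = row fi D env t} := by
    intro Φ
    simp only [team, row, EQF.realize, realize_liftQ, realize_liftT, g, realize_appT]
    rfl
  simp only [e1, e2, strictSat]
  constructor
  · rintro ⟨Y, Z, hYZ, hdis, h1, h2⟩
    let Φ : ∀ h, (ι h → A) → A := fun h w => if h then a else if asg D w ∈ Y then a else b
    have k : ∀ t : ℕ → A, Φ true (fun v : D => (env v).realize fi t) =
        Φ false (fun v : D => (env v).realize fi t) ↔ row fi D env t ∈ Y := by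
      intro t
      by_cases h : row fi D env t ∈ Y
      · have h' := h
        simp only [row] at h'
        simp [Φ, h, h']
      · have h' := h
        simp only [row] at h'
        simp [Φ, h, h', hab]
    refine ⟨Φ, ?_, ?_⟩
    · convert h1 using 1
      ext s
      constructor
      · rintro ⟨t, ⟨_, h⟩, rfl⟩
        exact (k t).1 h
      · intro hs
        have : s ∈ team fi D env act := hYZ ▸ Or.inl hs
        obtain ⟨t, ht, rfl⟩ := this
        exact ⟨t, ⟨ht, (k t).2 hs⟩, rfl⟩
    · convert h2 using 1
      ext s
      constructor
      · rintro ⟨t, ⟨ht, h⟩, rfl⟩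
        have : row fi D env t ∈ Y ∪ Z := hYZ ▸ ⟨t, ht, rfl⟩
        exact this.resolve_left fun h' => h ((k t).2 h')
      · intro hs
        have : s ∈ team fi D env act := hYZ ▸ Or.inr hs
        obtain ⟨t, ht, rfl⟩ := this
        refine ⟨t, ⟨ht, fun h => ?_⟩, rfl⟩
        have : row fi D env t ∈ Y ∩ Z := ⟨(k t).1 h, hs⟩
        rw [hdis] at this
        exact this
  · rintro ⟨Φ, h1, h2⟩
    refine ⟨_, _, ?_, ?_, h1, h2⟩
    · ext s
      constructor
      · rintro (⟨t, ⟨ht, _⟩, rfl⟩ | ⟨t, ⟨ht, _⟩, rfl⟩) <;> exact ⟨t, ht, rfl⟩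
      · rintro ⟨t, ht, rfl⟩
        by_cases h : Φ true (fun v : D => (env v).realize fi t) =
          Φ false (fun v : D => (env v).realize fi t)
        · exact Or.inl ⟨t, ⟨ht, h⟩, rfl⟩
        · exact Or.inr ⟨t, ⟨ht, h⟩, rfl⟩
    · ext s
      simp only [Set.mem_inter_iff, Set.mem_empty_iff_false, iff_false]
      rintro ⟨⟨t, ⟨_, h⟩, rfl⟩, ⟨t', ⟨_, h'⟩, e⟩⟩
      have : (fun v : D => (env v).realize fi t) = (fun v : D => (env v).realize fi t') := by
        funext v
        have := congrFun e v
        rwa [row_mem fi env t v.2, row_mem fi env t' v.2, Option.some_inj] at this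
      rw [this] at h
      exact h' h

theorem row_update {A : Type w} [L.Structure A] (fi : ∀ f : F, (Fin (ar f) → A) → A)
    (D : Finset ℕ) (env : ℕ → ETerm L F ar) (v : ℕ) (e : ETerm L F ar) (t : ℕ → A) :
    row fi (insert v D) (Function.update env v e) t =
      Function.update (row fi D env t) v (some (e.realize fi t)) := by
  funext n
  by_cases h : n = v
  · subst h
    simp [row, asg]
  · by_cases h' : n ∈ D <;> simp [row, asg, h, h']

theorem texpr_ex {φ : TF L} (v : ℕ)
    (hφ : ∀ (F : Type) (ar : F → ℕ) (env : ℕ → ETerm L F ar) (act : EQF L F ar),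
      (∀ x ∈ insert v D, (env x).varsLT i) → act.varsLT i →
        TExpr.{u, v, w} r (insert v D) env act φ)
    (henv : ∀ v ∈ D, (env v).varsLT i) (hact : act.varsLT i) :
    TExpr.{u, v, w} r D env act (.ex v φ) := by
  classical
  let ι : Unit → Type := fun _ => D
  let g : ETerm L (F ⊕ Unit) (Sum.elim ar (fun h => Fintype.card (ι h))) :=
    appT ι () (fun v : D => liftT (env v))
  have hg : g.varsLT i := varsLT_appT fun v : D =>
    ETerm.varsLT_mapS (henv v v.2)
  refine (Expr.ex ι (hφ _ _ (Function.update (fun v => liftT (env v)) v g) (liftQ act)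
    ?_ (EQF.varsLT_mapS hact))).congr ?_
  · intro x hx
    by_cases h : x = v
    · subst h; simpa using hg
    · simp only [Function.update, h, dif_neg, not_false_eq_true]
      exact ETerm.varsLT_mapS (henv x ((Finset.mem_insert.1 hx).resolve_left h))
  intro A _ hA fi
  have a0 : A := Classical.arbitrary A
  have e1 : ∀ Φ : ∀ h, (ι h → A) → A,
      team (extI fi ι Φ) (insert v D) (Function.update (fun v => liftT (env v)) v g) (liftQ act) =
      {s | ∃ t : ℕ → A, act.realize fi t ∧ s = Function.update (row fi D env t) v
        (some (Φ () (fun v : D => (env v).realize fi t)))} := by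
    intro Φ
    simp only [team, row_update, realize_liftQ, g, realize_appT]
    simp only [row, realize_liftT]
    rfl
  simp only [e1, strictSat]
  constructor
  · rintro ⟨f, h⟩
    refine ⟨fun _ w => f (asg D w), ?_⟩
    convert h using 1
    ext s
    constructor
    · rintro ⟨t, ht, rfl⟩
      exact ⟨row fi D env t, ⟨t, ht, rfl⟩, rfl⟩
    · rintro ⟨_, ⟨t, ht, rfl⟩, rfl⟩
      exact ⟨t, ht, rfl⟩
  · rintro ⟨Φ, h⟩
    refine ⟨fun s => Φ () (fun v : D => (s v).getD a0), ?_⟩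
    have k : ∀ t : ℕ → A, (fun v : D => (row fi D env t v).getD a0) =
        fun v : D => (env v).realize fi t := by
      intro t
      funext v
      rw [row_mem fi env t v.2]
      rfl
    convert h using 1
    ext s
    constructor
    · rintro ⟨_, ⟨t, ht, rfl⟩, rfl⟩
      refine ⟨t, ht, ?_⟩
      dsimp only
      rw [k]
    · rintro ⟨t, ht, rfl⟩
      refine ⟨row fi D env t, ⟨t, ht, rfl⟩, ?_⟩
      dsimp only
      rw [k]

theorem texpr_all {φ : TF L} (v : ℕ)
    (hφ : ∀ (F : Type) (ar : F → ℕ) (env : ℕ → ETerm L F ar) (act : EQF L F ar),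
      (∀ x ∈ insert v D, (env x).varsLT (i + 1)) → act.varsLT (i + 1) →
        TExpr.{u, v, w} r (insert v D) env act φ)
    (henv : ∀ v ∈ D, (env v).varsLT i) (hact : act.varsLT i) :
    TExpr.{u, v, w} r D env act (.all v φ) := by
  classical
  refine Expr.congr (hφ _ _ (Function.update env v (.var i)) act
    ?_ (EQF.varsLT_mono (by omega) hact)) ?_
  · intro x hx
    by_cases h : x = v
    · subst h; simp [ETerm.varsLT]
    · simp only [Function.update, h, dif_neg, not_false_eq_true]
      exact ETerm.varsLT_mono (by omega) (henv x ((Finset.mem_insert.1 hx).resolve_left h))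
  intro A _ hA fi
  have : {t | ∃ s ∈ team fi D env act, ∃ m : A, t = Function.update s v (some m)} =
      team fi (insert v D) (Function.update env v (.var i)) act := by
    ext s
    constructor
    · rintro ⟨_, ⟨t, ht, rfl⟩, m, rfl⟩
      have hh : ∀ n < i, t n = Function.update t i m n := by
        intro n hn
        have : n ≠ i := by omega
        simp [this]
      refine ⟨Function.update t i m, (EQF.realize_congr fi hh hact).1 ht, ?_⟩
      rw [row_update]
      congr 1
      · funext n
        by_cases hn : n ∈ D
        · rw [row_mem fi env _ hn, row_mem fi env _ hn,
            ETerm.realize_congr fi hh (henv n hn)]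
        · simp [row, asg, hn]
      · simp [ETerm.realize]
    · rintro ⟨t, ht, rfl⟩
      refine ⟨_, ⟨t, ht, rfl⟩, t i, ?_⟩
      rw [row_update]
      rfl
  simp only [strictSat, this]

end cases

abbrev IndSym (i : ℕ) (Z : Finset ℕ) : Type := Z ⊕ ((Fin i × Z) ⊕ (Fin i ⊕ (Fin (i + 1) × Z)))

abbrev indIdx (i : ℕ) (X Z : Finset ℕ) : IndSym i Z → Type :=
  Sum.elim (fun _ => X) (Sum.elim (fun _ => X ⊕ (Z ⊕ Unit)) (fun _ => X ⊕ Z))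

noncomputable instance indFin (i : ℕ) (X Z : Finset ℕ) (h : IndSym i Z) :
    Fintype (indIdx i X Z h) := by
  rcases h with h | h | h
  · exact inferInstanceAs (Fintype X)
  · exact inferInstanceAs (Fintype (X ⊕ (Z ⊕ Unit)))
  · exact inferInstanceAs (Fintype (X ⊕ Z))

theorem texpr_indep {r i : ℕ} {D : Finset ℕ} {env : ℕ → ETerm L F ar} {act : EQF L F ar}
    (hir : i < r) (henv : ∀ v ∈ D, (env v).varsLT i) (hact : act.varsLT i)
    (xs ys zs : List ℕ) (hfv : freeVars (L := L) (.indep xs ys zs) ⊆ (D : Set ℕ)) :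
    TExpr.{u, v, w} r D env act (.indep xs ys zs) := by
  classical
  have hx : ∀ v ∈ xs, v ∈ D := fun v hv => hfv (by simp [freeVars, hv])
  have hy : ∀ v ∈ ys, v ∈ D := fun v hv => hfv (by simp [freeVars, hv])
  have hz : ∀ v ∈ zs, v ∈ D := fun v hv => hfv (by simp [freeVars, hv])
  obtain ⟨X, hX⟩ : ∃ X : Finset ℕ, X = xs.toFinset := ⟨_, rfl⟩
  obtain ⟨Y, hY⟩ : ∃ Y : Finset ℕ, Y = ys.toFinset := ⟨_, rfl⟩
  obtain ⟨Z, hZ⟩ : ∃ Z : Finset ℕ, Z = zs.toFinset := ⟨_, rfl⟩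
  have hXD : ∀ v : X, (v : ℕ) ∈ D := fun v => hx _ (List.mem_toFinset.1 ((Finset.ext_iff.1 hX v).1 v.2))
  have hYD : ∀ v : Y, (v : ℕ) ∈ D := fun v => hy _ (List.mem_toFinset.1 ((Finset.ext_iff.1 hY v).1 v.2))
  have hZD : ∀ v : Z, (v : ℕ) ∈ D := fun v => hz _ (List.mem_toFinset.1 ((Finset.ext_iff.1 hZ v).1 v.2))
  let ι := indIdx i X Z
  let F' := F ⊕ IndSym i Z
  let ar' : F' → ℕ := Sum.elim ar (fun h => Fintype.card (ι h))
  let env' : ℕ → ETerm L F' ar' := fun v => liftT (env v)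
  let act' : EQF L F' ar' := liftQ act
  let tR : Z → ETerm L F' ar' := fun b => appT ι (.inl b) (fun v : X => env' v)
  let tC : Fin i → (Z → ETerm L F' ar') → ETerm L F' ar' → Z → ETerm L F' ar' := fun j e u b =>
    appT ι (.inr (.inl (j, b)))
      (Sum.elim (fun v : X => env' v) (Sum.elim e (fun _ : Unit => u)))
  let tW : Fin i → ETerm L F' ar' := fun j => appT ι (.inr (.inr (.inl j)))
      (Sum.elim (fun v : X => env' v) (fun v : Z => env' v))
  let tV : Fin (i + 1) → Z → ETerm L F' ar' := fun j b => appT ι (.inr (.inr (.inr (j, b))))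
      (Sum.elim (fun v : X => env' v) (fun v : Z => env' v))
  have hact' : act'.varsLT i := EQF.varsLT_mapS hact
  have henv' : ∀ v ∈ D, (env' v).varsLT i := fun v hv => ETerm.varsLT_mapS (henv v hv)
  have htR : ∀ b, (tR b).varsLT i := fun b => varsLT_appT fun v : X => henv' v (hXD v)
  have htC : ∀ j e u b n, i ≤ n → (∀ b, (e b).varsLT n) → u.varsLT n → (tC j e u b).varsLT n := by
    intro j e u b n hn he hu
    refine varsLT_appT ?_
    rintro (v | v | v)
    · exact ETerm.varsLT_mono hn (henv' v (hXD v))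
    · exact he v
    · exact hu
  have htW : ∀ j, (tW j).varsLT i := by
    intro j
    refine varsLT_appT ?_
    rintro (v | v)
    · exact henv' v (hXD v)
    · exact henv' v (hZD v)
  have htV : ∀ j b, (tV j b).varsLT i := by
    intro j b
    refine varsLT_appT ?_
    rintro (v | v)
    · exact henv' v (hXD v)
    · exact henv' v (hZD v)
  let same : (Z → ETerm L F' ar') → List (ETerm L F' ar' × ETerm L F' ar') := fun e =>
    X.attach.toList.map (fun v : X => (env' v, env' v)) ++
      (Y.attach.toList.map (fun v : Y => (env' v, env' v)) ++
        Z.attach.toList.map (fun b : Z => (env' b, e b)))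
  have hsame : ∀ e, (∀ b, (e b).varsLT r) → ∀ p ∈ same e, p.1.varsLT i ∧ p.2.varsLT r := by
    intro e he p hp
    rcases List.mem_append.1 hp with hp | hp
    · obtain ⟨v, _, rfl⟩ := List.mem_map.1 hp
      exact ⟨henv' v (hXD v), ETerm.varsLT_mono hir.le (henv' v (hXD v))⟩
    rcases List.mem_append.1 hp with hp | hp
    · obtain ⟨v, _, rfl⟩ := List.mem_map.1 hp
      exact ⟨henv' v (hYD v), ETerm.varsLT_mono hir.le (henv' v (hYD v))⟩
    · obtain ⟨v, _, rfl⟩ := List.mem_map.1 hp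
      exact ⟨henv' v (hZD v), he v⟩
  let eqsV : (Z → ETerm L F' ar') → (Z → ETerm L F' ar') →
      List (ETerm L F' ar' × ETerm L F' ar') := fun e e' =>
    Z.attach.toList.map (fun b : Z => (e b, e' b))
  have heqsV : ∀ e e', (∀ b, (e b).varsLT r) → (∀ b, (e' b).varsLT r) →
      ∀ p ∈ eqsV e e', p.1.varsLT r ∧ p.2.varsLT r := by
    intro e e' he he' p hp
    obtain ⟨v, _, rfl⟩ := List.mem_map.1 hp
    exact ⟨he v, he' v⟩
  have up : ∀ {t : ETerm L F' ar'}, t.varsLT i → t.varsLT r := fun h => ETerm.varsLT_mono hir.le h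
  have hactr : act'.varsLT r := EQF.varsLT_mono hir.le hact'
  have q := fun e e' (he : ∀ b, (e b).varsLT r) (he' : ∀ b, (e' b).varsLT r) =>
    Expr.qf.{u, v, w} (act'.imp (act'.eqs (eqsV e e')))
      (EQF.varsLT_imp hactr (EQF.varsLT_eqs hactr (heqsV e e' he he')))
  refine (Expr.ex ι
    ((Expr.rows hir.le act' hact' (same tR) (hsame _ fun b => up (htR b))).and
    ((Expr.forall_fin (by omega) i fun j => Expr.rows hir.le act' hact'
        (same (tC j (fun v : Z => env' v) (.var i)))
        (hsame _ fun b => htC _ _ _ _ _ hir.le (fun v => up (henv' v (hZD v))) hir)).and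
    ((q (tV 0) tR (fun b => up (htV _ b)) (fun b => up (htR b))).and
    ((q (tV (Fin.last i)) (fun v : Z => env' v) (fun b => up (htV _ b))
        (fun v => up (henv' v (hZD v)))).and
    (Expr.forall_fin (by omega) i fun j : Fin i =>
      q (tV j.succ) (tC j (tV j.castSucc) (tW j)) (fun b => up (htV _ b))
        (fun b => htC _ _ _ _ _ hir.le (fun v => up (htV _ v)) (up (htW j)))
      )))))).congr ?_
  intro A _ hA fi
  have hmX : ∀ s s' : ℕ → A, xs.map (row fi D env s) = xs.map (row fi D env s') ↔
      (fun v : X => (env v).realize fi s) = (fun v : X => (env v).realize fi s') := by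
    intro s s'
    rw [map_eq_map_row fi env s s' xs hx, funext_iff, Subtype.forall]
    simp [hX]
  have hmY : ∀ s s' : ℕ → A, ys.map (row fi D env s) = ys.map (row fi D env s') ↔
      (fun v : Y => (env v).realize fi s) = (fun v : Y => (env v).realize fi s') := by
    intro s s'
    rw [map_eq_map_row fi env s s' ys hy, funext_iff, Subtype.forall]
    simp [hY]
  have hmZ : ∀ s s' : ℕ → A, zs.map (row fi D env s) = zs.map (row fi D env s') ↔
      (fun v : Z => (env v).realize fi s) = (fun v : Z => (env v).realize fi s') := by
    intro s s'
    rw [map_eq_map_row fi env s s' zs hz, funext_iff, Subtype.forall]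
    simp [hZ]
  have rA : ∀ (Φ : ∀ h, (ι h → A) → A) s, act'.realize (extI fi ι Φ) s ↔ act.realize fi s :=
    fun Φ s => realize_liftQ fi ι Φ act s
  have rE : ∀ (Φ : ∀ h, (ι h → A) → A) s v,
      (env' v).realize (extI fi ι Φ) s = (env v).realize fi s :=
    fun Φ s v => realize_liftT fi ι Φ (env v) s
  have rSame : ∀ (Φ : ∀ h, (ι h → A) → A) e s s',
      (∀ p ∈ same e, p.1.realize (extI fi ι Φ) s' = p.2.realize (extI fi ι Φ) s) ↔
      ((fun v : X => (env v).realize fi s') = (fun v : X => (env v).realize fi s) ∧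
      (fun v : Y => (env v).realize fi s') = (fun v : Y => (env v).realize fi s) ∧
      (fun v : Z => (env v).realize fi s') = (fun v : Z => (e v).realize (extI fi ι Φ) s)) := by
    intro Φ e s s'
    simp only [same, List.forall_mem_append, List.forall_mem_map, Finset.mem_toList,
      Finset.mem_attach, true_imp_iff, rE, funext_iff]
  have rQ : ∀ (Φ : ∀ h, (ι h → A) → A) e e' s,
      (act'.imp (act'.eqs (eqsV e e'))).realize (extI fi ι Φ) s ↔
      (act.realize fi s → (fun v : Z => (e v).realize (extI fi ι Φ) s) =
        (fun v : Z => (e' v).realize (extI fi ι Φ) s)) := by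
    intro Φ e e' s
    rw [EQF.realize_imp, EQF.realize_eqs, rA]
    simp only [eqsV, List.forall_mem_map, Finset.mem_toList,
      Finset.mem_attach, true_imp_iff, funext_iff]
    tauto
  have rR : ∀ (Φ : ∀ h, (ι h → A) → A) s b, (tR b).realize (extI fi ι Φ) s =
      Φ (.inl b) (fun v : X => (env v).realize fi s) := by
    intro Φ s b
    refine (realize_appT fi ι Φ _ _ s).trans (congrArg (Φ _) (funext ?_))
    intro v
    exact rE Φ s (v : X).1
  have rC : ∀ (Φ : ∀ h, (ι h → A) → A) s j e u b, (tC j e u b).realize (extI fi ι Φ) s =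
      Φ (.inr (.inl (j, b))) (Sum.elim (fun v : X => (env v).realize fi s)
        (Sum.elim (fun v : Z => (e v).realize (extI fi ι Φ) s)
          (fun _ => u.realize (extI fi ι Φ) s))) := by
    intro Φ s j e u b
    refine (realize_appT fi ι Φ _ _ s).trans (congrArg (Φ _) (funext ?_))
    intro v
    rcases v with v | v | v
    · exact rE Φ s v
    · rfl
    · rfl
  have rW : ∀ (Φ : ∀ h, (ι h → A) → A) s j, (tW j).realize (extI fi ι Φ) s =
      Φ (.inr (.inr (.inl j))) (Sum.elim (fun v : X => (env v).realize fi s)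
        (fun v : Z => (env v).realize fi s)) := by
    intro Φ s j
    refine (realize_appT fi ι Φ _ _ s).trans (congrArg (Φ _) (funext ?_))
    intro v
    rcases v with v | v
    · exact rE Φ s v
    · exact rE Φ s v
  have rV : ∀ (Φ : ∀ h, (ι h → A) → A) s j b, (tV j b).realize (extI fi ι Φ) s =
      Φ (.inr (.inr (.inr (j, b)))) (Sum.elim (fun v : X => (env v).realize fi s)
        (fun v : Z => (env v).realize fi s)) := by
    intro Φ s j b
    refine (realize_appT fi ι Φ _ _ s).trans (congrArg (Φ _) (funext ?_))
    intro v
    rcases v with v | v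
    · exact rE Φ s v
    · exact rE Φ s v
  rw [strictSat, forall_team]
  simp only [forall_team, exists_team, hmX, hmY, hmZ]
  refine (indep_sem i (fun s => act.realize fi s) (fun s => (fun v : X => (env v).realize fi s))
    (fun s => (fun v : Y => (env v).realize fi s)) (fun s => (fun v : Z => (env v).realize fi s))
    ?_).trans ?_
  · intro s s' h
    refine ⟨EQF.realize_congr fi h hact, ?_, ?_, ?_⟩
    · exact funext fun v => ETerm.realize_congr fi h (henv v (hXD v))
    · exact funext fun v => ETerm.realize_congr fi h (henv v (hYD v))
    · exact funext fun v => ETerm.realize_congr fi h (henv v (hZD v))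
  simp only [rA, rSame, rQ, rR, rC, rV, rW, rE, ETerm.realize]
  constructor
  · rintro ⟨R, C, W, V, h1, h2, h3⟩
    let Φ : ∀ h, (ι h → A) → A := fun h => match h with
      | .inl b => fun w => R w b
      | .inr (.inl (j, b)) => fun w => C j (fun v => w (.inl v)) (fun v => w (.inr (.inl v)))
          (w (.inr (.inr ()))) b
      | .inr (.inr (.inl j)) => fun w => W j (fun v => w (.inl v)) (fun v => w (.inr v))
      | .inr (.inr (.inr (j, b))) => fun w => V j (fun v => w (.inl v)) (fun v => w (.inr v)) b
    exact ⟨Φ, h1, h2, fun s hs => (h3 s hs).1, fun s hs => (h3 s hs).2.1,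
      fun j s hs => (h3 s hs).2.2 j⟩
  · rintro ⟨Φ, h1, h2, h3, h4, h5⟩
    exact ⟨fun x b => Φ (.inl b) x,
      fun j x z u b => Φ (.inr (.inl (j, b))) (Sum.elim x (Sum.elim z (fun _ => u))),
      fun j x z => Φ (.inr (.inr (.inl j))) (Sum.elim x z),
      fun j x z b => Φ (.inr (.inr (.inr (j, b)))) (Sum.elim x z),
      h1, h2, fun s hs => ⟨h3 s hs, h4 s hs, fun j => h5 j s hs⟩⟩

theorem texpr_main (r : ℕ) (φ : TF L) : ∀ (i : ℕ) (D : Finset ℕ),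
    freeVars φ ⊆ (D : Set ℕ) → i + uCount φ < r →
    ∀ (F : Type) (ar : F → ℕ) (env : ℕ → ETerm L F ar) (act : EQF L F ar),
      (∀ v ∈ D, (env v).varsLT i) → act.varsLT i → TExpr.{u, v, w} r D env act φ := by
  have hins : ∀ (S : Set ℕ) (v : ℕ) (D : Finset ℕ), S \ {v} ⊆ (D : Set ℕ) →
      S ⊆ ((insert v D : Finset ℕ) : Set ℕ) := by
    intro S v D h x hx
    by_cases hxv : x = v
    · simp [hxv]
    · have : x ∈ D := h ⟨hx, hxv⟩
      simp [this]
  induction φ with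
  | rel R ts =>
    intro i D hfv hi F ar env act henv hact
    exact texpr_rel (by simpa [uCount] using hi) henv hact R ts hfv
  | nrel R ts =>
    intro i D hfv hi F ar env act henv hact
    exact texpr_nrel (by simpa [uCount] using hi) henv hact R ts hfv
  | teq t u =>
    intro i D hfv hi F ar env act henv hact
    exact texpr_teq (by simpa [uCount] using hi) henv hact t u hfv
  | tne t u =>
    intro i D hfv hi F ar env act henv hact
    exact texpr_tne (by simpa [uCount] using hi) henv hact t u hfv
  | dep xs y =>
    intro i D hfv hi F ar env act henv hact
    exact texpr_dep (by simpa [uCount] using hi) henv hact xs y hfv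
  | indep xs ys zs =>
    intro i D hfv hi F ar env act henv hact
    exact texpr_indep (by simpa [uCount] using hi) henv hact xs ys zs hfv
  | inc xs ys =>
    intro i D hfv hi F ar env act henv hact
    exact texpr_inc (by simpa [uCount] using hi) henv hact xs ys hfv
  | and φ ψ h1 h2 =>
    intro i D hfv hi F ar env act henv hact
    simp only [freeVars, Set.union_subset_iff] at hfv
    simp only [uCount] at hi
    exact ((h1 i D hfv.1 (by omega) F ar env act henv hact).and
      (h2 i D hfv.2 (by omega) F ar env act henv hact)).congr fun A _ _ fi => by
        simp only [strictSat]
  | or φ ψ h1 h2 =>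
    intro i D hfv hi F ar env act henv hact
    simp only [freeVars, Set.union_subset_iff] at hfv
    simp only [uCount] at hi
    exact texpr_or (h1 i D hfv.1 (by omega)) (h2 i D hfv.2 (by omega)) henv hact
  | ex v φ h =>
    intro i D hfv hi F ar env act henv hact
    simp only [freeVars] at hfv
    simp only [uCount] at hi
    exact texpr_ex v (h i (insert v D) (hins _ _ _ hfv) hi) henv hact
  | all v φ h =>
    intro i D hfv hi F ar env act henv hact
    simp only [freeVars] at hfv
    simp only [uCount] at hi
    exact texpr_all v (h (i + 1) (insert v D) (hins _ _ _ hfv) (by omega)) henv hact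

theorem to_eso_aux (k : ℕ) (ψ : TF L) (hsent : freeVars ψ = ∅) (huk : uCount ψ ≤ k) :
    ∃ (n : ℕ) (ar : Fin n → ℕ) (r : ℕ) (θ : EQF L (Fin n) ar),
      r ≤ k + 1 ∧ θ.varsLT r ∧
      ∀ (A : Type w) [L.Structure A], (∃ a b : A, a ≠ b) →
        (tTrue A ψ ↔ esoTrue A θ) := by
  let ar0 : Unit → ℕ := fun _ => 0
  let c : ETerm L Unit ar0 := .efunc () Fin.elim0
  have hc : c.varsLT 0 := fun i => i.elim0
  obtain ⟨G, hG, arG, θ, h1, h2⟩ := texpr_main.{u, v, w} (k + 1) ψ 0 ∅ (by simp [hsent])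
    (by omega) Unit ar0 (fun _ => c) (.teq c c) (by simp) ⟨hc, hc⟩
  obtain ⟨n, ⟨e⟩⟩ := Finite.exists_equiv_fin (Unit ⊕ G)
  have hσ : ∀ f, (fun j => Sum.elim ar0 arG (e.symm j)) (e f) = Sum.elim ar0 arG f := by
    intro f
    simp
  refine ⟨n, fun j => Sum.elim ar0 arG (e.symm j), k + 1, θ.mapS e hσ, le_rfl,
    EQF.varsLT_mapS h1, ?_⟩
  intro A _ hA
  have hA : Nontrivial A := ⟨hA⟩
  have a0 : A := Classical.arbitrary A
  have ht : ∀ fi : (∀ f : Unit, (Fin (ar0 f) → A) → A),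
      team fi ∅ (fun _ => c) (.teq c c) = {emptyAssign A} := by
    intro fi
    ext s
    have : ∀ t : ℕ → A, row fi ∅ (fun _ => c) t = emptyAssign A := by
      intro t
      funext n
      simp [row, asg, emptyAssign]
    simp only [team, EQF.realize, this, Set.mem_ofPred_eq, true_and, Set.mem_singleton_iff]
    exact ⟨fun ⟨_, h⟩ => h, fun h => ⟨fun _ => a0, h⟩⟩
  have h2' : ∀ fi : (∀ f : Unit, (Fin (ar0 f) → A) → A), tTrue A ψ ↔ _ := fun fi => by
    have := h2 A hA fi
    simp only [ht] at this
    exact this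
  constructor
  · intro h
    obtain ⟨gi, hg⟩ := (h2' (fun _ _ => a0)).1 h
    refine ⟨fun j => (Sum.rec (fun _ _ => a0) gi :
      ∀ f : Unit ⊕ G, (Fin (Sum.elim ar0 arG f) → A) → A) (e.symm j), fun s => ?_⟩
    refine (EQF.realize_mapS _ e hσ _ ?_ s θ).2 (hg s)
    intro f v
    have key : ∀ (I : ∀ f : Unit ⊕ G, (Fin (Sum.elim ar0 arG f) → A) → A)
        (f f' : Unit ⊕ G) (hf : f' = f) (h : Sum.elim ar0 arG f' = Sum.elim ar0 arG f)
        (v : Fin (Sum.elim ar0 arG f) → A), I f' (fun i => v (Fin.cast h i)) = I f v := by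
      intro I f f' hf h v
      subst hf
      rfl
    exact key _ f (e.symm (e f)) (e.symm_apply_apply f) (hσ f) v
  · rintro ⟨fi, h⟩
    let I : ∀ f : Unit ⊕ G, (Fin (Sum.elim ar0 arG f) → A) → A :=
      fun f v => fi (e f) (fun i => v (Fin.cast (hσ f) i))
    refine (h2' (fun f => I (.inl f))).2 ⟨fun g => I (.inr g), fun s => ?_⟩
    refine (EQF.realize_mapS _ e hσ fi ?_ s θ).1 (h s)
    rintro (f | f) v <;> rfl

end Helpers

end TeamSem

namespace TeamSem

/-- For every sentence `ψ ∈ FO(=(…), ⊥_c, ⊆)(k∀)` there is a sentence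
`τ_ψ ∈ ESO_f((k+1)∀)` (in Skolem normal form `∃f₁…∃fₙ ∀x₁…∀x_r θ` with `r ≤ k+1`
and `θ` quantifier-free) such that for all structures `A` with at least two
elements, `A ⊨ ψ` under strict team semantics iff `A ⊨ τ_ψ`. -/
theorem to_eso {L : FirstOrder.Language.{u, v}} (k : ℕ) (ψ : TF L)
    (hsent : freeVars ψ = ∅) (hnodup : (boundVars ψ).Nodup) (huk : uCount ψ ≤ k) :
    ∃ (n : ℕ) (ar : Fin n → ℕ) (r : ℕ) (θ : EQF L (Fin n) ar),
      r ≤ k + 1 ∧ θ.varsLT r ∧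
      ∀ (A : Type w) [L.Structure A], (∃ a b : A, a ≠ b) →
        (tTrue A ψ ↔ esoTrue A θ) := by
  exact to_eso_aux.{u, v, w} k ψ hsent huk

end TeamSem
end
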